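/- There exists an infinite-dimensional separable real Banach space X which is an L∞-space, is hereditarily indecomposable, contains no infinite-dimensional reflexive closed subspace, and is not L∞-saturated: X has an infinite-dimensional closed subspace W such that no infinite-dimensional closed subspace of W is an L∞-space. -/

import Mathlib

noncomputable section

/-- A Banach space is an `L∞`-space with constant `C` if it admits an increasing sequence
of finite-dimensional subspaces with dense union, each of which is `C`-isomorphic to
`ℝ^n` (of the corresponding dimension `n`) with the supremum norm. -/
def IsLinftySpaceWith (C : ℝ) (X : Type*) [SeminormedAddCommGroup X] [NormedSpace ℝ X] :
    Prop :=
  ∃ F : ℕ → Submodule ℝ X, Monotone F ∧ (∀ n, FiniteDimensional ℝ ↥(F n)) ∧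
    Dense (⋃ n, (F n : Set X)) ∧
    ∀ n, ∃ T : ↥(F n) ≃L[ℝ] (Fin (Module.finrank ℝ ↥(F n)) → ℝ),
      ‖(T : ↥(F n) →L[ℝ] (Fin (Module.finrank ℝ ↥(F n)) → ℝ))‖ *
        ‖(T.symm : (Fin (Module.finrank ℝ ↥(F n)) → ℝ) →L[ℝ] ↥(F n))‖ ≤ C

/-- An `L∞`-space: an `L∞,C`-space for some constant `C ≥ 1`. -/
def IsLinftySpace (X : Type*) [SeminormedAddCommGroup X] [NormedSpace ℝ X] : Prop :=
  ∃ C : ℝ, 1 ≤ C ∧ IsLinftySpaceWith C X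

/-- A space is hereditarily indecomposable if no infinite-dimensional closed subspace is
the topological direct sum of two infinite-dimensional closed subspaces. -/
def HereditarilyIndecomposable (X : Type*) [SeminormedAddCommGroup X] [NormedSpace ℝ X] :
    Prop :=
  ∀ Z U V : Submodule ℝ X, IsClosed (Z : Set X) → ¬FiniteDimensional ℝ ↥Z →
    IsClosed (U : Set X) → IsClosed (V : Set X) →
    ¬FiniteDimensional ℝ ↥U → ¬FiniteDimensional ℝ ↥V → U ⊓ V = ⊥ → U ⊔ V ≠ Z

/-- The scalar-plus-compact property: every bounded linear operator on `X` is a scalar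
multiple of the identity plus a compact operator. -/
def ScalarPlusCompact (X : Type*) [SeminormedAddCommGroup X] [NormedSpace ℝ X] : Prop :=
  ∀ T : X →L[ℝ] X, ∃ (c : ℝ) (K : X →L[ℝ] X),
    IsCompactOperator K ∧ T = c • ContinuousLinearMap.id ℝ X + K

/-- A Banach space is reflexive if the canonical inclusion into its double dual is
surjective. -/
def IsReflexiveSpace (X : Type*) [SeminormedAddCommGroup X] [NormedSpace ℝ X] : Prop :=
  Function.Surjective (NormedSpace.inclusionInDoubleDual ℝ X)

/-- `X` contains no infinite-dimensional reflexive closed subspace. -/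
def NoReflexiveSubspace (X : Type*) [NormedAddCommGroup X] [NormedSpace ℝ X] : Prop :=
  ∀ Y : Submodule ℝ X, IsClosed (Y : Set X) → ¬FiniteDimensional ℝ ↥Y →
    ¬IsReflexiveSpace ↥Y

/-- `X` is reflexively saturated: every infinite-dimensional closed subspace contains an
infinite-dimensional reflexive closed subspace. -/
def ReflexivelySaturated (X : Type*) [NormedAddCommGroup X] [NormedSpace ℝ X] : Prop :=
  ∀ Y : Submodule ℝ X, IsClosed (Y : Set X) → ¬FiniteDimensional ℝ ↥Y →
    ∃ Z : Submodule ℝ X, Z ≤ Y ∧ IsClosed (Z : Set X) ∧ ¬FiniteDimensional ℝ ↥Z ∧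
      IsReflexiveSpace ↥Z

/-- The space `ℓ₁` of absolutely summable real sequences. -/
abbrev EllOne : Type := lp (fun _ : ℕ => ℝ) 1

/-- The space `c₀` of real null sequences with the supremum norm. -/
abbrev CZero : Type := ZeroAtInftyContinuousMap ℕ ℝ

namespace BDSpace

/-! ### Parameters -/

/-- The pair `(m j, N j)` of the inverse weight and the maximal age at level `j`. -/
def params : ℕ → ℕ × ℕ
  | 0 => (4, 64)
  | j + 1 =>
    (64 * (params j).1 * (params j).2,
      (j + 1 + (64 * (params j).1 * (params j).2) * (2 * (params j).2 + 2)) ^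
        (64 * (params j).1 * (params j).2 + 3))

/-- The inverse of the weight of level `j`. -/
def mw (j : ℕ) : ℕ := (params j).1

/-- The maximal age of a node of level `j`. -/
def ageBound (j : ℕ) : ℕ := (params j).2

lemma mw_succ (j : ℕ) : mw (j + 1) = 64 * mw j * ageBound j := rfl

lemma ageBound_succ (j : ℕ) : ageBound (j + 1) =
    (j + 1 + mw (j + 1) * (2 * ageBound j + 2)) ^ (mw (j + 1) + 3) := rfl

lemma ageBound_pos (j : ℕ) : 1 ≤ ageBound j := by
  cases j with
  | zero => decide
  | succ j => rw [ageBound_succ]; exact Nat.one_le_pow _ _ (by omega)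

lemma four_le_mw (j : ℕ) : 4 ≤ mw j := by
  induction j with
  | zero => decide
  | succ j ih => rw [mw_succ]; nlinarith [ageBound_pos j]

lemma two_mul_mw_le (j : ℕ) : 2 * mw j ≤ mw (j + 1) := by
  rw [mw_succ]; nlinarith [ageBound_pos j, four_le_mw j]

lemma mw_strictMono : StrictMono mw :=
  strictMono_nat_of_lt_succ fun j => by have := two_mul_mw_le j; have := four_le_mw j; omega

lemma mw_mono {i j : ℕ} (h : i ≤ j) : mw i ≤ mw j := mw_strictMono.monotone h

lemma lt_mw (j : ℕ) : j < mw j := by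
  induction j with
  | zero => decide
  | succ j ih => have := two_mul_mw_le j; have := four_le_mw j; omega

lemma mw_sq_le (j : ℕ) : 2 * mw j * mw j ≤ ageBound j := by
  cases j with
  | zero => decide +revert
  | succ j =>
    rw [ageBound_succ]
    set M := mw (j + 1)
    have hM : 4 ≤ M := four_le_mw _
    have h1 : 2 * M ≤ j + 1 + M * (2 * ageBound j + 2) := by nlinarith [ageBound_pos j]
    calc 2 * M * M ≤ (2 * M) ^ 2 := by nlinarith
      _ ≤ (2 * M) ^ (M + 3) := Nat.pow_le_pow_right (by omega) (by omega)
      _ ≤ _ := Nat.pow_le_pow_left h1 _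

lemma ageBound_mono {i j : ℕ} (h : i ≤ j) : ageBound i ≤ ageBound j := by
  refine monotone_nat_of_le_succ (fun j => ?_) h
  rw [ageBound_succ]
  have hM : 4 ≤ mw (j + 1) := four_le_mw _
  have h1 : ageBound j ≤ j + 1 + mw (j + 1) * (2 * ageBound j + 2) := by nlinarith
  exact h1.trans (Nat.le_self_pow (by omega) _)

/-- The growth of the ages needed for the estimate of averages of rapidly increasing sequences. -/
lemma ageBound_growth (j : ℕ) :
    2 * mw (j + 1) * ageBound j * ((2 * ageBound j + 2) ^ mw (j + 1) + mw (j + 1)) ≤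
      ageBound (j + 1) := by
  rw [ageBound_succ]
  set M := mw (j + 1)
  set b := j + 1 + M * (2 * ageBound j + 2)
  have hM : 4 ≤ M := four_le_mw _
  have hN := ageBound_pos j
  have hb1 : M ≤ b := by simp only [b]; nlinarith
  have hb2 : 2 * ageBound j + 2 ≤ b := by simp only [b]; nlinarith
  have hb3 : b ≤ b ^ M := Nat.le_self_pow (by omega) _
  calc 2 * M * ageBound j * ((2 * ageBound j + 2) ^ M + M)
      ≤ 2 * b * ageBound j * (b ^ M + b ^ M) := by
        gcongr
        exact hb1.trans hb3
    _ = b * (2 * (2 * ageBound j)) * b ^ M := by ring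
    _ ≤ b * (b * b) * b ^ M := by
        gcongr
        · omega
        · omega
    _ = b ^ (M + 3) := by ring

lemma pow_le_ageBound {n j : ℕ} (hj : n ≤ j) (h1 : 1 ≤ j) : n ^ mw j ≤ ageBound j := by
  obtain ⟨i, rfl⟩ : ∃ i, j = i + 1 := ⟨j - 1, by omega⟩
  rw [ageBound_succ]
  have hb : n ≤ i + 1 + mw (i + 1) * (2 * ageBound i + 2) := by omega
  have hb0 : 0 < i + 1 + mw (i + 1) * (2 * ageBound i + 2) := by omega
  exact (Nat.pow_le_pow_left hb _).trans (Nat.pow_le_pow_right hb0 (by omega))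

lemma mw_pos (j : ℕ) : (0 : ℚ) < mw j := by
  have := four_le_mw j
  exact_mod_cast (by omega : 0 < mw j)

lemma four_le_mw_rat (j : ℕ) : (4 : ℚ) ≤ mw j := by exact_mod_cast four_le_mw j

lemma inv_mw_le {i j : ℕ} (h : i ≤ j) : (1 : ℚ) / mw j ≤ 1 / mw i :=
  one_div_le_one_div_of_le (mw_pos i) (by exact_mod_cast mw_mono h)

lemma inv_mw_succ_le (j : ℕ) : (1 : ℚ) / mw (j + 1) ≤ 1 / mw j / 2 := by
  rw [div_div]
  refine one_div_le_one_div_of_le (by have := mw_pos j; positivity) ?_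
  have := two_mul_mw_le j
  have h : ((2 * mw j : ℕ) : ℚ) ≤ mw (j + 1) := by exact_mod_cast this
  push_cast at h; linarith

/-! ### Vectors and restrictions -/

/-- Finitely supported rational vectors. -/
abbrev Vec : Type := ℕ →₀ ℚ

/-- Restriction of a vector to the interval `[a, b)`. -/
def res (a b : ℕ) : Vec →ₗ[ℚ] Vec where
  toFun x := x.filter fun k => a ≤ k ∧ k < b
  map_add' _ _ := Finsupp.filter_add
  map_smul' _ _ := Finsupp.filter_smul

lemma res_apply (a b : ℕ) (x : Vec) (k : ℕ) :
    res a b x k = if a ≤ k ∧ k < b then x k else 0 := by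
  simp [res, Finsupp.filter_apply]

lemma res_res (a b c d : ℕ) (x : Vec) :
    res a b (res c d x) = res (max a c) (min b d) x := by
  ext k
  simp only [res_apply]
  split_ifs <;> first | rfl | (exfalso; omega)

lemma res_eq_zero_of_le {a b : ℕ} (h : b ≤ a) (x : Vec) : res a b x = 0 := by
  ext k
  rw [res_apply, if_neg (by omega)]; rfl

lemma res_sub {a b : ℕ} (h : a ≤ b) (x : Vec) : res a b x = res 0 b x - res 0 a x := by
  ext k
  simp only [res_apply, Finsupp.coe_sub, Pi.sub_apply]
  split_ifs <;> first | (exfalso; omega) | simp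

/-- `x` is supported in `[a, b)`. -/
def SuppIn (a b : ℕ) (x : Vec) : Prop := ∀ k, x k ≠ 0 → a ≤ k ∧ k < b

lemma SuppIn.res_eq {a b c d : ℕ} {x : Vec} (h : SuppIn a b x) (hc : c ≤ a) (hd : b ≤ d) :
    res c d x = x := by
  ext k
  rw [res_apply]
  split_ifs with hk
  · rfl
  · by_contra hne
    have := h k (fun h0 => hne h0.symm)
    omega

lemma SuppIn.res_eq_zero {a b c d : ℕ} {x : Vec} (h : SuppIn a b x) (hd : d ≤ a ∨ b ≤ c) :
    res c d x = 0 := by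
  ext k
  rw [res_apply]
  split_ifs with hk
  · by_contra hne
    have := h k hne
    omega
  · rfl

lemma SuppIn.apply_eq_zero {a b k : ℕ} {x : Vec} (h : SuppIn a b x) (hk : k < a ∨ b ≤ k) :
    x k = 0 := by
  by_contra hne
  have := h k hne
  omega

lemma SuppIn.mono {a b c d : ℕ} {x : Vec} (h : SuppIn a b x) (hc : c ≤ a) (hd : b ≤ d) :
    SuppIn c d x := fun k hk => by have := h k hk; omega

lemma SuppIn.add {a b : ℕ} {x y : Vec} (hx : SuppIn a b x) (hy : SuppIn a b y) :
    SuppIn a b (x + y) := fun k hk => by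
  by_cases h : x k = 0
  · exact hy k (by simpa [h] using hk)
  · exact hx k h

lemma SuppIn.smul {a b : ℕ} {x : Vec} (c : ℚ) (hx : SuppIn a b x) : SuppIn a b (c • x) :=
  fun k hk => hx k (by intro h; simp [h] at hk)

lemma SuppIn.zero (a b : ℕ) : SuppIn a b 0 := fun k hk => by simp at hk

lemma SuppIn.sum {ι : Type*} {a b : ℕ} (s : Finset ι) (f : ι → Vec)
    (h : ∀ i ∈ s, SuppIn a b (f i)) : SuppIn a b (∑ i ∈ s, f i) := by
  classical
  induction s using Finset.induction_on with
  | empty => exact SuppIn.zero a b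
  | insert i s hi ih =>
    rw [Finset.sum_insert hi]
    exact (h i (by simp)).add (ih fun j hj => h j (by simp [hj]))

lemma SuppIn.res {a b : ℕ} {x : Vec} (h : SuppIn a b x) (c d : ℕ) :
    SuppIn a b (BDSpace.res c d x) := by
  intro k hk
  rw [res_apply] at hk
  exact h k (by intro h0; simp [h0] at hk)

lemma exists_suppIn (x : Vec) : ∃ q, SuppIn 0 q x := by
  refine ⟨x.support.sup id + 1, fun k hk => ⟨Nat.zero_le _, ?_⟩⟩
  have : id k ≤ x.support.sup id := Finset.le_sup (by simpa using hk)
  simpa using Nat.lt_succ_of_le this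

/-! ### Special sequences -/

/-- Sequences of labelled vectors. -/
abbrev Seq : Type := List (ℕ × Vec)

lemma exists_seqCode : ∃ f : Seq → ℕ, Function.Injective f := exists_injective_nat _

/-- An injective numbering of the sequences of labelled vectors. -/
def seqCode : Seq → ℕ := exists_seqCode.choose

/-- The code of a sequence together with the label of its next entry. -/
def code (s : Seq) (a : ℕ) : ℕ := Nat.pair (seqCode s) a

lemma code_inj {s s' : Seq} {a a' : ℕ} (h : code s a = code s' a') : s = s' ∧ a = a' := by
  have := Nat.pair_eq_pair.mp h
  exact ⟨exists_seqCode.choose_spec this.1, this.2⟩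

lemma le_code (s : Seq) (a : ℕ) : a ≤ code s a := Nat.right_le_pair _ _

/-- The `i`-th vector of a sequence. -/
def vec (t : Seq) (i : ℕ) : Vec := (t.getD i (0, 0)).2

/-- The weight prescribed for the `i`-th vector of a sequence. -/
def wtSeq (t : Seq) (i : ℕ) : ℕ := code (t.take i) (t.getD i (0, 0)).1

/-- The sum of the vectors of `t` whose weights satisfy `p`. -/
def partSum (t : Seq) (p : ℕ → Prop) [DecidablePred p] : Vec :=
  ∑ i ∈ (Finset.range t.length).filter (fun i => p (wtSeq t i)), vec t i

/-- A node: its evaluation functional, its weight (zero for base nodes) and its age. -/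
structure Node where
  ev : Vec →ₗ[ℚ] ℚ
  wt : ℕ
  age : ℕ

/-- Base nodes evaluate a coordinate. -/
def baseNode (n : ℕ) : Node := ⟨Finsupp.lapply n, 0, 0⟩

/-- The bound in the definition of an exact vector of weight `j` for nodes of weight `w`. -/
def exactBound (w j : ℕ) : ℚ := if w < j then 1 / mw w else if w = j then 1 else 1 / mw j

/-- A vector which is exact of weight `j` with respect to the nodes below `n`. -/
def Exact (R : ℕ → Node) (n j : ℕ) (z : Vec) : Prop :=
  (∀ k, |z k| ≤ 1 / mw j) ∧
    ∀ k < n, (∃ l, z l ≠ 0 ∧ k ≤ l) → (R k).wt ≠ 0 →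
      ∀ a b, |(R k).ev (res a b z)| ≤ exactBound (R k).wt j

/-- A sequence of exact vectors whose weights are prescribed by the coding of its initial parts. -/
def Special (R : ℕ → Node) (n : ℕ) (t : Seq) : Prop :=
  (∀ i < t.length, Exact R n (wtSeq t i) (vec t i)) ∧
    ∀ i k, i < k → k < t.length → wtSeq t i < wtSeq t k

/-- A multiple of the restriction of a node to an interval. -/
abbrev Comp : Type := ℚ × ℕ × ℕ × ℕ

namespace Comp

/-- The coefficient. -/
def coef (c : Comp) : ℚ := c.1
/-- The node. -/
def node (c : Comp) : ℕ := c.2.1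
/-- The left end of the interval. -/
def lo (c : Comp) : ℕ := c.2.2.1
/-- The right end of the interval. -/
def hi (c : Comp) : ℕ := c.2.2.2
/-- The component is a multiple of a coordinate functional. -/
def Single (c : Comp) : Prop := c.lo = c.node ∧ c.hi = c.node + 1

end Comp

/-- The action of a component. -/
def compEv (R : ℕ → Node) (c : Comp) : Vec →ₗ[ℚ] ℚ :=
  c.coef • (R c.node).ev.comp (res c.lo c.hi)

/-- The data of a node: weight, predecessor and two components. -/
abbrev Data : Type := ℕ × Option ℕ × Comp × Comp

/-- The functional that the node with data `d` adds to its coordinate. -/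
def dataEv (R : ℕ → Node) (d : Data) : Vec →ₗ[ℚ] ℚ :=
  d.2.1.elim 0 (fun ξ => (R ξ).ev) +
    (1 / (mw d.1 : ℚ)) • (compEv R d.2.2.1 + compEv R d.2.2.2)

/-- The age of the node with data `d`. -/
def dataAge (R : ℕ → Node) (d : Data) : ℕ := d.2.1.elim 1 (fun ξ => (R ξ).age + 1)

/-- The data that may be used for the node `n`. -/
structure Legal (R : ℕ → Node) (n : ℕ) (d : Data) : Prop where
  pos : 1 ≤ d.1
  le : d.1 ≤ n
  coef : |d.2.2.1.coef| + |d.2.2.2.coef| ≤ 1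
  node₁ : d.2.2.1.node < n
  node₂ : d.2.2.2.node < n
  hi₁ : d.2.2.1.hi ≤ n
  hi₂ : d.2.2.2.hi ≤ n
  pred : ∀ ξ, d.2.1 = some ξ → ξ < n ∧ (R ξ).wt = d.1 ∧ (R ξ).age < ageBound d.1 ∧
    ξ < d.2.2.1.lo ∧ ξ < d.2.2.2.lo ∧
    (ξ < (R d.2.2.1.node).wt ∨ d.2.2.1.Single) ∧ (ξ < (R d.2.2.2.node).wt ∨ d.2.2.2.Single)
  bound : ∀ t, Special R n t → ∀ h,
    |dataEv R d (res 0 h (partSum t (fun w => d.1 < w)))| ≤ 5 / mw d.1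

lemma Exact.congr {R R' : ℕ → Node} {n j : ℕ} {z : Vec} (hR : ∀ k < n, R k = R' k)
    (h : Exact R n j z) : Exact R' n j z :=
  ⟨h.1, fun k hk hl hw a b => by
    have := hR k hk
    rw [← this] at hw ⊢
    exact h.2 k hk hl hw a b⟩

lemma Special.congr {R R' : ℕ → Node} {n : ℕ} {t : Seq} (hR : ∀ k < n, R k = R' k)
    (h : Special R n t) : Special R' n t :=
  ⟨fun i hi => (h.1 i hi).congr hR, h.2⟩

lemma dataEv_congr {R R' : ℕ → Node} {n : ℕ} {d : Data} (hR : ∀ k < n, R k = R' k)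
    (h1 : d.2.2.1.node < n) (h2 : d.2.2.2.node < n) (h3 : ∀ ξ, d.2.1 = some ξ → ξ < n) :
    dataEv R d = dataEv R' d := by
  obtain ⟨w, o, c₁, c₂⟩ := d
  simp only [dataEv, compEv] at *
  rw [hR _ h1, hR _ h2]
  cases o with
  | none => rfl
  | some ξ => simp only [Option.elim]; rw [hR ξ (h3 ξ rfl)]

lemma Legal.congr {R R' : ℕ → Node} {n : ℕ} {d : Data} (hR : ∀ k < n, R k = R' k)
    (h : Legal R n d) : Legal R' n d where
  pos := h.pos
  le := h.le
  coef := h.coef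
  node₁ := h.node₁
  node₂ := h.node₂
  hi₁ := h.hi₁
  hi₂ := h.hi₂
  pred ξ hξ := by
    have := h.pred ξ hξ
    rw [hR ξ this.1, hR _ h.node₁, hR _ h.node₂] at this
    exact this
  bound t ht b := by
    rw [← dataEv_congr hR h.node₁ h.node₂ (fun ξ hξ => (h.pred ξ hξ).1)]
    exact h.bound t (ht.congr fun k hk => (hR k hk).symm) b

lemma exists_dataSeq : ∃ f : ℕ → Data, Function.Surjective f := exists_surjective_nat _

/-- A sequence in which all data occur infinitely often. -/
def dataSeq (n : ℕ) : Data := exists_dataSeq.choose (Nat.unpair n).1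

lemma exists_dataSeq_eq (d : Data) (n : ℕ) : ∃ k, n ≤ k ∧ dataSeq k = d := by
  obtain ⟨i, hi⟩ := exists_dataSeq.choose_spec d
  exact ⟨Nat.pair i n, Nat.right_le_pair _ _, by simp [dataSeq, hi]⟩

open Classical in
/-- The node `n` in terms of the nodes below `n`. -/
def step (n : ℕ) (R : ℕ → Node) : Node :=
  if Legal R n (dataSeq n) then
    ⟨Finsupp.lapply n + dataEv R (dataSeq n), (dataSeq n).1, dataAge R (dataSeq n)⟩
  else baseNode n

/-- The nodes. -/
def nodes (n : ℕ) : Node :=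
  step n fun k => if _h : k < n then nodes k else baseNode k
termination_by n

lemma nodes_eq (n : ℕ) : nodes n = step n nodes := by
  classical
  rw [nodes]
  set R : ℕ → Node := fun k => if _h : k < n then nodes k else baseNode k with hRdef
  have hR : ∀ k < n, R k = nodes k := fun k hk => by simp [hRdef, hk]
  have hL : Legal R n (dataSeq n) ↔ Legal nodes n (dataSeq n) :=
    ⟨Legal.congr hR, Legal.congr fun k hk => (hR k hk).symm⟩
  unfold step
  by_cases h : Legal nodes n (dataSeq n)
  · rw [if_pos h, if_pos (hL.mpr h)]
    have h3 : ∀ ξ, (dataSeq n).2.1 = some ξ → ξ < n := fun ξ hξ => (h.pred ξ hξ).1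
    rw [dataEv_congr hR h.node₁ h.node₂ h3]
    congr 1
    unfold dataAge
    cases ho : (dataSeq n).2.1 with
    | none => rfl
    | some ξ => simp only [Option.elim]; rw [hR ξ (h3 ξ ho)]
  · rw [if_neg h, if_neg (fun h' => h (hL.mp h'))]

end BDSpace

namespace BDSpace

/-! ### Nodes -/

/-- The evaluation functional of a node. -/
abbrev ev (n : ℕ) : Vec →ₗ[ℚ] ℚ := (nodes n).ev
/-- The weight of a node. -/
abbrev wt (n : ℕ) : ℕ := (nodes n).wt
/-- The age of a node. -/
abbrev age (n : ℕ) : ℕ := (nodes n).age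
/-- The action of a component. -/
abbrev cev (c : Comp) : Vec →ₗ[ℚ] ℚ := compEv nodes c

lemma cev_apply (c : Comp) (x : Vec) : cev c x = c.coef * ev c.node (res c.lo c.hi x) := rfl

lemma node_data (n : ℕ) : (wt n = 0 ∧ age n = 0 ∧ ∀ x, ev n x = x n) ∨
    ∃ d, Legal nodes n d ∧ wt n = d.1 ∧ age n = dataAge nodes d ∧
      ∀ x, ev n x = x n + dataEv nodes d x := by
  classical
  have h := nodes_eq n
  unfold step at h
  by_cases hl : Legal nodes n (dataSeq n)
  · rw [if_pos hl] at h
    refine Or.inr ⟨_, hl, ?_, ?_, fun x => ?_⟩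
    · simp only [wt]; rw [h]
    · simp only [age]; rw [h]
    · simp only [ev]; rw [h]; rfl
  · rw [if_neg hl] at h
    refine Or.inl ⟨?_, ?_, fun x => ?_⟩
    · simp only [wt]; rw [h]; rfl
    · simp only [age]; rw [h]; rfl
    · simp only [ev]; rw [h]; rfl

lemma exists_node_of_legal {d : Data} {n₀ : ℕ} (h : ∀ n, n₀ ≤ n → Legal nodes n d) :
    ∃ n, n₀ ≤ n ∧ wt n = d.1 ∧ age n = dataAge nodes d ∧ ∀ x, ev n x = x n + dataEv nodes d x := by
  classical
  obtain ⟨n, hn, hd⟩ := exists_dataSeq_eq d n₀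
  refine ⟨n, hn, ?_⟩
  have h1 := nodes_eq n
  unfold step at h1
  rw [hd, if_pos (h n hn)] at h1
  refine ⟨?_, ?_, fun x => ?_⟩
  · simp only [wt]; rw [h1]
  · simp only [age]; rw [h1]
  · simp only [ev]; rw [h1]; rfl

/-- A node without predecessor. -/
structure IsStart (n : ℕ) (c₁ c₂ : Comp) : Prop where
  pos : 1 ≤ wt n
  le : wt n ≤ n
  age_eq : age n = 1
  coef : |c₁.coef| + |c₂.coef| ≤ 1
  node₁ : c₁.node < n
  node₂ : c₂.node < n
  hi₁ : c₁.hi ≤ n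
  hi₂ : c₂.hi ≤ n
  ev_eq : ∀ x, ev n x = x n + 1 / mw (wt n) * (cev c₁ x + cev c₂ x)

/-- A node with predecessor `ξ`. -/
structure IsSucc (n ξ : ℕ) (c₁ c₂ : Comp) : Prop where
  pos : 1 ≤ wt n
  le : wt n ≤ n
  lt : ξ < n
  wt_eq : wt ξ = wt n
  age_eq : age n = age ξ + 1
  age_lt : age ξ < ageBound (wt n)
  coef : |c₁.coef| + |c₂.coef| ≤ 1
  node₁ : c₁.node < n
  node₂ : c₂.node < n
  hi₁ : c₁.hi ≤ n
  hi₂ : c₂.hi ≤ n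
  lo₁ : ξ < c₁.lo
  lo₂ : ξ < c₂.lo
  comp₁ : ξ < wt c₁.node ∨ c₁.Single
  comp₂ : ξ < wt c₂.node ∨ c₂.Single
  ev_eq : ∀ x, ev n x = x n + ev ξ x + 1 / mw (wt n) * (cev c₁ x + cev c₂ x)

lemma node_cases (n : ℕ) : (wt n = 0 ∧ ∀ x, ev n x = x n) ∨ (∃ c₁ c₂, IsStart n c₁ c₂) ∨
    ∃ ξ c₁ c₂, IsSucc n ξ c₁ c₂ := by
  rcases node_data n with ⟨h1, -, h2⟩ | ⟨⟨w, o, c₁, c₂⟩, hl, hw, ha, he⟩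
  · exact Or.inl ⟨h1, h2⟩
  · right
    cases o with
    | none =>
      refine Or.inl ⟨c₁, c₂, ⟨?_, ?_, ha, hl.coef, hl.node₁, hl.node₂, hl.hi₁, hl.hi₂,
        fun x => ?_⟩⟩
      · rw [hw]; exact hl.pos
      · rw [hw]; exact hl.le
      · rw [he, hw]; simp [dataEv, mul_add]
    | some ξ =>
      obtain ⟨h1, h2, h3, h4, h5, h6, h7⟩ := hl.pred ξ rfl
      refine Or.inr ⟨ξ, c₁, c₂, ⟨?_, ?_, h1, ?_, ha, ?_, hl.coef, hl.node₁, hl.node₂, hl.hi₁,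
        hl.hi₂, h4, h5, h6, h7, fun x => ?_⟩⟩
      · rw [hw]; exact hl.pos
      · rw [hw]; exact hl.le
      · rw [hw]; exact h2
      · rw [hw]; exact h3
      · rw [he, hw]; simp [dataEv, add_assoc, mul_add]

lemma ev_congr (n : ℕ) : ∀ x y : Vec, (∀ k ≤ n, x k = y k) → ev n x = ev n y := by
  induction n using Nat.strong_induction_on with
  | _ n ih =>
    intro x y h
    have hc : ∀ c : Comp, c.node < n → cev c x = cev c y := fun c hc => by
      rw [cev_apply, cev_apply, ih _ hc _ (res c.lo c.hi y) fun k hk => ?_]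
      rw [res_apply, res_apply, h k (by omega)]
    rcases node_cases n with ⟨-, he⟩ | ⟨c₁, c₂, hs⟩ | ⟨ξ, c₁, c₂, hs⟩
    · rw [he, he, h n le_rfl]
    · rw [hs.ev_eq, hs.ev_eq, h n le_rfl, hc _ hs.node₁, hc _ hs.node₂]
    · rw [hs.ev_eq, hs.ev_eq, h n le_rfl, hc _ hs.node₁, hc _ hs.node₂,
        ih ξ hs.lt x y fun k hk => h k (by have := hs.lt; omega)]

lemma ev_res_of_lt {n b : ℕ} (h : n < b) (x : Vec) : ev n (res 0 b x) = ev n x :=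
  ev_congr n _ _ fun k hk => by rw [res_apply, if_pos (by omega)]

lemma ev_res_eq_res_min (n a b : ℕ) (x : Vec) : ev n (res a b x) = ev n (res a (min b (n + 1)) x) :=
  ev_congr n _ _ fun k hk => by
    rw [res_apply, res_apply]
    split_ifs <;> first | rfl | (exfalso; omega)

lemma ev_eq_zero_of_suppIn {n a b : ℕ} {x : Vec} (h : SuppIn a b x) (hn : n < a) : ev n x = 0 := by
  rw [ev_congr n x 0 fun k hk => by rw [h.apply_eq_zero (by omega)]; rfl, map_zero]

lemma cev_res (c : Comp) (a b : ℕ) (x : Vec) :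
    cev c (res a b x) = c.coef * ev c.node (res (max c.lo a) (min c.hi b) x) := by
  rw [cev_apply, res_res]

lemma cev_eq_zero {c : Comp} {a b : ℕ} {x : Vec} (h : SuppIn a b x) (hc : c.hi ≤ a ∨ b ≤ c.lo) :
    cev c x = 0 := by
  rw [cev_apply, h.res_eq_zero hc, map_zero, mul_zero]

lemma ev_res_self (n : ℕ) (x : Vec) : ev n (res n (n + 1) x) = x n := by
  have h : SuppIn n (n + 1) (res n (n + 1) x) := fun k hk => by
    rw [res_apply] at hk
    by_contra h
    exact hk (if_neg h)
  have hx : res n (n + 1) x n = x n := by rw [res_apply, if_pos (by omega)]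
  rcases node_cases n with ⟨-, he⟩ | ⟨c₁, c₂, hs⟩ | ⟨ξ, c₁, c₂, hs⟩
  · rw [he, hx]
  · rw [hs.ev_eq, hx, cev_eq_zero h (Or.inl hs.hi₁), cev_eq_zero h (Or.inl hs.hi₂)]; simp
  · rw [hs.ev_eq, hx, cev_eq_zero h (Or.inl hs.hi₁), cev_eq_zero h (Or.inl hs.hi₂),
      ev_eq_zero_of_suppIn h hs.lt]; simp

lemma cev_single {c : Comp} (h : c.Single) (x : Vec) : cev c x = c.coef * x c.node := by
  rw [cev_apply, h.1, h.2, ev_res_self]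

/-- A convex combination estimate for two components. -/
lemma comb_le {α β p q B : ℚ} (hB : 0 ≤ B) (h : |α| + |β| ≤ 1) (hp : |p| ≤ B) (hq : |q| ≤ B) :
    |α * p + β * q| ≤ B := by
  calc |α * p + β * q| ≤ |α| * |p| + |β| * |q| := by
        rw [← abs_mul, ← abs_mul]; exact abs_add_le _ _
    _ ≤ |α| * B + |β| * B := by gcongr
    _ = (|α| + |β|) * B := by ring
    _ ≤ 1 * B := by gcongr
    _ = B := one_mul B

lemma abs_inv_mw_mul_le {w : ℕ} {p B : ℚ} (h : |p| ≤ B) : |1 / (mw w : ℚ) * p| ≤ B / mw w := by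
  rw [abs_mul, abs_of_pos (by have := mw_pos w; positivity)]
  calc 1 / (mw w : ℚ) * |p| ≤ 1 / (mw w : ℚ) * B := by
        gcongr
    _ = B / mw w := by ring

lemma div_mw_le {w : ℕ} {B : ℚ} (hB : 0 ≤ B) : B / mw w ≤ B / 4 :=
  div_le_div_of_nonneg_left hB (by norm_num) (four_le_mw_rat w)

/-- The initial projections are bounded by `2`. -/
lemma ev_res_le (n : ℕ) : ∀ (k : ℕ) (x : Vec) (c : ℚ), 0 ≤ c → (∀ i < k, |ev i x| ≤ c) →
    |ev n (res 0 k x)| ≤ 2 * c := by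
  induction n using Nat.strong_induction_on with
  | _ n ih =>
    intro k x c hc h
    by_cases hn : n < k
    · rw [ev_res_of_lt hn]; linarith [h n hn]
    have hn0 : res 0 k x n = 0 := by rw [res_apply, if_neg (by omega)]
    have hcomp : ∀ c' : Comp, c'.node < n →
        |ev c'.node (res c'.lo c'.hi (res 0 k x))| ≤ 4 * c := by
      intro c' hc'
      rw [res_res]
      rcases le_total (max c'.lo 0) (min c'.hi k) with hle | hle
      · rw [res_sub hle, map_sub]
        have h1 := ih _ hc' (min c'.hi k) x c hc fun i hi => h i (by omega)
        have h2 := ih _ hc' (max c'.lo 0) x c hc fun i hi => h i (by omega)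
        calc _ ≤ _ := abs_sub _ _
          _ ≤ 4 * c := by linarith
      · rw [res_eq_zero_of_le hle, map_zero, abs_zero]; linarith
    rcases node_cases n with ⟨-, he⟩ | ⟨c₁, c₂, hs⟩ | ⟨ξ, c₁, c₂, hs⟩
    · rw [he, hn0]; simp; linarith
    · have hB := comb_le (by linarith) hs.coef (hcomp c₁ hs.node₁) (hcomp c₂ hs.node₂)
      have h3 := abs_inv_mw_mul_le (w := wt n) hB
      have h4 := div_mw_le (w := wt n) (B := 4 * c) (by linarith)
      rw [hs.ev_eq, hn0, zero_add]
      refine h3.trans (h4.trans (by linarith))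
    · have hB := comb_le (by linarith) hs.coef (hcomp c₁ hs.node₁) (hcomp c₂ hs.node₂)
      have h3 := abs_inv_mw_mul_le (w := wt n) hB
      have h4 := div_mw_le (w := wt n) (B := 4 * c) (by linarith)
      rw [hs.ev_eq, hn0, zero_add]
      by_cases hk : ξ < k
      · rw [ev_res_of_lt hk]
        calc _ ≤ _ := abs_add_le _ _
          _ ≤ c + 4 * c / 4 := add_le_add (h ξ hk) (h3.trans h4)
          _ = 2 * c := by ring
      · have hz : ∀ c' : Comp, ξ < c'.lo → cev c' (res 0 k x) = 0 := fun c' hc' => by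
          rw [cev_res, res_eq_zero_of_le (by omega), map_zero, mul_zero]
        rw [hz _ hs.lo₁, hz _ hs.lo₂, add_zero, mul_zero, add_zero]
        exact ih ξ hs.lt k x c hc h

lemma ev_res_le_four {x : Vec} {c : ℚ} (h : ∀ i, |ev i x| ≤ c) (n a b : ℕ) :
    |ev n (res a b x)| ≤ 4 * c := by
  have hc : 0 ≤ c := (abs_nonneg _).trans (h 0)
  rcases le_total a b with hle | hle
  · rw [res_sub hle, map_sub]
    have h1 := ev_res_le n b x c hc fun i _ => h i
    have h2 := ev_res_le n a x c hc fun i _ => h i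
    calc _ ≤ _ := abs_sub _ _
      _ ≤ 4 * c := by linarith
  · rw [res_eq_zero_of_le hle, map_zero, abs_zero]; linarith

lemma apply_le_four {x : Vec} {c : ℚ} (h : ∀ i, |ev i x| ≤ c) (n : ℕ) : |x n| ≤ 4 * c := by
  rw [← ev_res_self]; exact ev_res_le_four h n _ _

/-! ### Estimates on exact vectors and special sequences -/

/-- The bound for the action of nodes of weight `w` on exact vectors of weight `j`. -/
lemma exactBound_nonneg (w j : ℕ) : 0 ≤ exactBound w j := by
  unfold exactBound
  have := mw_pos w
  have := mw_pos j
  split_ifs <;> positivity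

lemma exactBound_le_one (w j : ℕ) : exactBound w j ≤ 1 := by
  unfold exactBound
  have h : ∀ i, (1 : ℚ) / mw i ≤ 1 := fun i => by
    rw [div_le_one (mw_pos i)]; linarith [four_le_mw_rat i]
  split_ifs
  · exact h w
  · exact le_rfl
  · exact h j

lemma Exact.ev_le {n j : ℕ} {z : Vec} (h : Exact nodes n j z) : ∀ k < n, wt k ≠ 0 →
    ∀ a b, |ev k (res a b z)| ≤ exactBound (wt k) j + 4 / mw (wt k) := by
  intro k
  induction k using Nat.strong_induction_on with
  | _ k ih =>
    intro hk hw a b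
    have hm := mw_pos (wt k)
    by_cases hl : ∃ l, z l ≠ 0 ∧ k ≤ l
    · have := h.2 k hk hl hw a b
      have h4 : (0 : ℚ) ≤ 4 / mw (wt k) := by positivity
      linarith
    push Not at hl
    have hsupp : SuppIn 0 k z := fun l hl' => ⟨Nat.zero_le _, by
      by_contra hlt
      exact absurd (hl l hl') (by omega)⟩
    obtain ⟨q, hqk, hq, hqw⟩ : ∃ q, q ≤ k ∧ SuppIn 0 q z ∧ ∀ i < q, ∃ l, z l ≠ 0 ∧ i ≤ l := by
      by_cases hz : z = 0
      · exact ⟨0, Nat.zero_le _, by rw [hz]; exact SuppIn.zero _ _, fun i hi => by omega⟩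
      · have hne : z.support.Nonempty := Finsupp.support_nonempty_iff.mpr hz
        refine ⟨z.support.max' hne + 1, ?_, fun l hl' => ⟨Nat.zero_le _, ?_⟩, fun i hi => ?_⟩
        · have := z.support.max'_mem hne
          exact (hsupp _ (by simpa using this)).2
        · exact Nat.lt_succ_of_le (z.support.le_max' l (by simpa using hl'))
        · exact ⟨_, by simpa using z.support.max'_mem hne, by omega⟩
    have hqev : ∀ i < q, |ev i z| ≤ 1 := fun i hi => by
      by_cases hwi : wt i = 0
      · rcases node_cases i with ⟨-, he⟩ | ⟨c₁, c₂, hs⟩ | ⟨ξ, c₁, c₂, hs⟩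
        · rw [he]
          refine (h.1 i).trans ?_
          rw [div_le_one (mw_pos j)]; linarith [four_le_mw_rat j]
        · exact absurd hs.pos (by omega)
        · exact absurd hs.pos (by omega)
      · have := h.2 i (by omega) (hqw i hi) hwi 0 q
        rw [hq.res_eq le_rfl le_rfl] at this
        exact this.trans (exactBound_le_one _ _)
    have hz4 : ∀ i a b, |ev i (res a b z)| ≤ 4 := fun i a b => by
      rw [← hq.res_eq (le_refl 0) (le_refl q), res_res]
      rcases le_total (max a 0) (min b q) with hle | hle
      · rw [res_sub hle, map_sub]
        have h1 := ev_res_le i (min b q) z 1 zero_le_one fun i hi => hqev i (by omega)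
        have h2 := ev_res_le i (max a 0) z 1 zero_le_one fun i hi => hqev i (by omega)
        exact (abs_sub _ _).trans (by linarith)
      · rw [res_eq_zero_of_le hle, map_zero, abs_zero]; norm_num
    have hcomp : ∀ c : Comp, |ev c.node (res c.lo c.hi (res a b z))| ≤ 4 := fun c => by
      rw [res_res]; exact hz4 _ _ _
    have hzk : res a b z k = 0 := (hsupp.res a b).apply_eq_zero (Or.inr le_rfl)
    rcases node_cases k with ⟨h0, -⟩ | ⟨c₁, c₂, hs⟩ | ⟨ξ, c₁, c₂, hs⟩
    · exact absurd h0 hw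
    · have hB := comb_le (by norm_num) hs.coef (hcomp c₁) (hcomp c₂)
      rw [hs.ev_eq, hzk, zero_add]
      exact (abs_inv_mw_mul_le hB).trans (le_add_of_nonneg_left (exactBound_nonneg _ _))
    · have hB := comb_le (by norm_num) hs.coef (hcomp c₁) (hcomp c₂)
      rw [hs.ev_eq, hzk, zero_add]
      by_cases hξ : ∃ l, z l ≠ 0 ∧ ξ ≤ l
      · have h1 := h.2 ξ (hs.lt.trans hk) hξ (by change wt ξ ≠ 0; rw [hs.wt_eq]; exact hw) a b
        have h1' : |ev ξ (res a b z)| ≤ exactBound (wt k) j := by rw [← hs.wt_eq]; exact h1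
        exact (abs_add_le _ _).trans (add_le_add h1' (abs_inv_mw_mul_le hB))
      · push Not at hξ
        have hsξ : SuppIn 0 ξ z := fun l hl' => ⟨Nat.zero_le _, hξ l hl'⟩
        rw [cev_eq_zero (hsξ.res a b) (Or.inr hs.lo₁.le), cev_eq_zero (hsξ.res a b)
          (Or.inr hs.lo₂.le), add_zero, mul_zero, add_zero]
        have := ih ξ hs.lt (hs.lt.trans hk) (by rw [hs.wt_eq]; exact hw) a b
        rwa [hs.wt_eq] at this

lemma Exact.ev_le_of_lt {n j k : ℕ} {z : Vec} (h : Exact nodes n j z) (hk : k < n)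
    (hw : wt k ≠ 0) (hj : j < wt k) (a b : ℕ) : |ev k (res a b z)| ≤ 5 / mw j := by
  have h1 := h.ev_le k hk hw a b
  rw [exactBound, if_neg (by omega), if_neg (by omega)] at h1
  have h2 : (4 : ℚ) / mw (wt k) ≤ 4 / mw j := by
    have := inv_mw_le hj.le
    rw [div_eq_mul_one_div, div_eq_mul_one_div (4 : ℚ)]; linarith
  calc _ ≤ _ := h1
    _ ≤ 1 / mw j + 4 / mw j := by linarith
    _ = 5 / mw j := by ring

lemma Exact.ev_le_two {n j k : ℕ} {z : Vec} (h : Exact nodes n j z) (hk : k < n)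
    (a b : ℕ) : |ev k (res a b z)| ≤ 2 := by
  by_cases hw : wt k = 0
  · rcases node_cases k with ⟨-, he⟩ | ⟨c₁, c₂, hs⟩ | ⟨ξ, c₁, c₂, hs⟩
    · rw [he, res_apply]
      have : |z k| ≤ 2 := (h.1 k).trans (by
        rw [div_le_iff₀ (mw_pos j)]; linarith [four_le_mw_rat j])
      split_ifs
      · exact this
      · simp
    · exact absurd hs.pos (by omega)
    · exact absurd hs.pos (by omega)
  · have h1 := h.ev_le k hk hw a b
    have h2 := exactBound_le_one (wt k) j
    have h3 := div_mw_le (w := wt k) (B := 4) (by norm_num)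
    linarith

lemma Exact.mono {n n' j : ℕ} {z : Vec} (h : Exact nodes n j z) (hn : n' ≤ n) :
    Exact nodes n' j z := ⟨h.1, fun k hk => h.2 k (by omega)⟩

lemma Special.mono {n n' : ℕ} {t : Seq} (h : Special nodes n t) (hn : n' ≤ n) :
    Special nodes n' t := ⟨fun i hi => (h.1 i hi).mono hn, h.2⟩

/-- Summation of the inverses of the weights of a special sequence. -/
lemma sum_inv_mw_le (v : ℕ → ℕ) (L w : ℕ) (hv : ∀ i i', i < i' → i' < L → v i < v i') :
    ∑ i ∈ (Finset.range L).filter (fun i => w ≤ v i), (1 : ℚ) / mw (v i) ≤ 2 / mw w := by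
  have key : ∑ i ∈ (Finset.range L).filter (fun i => w ≤ v i), (1 : ℚ) / mw (v i) =
      ∑ k ∈ ((Finset.range L).filter (fun i => w ≤ v i)).image v, (1 : ℚ) / mw k := by
    rw [Finset.sum_image]
    intro i hi i' hi' h
    simp only [Finset.coe_filter, Finset.mem_range, Set.mem_ofPred_eq] at hi hi'
    rcases lt_trichotomy i i' with hlt | heq | hlt
    · have := hv i i' hlt hi'.1; omega
    · exact heq
    · have := hv i' i hlt hi.1; omega
  rw [key]
  have gen : ∀ K w, ∑ k ∈ Finset.Ico w (w + K), (1 : ℚ) / mw k ≤ 2 / mw w := by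
    intro K
    induction K with
    | zero => intro w; have := mw_pos w; simp; positivity
    | succ K ih =>
      intro w
      rw [Finset.sum_eq_sum_Ico_succ_bot (by omega), show w + (K + 1) = w + 1 + K by ring]
      have h1 := ih (w + 1)
      have h2 := inv_mw_succ_le w
      have h3 : (2 : ℚ) / mw (w + 1) = 2 * (1 / mw (w + 1)) := by ring
      have h4 : (2 : ℚ) / mw w = 2 * (1 / mw w) := by ring
      linarith
  obtain ⟨K, hK⟩ : ∃ K, ∀ i < L, v i < w + K := by
    refine ⟨(Finset.range L).sup v + 1, fun i hi => ?_⟩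
    have : v i ≤ (Finset.range L).sup v := Finset.le_sup (by simpa using hi)
    omega
  refine le_trans (Finset.sum_le_sum_of_subset_of_nonneg ?_ fun i _ _ => ?_) (gen K w)
  · intro k hk
    simp only [Finset.mem_image, Finset.mem_filter, Finset.mem_range] at hk
    obtain ⟨i, hi, rfl⟩ := hk
    exact Finset.mem_Ico.mpr ⟨hi.2, hK i hi.1⟩
  · have := mw_pos i; positivity

lemma map_partSum {M : Type*} [AddCommMonoid M] [Module ℚ M] (f : Vec →ₗ[ℚ] M) (t : Seq)
    (p : ℕ → Prop) [DecidablePred p] : f (partSum t p) =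
      ∑ i ∈ (Finset.range t.length).filter (fun i => p (wtSeq t i)), f (vec t i) := map_sum f _ _

lemma Special.abs_map_partSum_le {n : ℕ} {t : Seq} (ht : Special nodes n t) (f : Vec →ₗ[ℚ] ℚ)
    (p : ℕ → Prop) [DecidablePred p] {w : ℕ} {C : ℚ} (hC : 0 ≤ C) (hp : ∀ v, p v → w ≤ v)
    (hf : ∀ i < t.length, p (wtSeq t i) → |f (vec t i)| ≤ C * (1 / mw (wtSeq t i))) :
    |f (partSum t p)| ≤ C * (2 / mw w) := by
  rw [map_partSum]
  calc _ ≤ ∑ i ∈ (Finset.range t.length).filter (fun i => p (wtSeq t i)), |f (vec t i)| :=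
        Finset.abs_sum_le_sum_abs _ _
    _ ≤ ∑ i ∈ (Finset.range t.length).filter (fun i => p (wtSeq t i)),
          C * (1 / mw (wtSeq t i)) := by
        refine Finset.sum_le_sum fun i hi => ?_
        simp only [Finset.mem_filter, Finset.mem_range] at hi
        exact hf i hi.1 hi.2
    _ ≤ ∑ i ∈ (Finset.range t.length).filter (fun i => w ≤ wtSeq t i),
          C * (1 / mw (wtSeq t i)) := by
        refine Finset.sum_le_sum_of_subset_of_nonneg (fun i hi => ?_) fun i _ _ => ?_
        · simp only [Finset.mem_filter, Finset.mem_range] at hi ⊢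
          exact ⟨hi.1, hp _ hi.2⟩
        · have := mw_pos (wtSeq t i); positivity
    _ = C * ∑ i ∈ (Finset.range t.length).filter (fun i => w ≤ wtSeq t i),
          (1 : ℚ) / mw (wtSeq t i) := by rw [Finset.mul_sum]
    _ ≤ C * (2 / mw w) :=
        mul_le_mul_of_nonneg_left (sum_inv_mw_le (wtSeq t) t.length w ht.2) hC

lemma Special.partSum_apply_le {n : ℕ} {t : Seq} (ht : Special nodes n t) (w k : ℕ) :
    |partSum t (fun v => w < v) k| ≤ 2 / mw (w + 1) := by
  have := ht.abs_map_partSum_le (Finsupp.lapply k) (fun v => w < v) (w := w + 1) zero_le_one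
    (fun v hv => hv) fun i hi _ => by simpa using (ht.1 i hi).1 k
  simpa using this

/-- The constraint on the nodes bounds their action on tails of special sequences. -/
lemma Special.ev_tail_le {n k : ℕ} {t : Seq} (ht : Special nodes n t) (hk : k < n)
    (hw : wt k ≠ 0) (h : ℕ) :
    |ev k (res 0 h (partSum t (fun v => wt k < v)))| ≤ 6 / mw (wt k) := by
  rcases node_data k with ⟨h0, -⟩ | ⟨d, hl, hd, -, he⟩
  · exact absurd h0 hw
  · rw [he, hd]
    have h1 := hl.bound t (ht.mono hk.le) h
    have h2 : |res 0 h (partSum t (fun v => d.1 < v)) k| ≤ 1 / mw d.1 := by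
      have h3 := ht.partSum_apply_le d.1 k
      have h4 := inv_mw_succ_le d.1
      have h5 : (2 : ℚ) / mw (d.1 + 1) = 2 * (1 / mw (d.1 + 1)) := by ring
      have h6 : (0 : ℚ) ≤ 1 / mw d.1 := by have := mw_pos d.1; positivity
      rw [res_apply]
      split_ifs
      · linarith
      · simp
    have h3 : (6 : ℚ) / mw d.1 = 1 / mw d.1 + 5 / mw d.1 := by ring
    rw [h3]
    exact (abs_add_le _ _).trans (add_le_add h2 h1)

lemma Special.ev_tail_res_le {n k : ℕ} {t : Seq} (ht : Special nodes n t) (hk : k < n)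
    (hw : wt k ≠ 0) (a b : ℕ) :
    |ev k (res a b (partSum t (fun v => wt k < v)))| ≤ 12 / mw (wt k) := by
  have hm := mw_pos (wt k)
  rcases le_total a b with hle | hle
  · rw [res_sub hle, map_sub]
    have h1 := ht.ev_tail_le hk hw a
    have h2 := ht.ev_tail_le hk hw b
    have h3 : (12 : ℚ) / mw (wt k) = 6 / mw (wt k) + 6 / mw (wt k) := by ring
    rw [h3]
    exact (abs_sub _ _).trans (add_le_add h2 h1)
  · rw [res_eq_zero_of_le hle, map_zero, abs_zero]; positivity

lemma partSum_split (t : Seq) {j w : ℕ} (h : j < w) : partSum t (fun v => j < v) =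
    partSum t (fun v => j < v ∧ v < w) + partSum t (fun v => v = w) +
      partSum t (fun v => w < v) := by
  simp only [partSum, Finset.sum_filter, ← Finset.sum_add_distrib]
  refine Finset.sum_congr rfl fun i _ => ?_
  rcases lt_trichotomy (wtSeq t i) w with h1 | h1 | h1
  · simp [h1, h1.ne, h1.not_gt]
  · simp [h1, h]
  · simp [h1, h1.ne', h1.not_gt, h.trans h1]

/-- Up to a small error, a node sees from a special sequence only the vector of its own weight. -/
lemma Special.ev_sub_match_le {n k j : ℕ} {t : Seq} (ht : Special nodes n t) (hk : k < n)
    (hj : j < wt k) (a b : ℕ) :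
    |ev k (res a b (partSum t (fun v => j < v))) - ev k (res a b (partSum t (fun v => v = wt k)))|
      ≤ 22 / mw (j + 1) := by
  have hw : wt k ≠ 0 := by omega
  have h1 : |ev k (res a b (partSum t (fun v => j < v ∧ v < wt k)))| ≤ 5 * (2 / mw (j + 1)) :=
    ht.abs_map_partSum_le ((ev k).comp (res a b)) (fun v => j < v ∧ v < wt k) (by norm_num)
      (fun v hv => hv.1) fun i hi hp => by
        have := (ht.1 i hi).ev_le_of_lt hk hw hp.2 a b
        rw [← mul_one_div] at this
        exact this
  have h2 := ht.ev_tail_res_le hk hw a b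
  have h3 : (12 : ℚ) / mw (wt k) ≤ 12 / mw (j + 1) := by
    have := inv_mw_le (show j + 1 ≤ wt k from hj)
    rw [← mul_one_div, ← mul_one_div (12 : ℚ)]; linarith
  rw [partSum_split t hj, map_add, map_add, map_add, map_add]
  have h4 : (22 : ℚ) / mw (j + 1) = 5 * (2 / mw (j + 1)) + 12 / mw (j + 1) := by ring
  rw [h4]
  have : ∀ p q r : ℚ, p + q + r - q = p + r := fun p q r => by ring
  rw [this]
  exact (abs_add_le _ _).trans (add_le_add h1 (h2.trans h3))

lemma Special.partSum_eq_le_two {n k : ℕ} {t : Seq} (ht : Special nodes n t) (hk : k < n)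
    (w a b : ℕ) : |ev k (res a b (partSum t (fun v => v = w)))| ≤ 2 := by
  by_cases hw : ∃ i < t.length, wtSeq t i = w
  · obtain ⟨i, hi, rfl⟩ := hw
    have : (Finset.range t.length).filter (fun i' => wtSeq t i' = wtSeq t i) = {i} := by
      ext i'
      simp only [Finset.mem_filter, Finset.mem_range, Finset.mem_singleton]
      constructor
      · rintro ⟨h1, h2⟩
        rcases lt_trichotomy i i' with hlt | heq | hlt
        · have := ht.2 i i' hlt h1; omega
        · exact heq.symm
        · have := ht.2 i' i hlt hi; omega
      · rintro rfl; exact ⟨hi, rfl⟩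
    rw [partSum, this, Finset.sum_singleton]
    exact (ht.1 i hi).ev_le_two hk a b
  · push Not at hw
    rw [partSum, Finset.filter_eq_empty_iff.mpr (fun i hi => hw i (by simpa using hi))]
    simp

/-- The sums of special sequences are uniformly bounded. -/
lemma Special.ev_sum_le {n k : ℕ} {t : Seq} (ht : Special nodes n t) (hk : k < n) :
    |ev k (∑ i ∈ Finset.range t.length, vec t i)| ≤ 10 := by
  have hs : ∑ i ∈ Finset.range t.length, vec t i = partSum t (fun _ => True) := by
    simp [partSum]
  have h0 : ∀ w, (2 : ℚ) / mw w ≤ 1 / 2 := fun w => by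
    have := div_mw_le (w := w) (B := 2) (by norm_num); linarith
  rw [hs]
  by_cases hw : wt k = 0
  · rcases node_cases k with ⟨-, he⟩ | ⟨c₁, c₂, hs⟩ | ⟨ξ, c₁, c₂, hs⟩
    · rw [he]
      have h1 := ht.abs_map_partSum_le (Finsupp.lapply k) (fun _ => True) (w := 0) zero_le_one
        (fun v _ => Nat.zero_le v) fun i hi _ => by simpa using (ht.1 i hi).1 k
      have h2 : |partSum t (fun _ => True) k| ≤ 1 * (2 / mw 0) := h1
      linarith [h0 0]
    · exact absurd hs.pos (by omega)
    · exact absurd hs.pos (by omega)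
  · obtain ⟨q, hq⟩ := exists_suppIn (partSum t fun _ => True)
    have hsplit : partSum t (fun _ => True) = partSum t (fun v => v < wt k) +
        partSum t (fun v => v = wt k) + partSum t (fun v => wt k < v) := by
      simp only [partSum, Finset.sum_filter, ← Finset.sum_add_distrib]
      refine Finset.sum_congr rfl fun i _ => ?_
      rcases lt_trichotomy (wtSeq t i) (wt k) with h1 | h1 | h1
      · simp [h1, h1.ne, h1.not_gt]
      · simp [h1]
      · simp [h1, h1.ne', h1.not_gt]
    have h1 : |ev k (res 0 (k + 1) (partSum t (fun v => v < wt k)))| ≤ 5 * (2 / mw 0) :=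
      ht.abs_map_partSum_le ((ev k).comp (res 0 (k + 1))) (fun v => v < wt k) (by norm_num)
        (fun v _ => Nat.zero_le v) fun i hi hp => by
          have := (ht.1 i hi).ev_le_of_lt hk hw hp 0 (k + 1)
          rw [← mul_one_div] at this
          exact this
    have h2 := ht.partSum_eq_le_two hk (wt k) 0 (k + 1)
    have h3 := ht.ev_tail_le hk hw (k + 1)
    rw [ev_res_of_lt (Nat.lt_succ_self k)] at h1 h2 h3
    have h4 := div_mw_le (w := wt k) (B := 6) (by norm_num)
    rw [hsplit, map_add, map_add]
    refine (abs_add_three _ _ _).trans ?_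
    linarith [h0 0]

end BDSpace

namespace BDSpace

/-! ### Averages of rapidly increasing sequences -/

lemma age_le_ageBound (n : ℕ) : age n ≤ ageBound (wt n) := by
  rcases node_data n with ⟨-, h, -⟩ | -
  · rw [h]; exact Nat.zero_le _
  rcases node_cases n with ⟨h, -⟩ | ⟨c₁, c₂, hs⟩ | ⟨ξ, c₁, c₂, hs⟩
  · rcases node_data n with ⟨-, h', -⟩ | ⟨d, hl, hd, -⟩
    · rw [h']; exact Nat.zero_le _
    · exact absurd hl.pos (by omega)
  · rw [hs.age_eq]; exact ageBound_pos _
  · rw [hs.age_eq]; exact hs.age_lt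

/-- The number of `i < K` with `s i` in `[a, b)`. -/
def cnt (s : ℕ → ℕ) (K a b : ℕ) : ℚ :=
  (((Finset.range K).filter fun i => a ≤ s i ∧ s i < b).card : ℚ)

lemma cnt_nonneg (s : ℕ → ℕ) (K a b : ℕ) : 0 ≤ cnt s K a b := Nat.cast_nonneg _

lemma cnt_le (s : ℕ → ℕ) (K a b : ℕ) : cnt s K a b ≤ K := by
  unfold cnt
  exact_mod_cast (Finset.card_filter_le _ _).trans (by simp)

lemma cnt_mono (s : ℕ → ℕ) (K : ℕ) {a b a' b' : ℕ} (ha : a' ≤ a) (hb : b ≤ b') :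
    cnt s K a b ≤ cnt s K a' b' := by
  unfold cnt
  exact_mod_cast Finset.card_le_card (Finset.monotone_filter_right _ fun i _ hi => by omega)

lemma cnt_split (s : ℕ → ℕ) (K a b c : ℕ) :
    cnt s K a (min b c) + cnt s K (max a c) b = cnt s K a b := by
  unfold cnt
  rw [← Nat.cast_add, ← Finset.card_union_of_disjoint]
  · congr 2
    ext i
    simp only [Finset.mem_union, Finset.mem_filter, Finset.mem_range]
    omega
  · rw [Finset.disjoint_filter]
    intro i _ h1 h2
    omega

lemma sum_ite_eq_mul_cnt (s : ℕ → ℕ) (K a b : ℕ) (c : ℚ) :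
    ∑ i ∈ Finset.range K, (if a ≤ s i ∧ s i < b then c else 0) = c * cnt s K a b := by
  rw [← Finset.sum_filter, Finset.sum_const, cnt, nsmul_eq_mul, mul_comm]

/-- The evaluation analysis of a node of positive weight. -/
lemma ev_le_of_forall_le {Y : Vec} {κ τ C : ℚ} {s : ℕ → ℕ} {K : ℕ} (hκ : 0 ≤ κ) (hτ : 0 ≤ τ)
    (hC : ∀ k, |Y k| ≤ C) (h : ∀ n a b, |ev n (res a b Y)| ≤ κ + τ * cnt s K a b) (n : ℕ) :
    wt n ≠ 0 → ∀ a b, |ev n (res a b Y)| ≤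
      age n * C + 1 / mw (wt n) * (age n * κ + τ * cnt s K a b) := by
  have hC0 : 0 ≤ C := (abs_nonneg _).trans (hC 0)
  have hco : ∀ n a b, |res a b Y n| ≤ C := fun n a b => by
    rw [res_apply]
    split_ifs
    · exact hC n
    · simpa using hC0
  induction n using Nat.strong_induction_on with
  | _ n ih =>
    intro hw a b
    have hm := mw_pos (wt n)
    have hcomp : ∀ (c : Comp) (d : ℕ), d ≤ c.lo →
        |ev c.node (res c.lo c.hi (res a b Y))| ≤ κ + τ * cnt s K (max a d) b := fun c d hd => by
      rw [res_res]
      refine (h _ _ _).trans ?_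
      have := cnt_mono s K (a := max c.lo a) (b := min c.hi b) (a' := max a d) (b' := b)
        (by omega) (by omega)
      gcongr
    have hnn : ∀ a b, 0 ≤ κ + τ * cnt s K a b := fun a b => by
      have := cnt_nonneg s K a b; positivity
    rcases node_cases n with ⟨h0, -⟩ | ⟨c₁, c₂, hs⟩ | ⟨ξ, c₁, c₂, hs⟩
    · exact absurd h0 hw
    · have hB := comb_le (hnn _ _) hs.coef (hcomp c₁ 0 (Nat.zero_le _)) (hcomp c₂ 0 (Nat.zero_le _))
      rw [max_eq_left (Nat.zero_le a)] at hB
      rw [hs.ev_eq, hs.age_eq]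
      refine (abs_add_le _ _).trans ?_
      push_cast
      rw [one_mul, one_mul]
      refine add_le_add (hco n a b) ((abs_inv_mw_mul_le hB).trans_eq (by ring))
    · have hB := comb_le (hnn _ _) hs.coef (hcomp c₁ (ξ + 1) hs.lo₁) (hcomp c₂ (ξ + 1) hs.lo₂)
      have h1 := ih ξ hs.lt (by rw [hs.wt_eq]; exact hw) a (min b (ξ + 1))
      rw [← ev_res_eq_res_min, hs.wt_eq] at h1
      have hsp := cnt_split s K a b (ξ + 1)
      rw [hs.ev_eq, hs.age_eq]
      push_cast
      have h2 := abs_inv_mw_mul_le (w := wt n) hB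
      refine (abs_add_le _ _).trans ((add_le_add ((abs_add_le _ _).trans
        (add_le_add (hco n a b) h1)) h2).trans_eq ?_)
      rw [← hsp]; ring

/-- A sum in which at most one term is exceptional. -/
lemma sum_le_of_exceptional {ι : Type*} (S : Finset ι) {g β : ι → ℚ} {E : ι → Prop} {C : ℚ}
    (hC : 0 ≤ C) (hE : ∀ i ∈ S, ∀ i' ∈ S, E i → E i' → i = i') (hβ : ∀ i ∈ S, 0 ≤ β i)
    (h1 : ∀ i ∈ S, ¬ E i → g i ≤ β i) (h2 : ∀ i ∈ S, E i → g i ≤ C) :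
    ∑ i ∈ S, g i ≤ C + ∑ i ∈ S, β i := by
  classical
  by_cases hex : ∃ i ∈ S, E i
  · obtain ⟨i, hi, hEi⟩ := hex
    rw [← Finset.add_sum_erase S g hi]
    refine add_le_add (h2 i hi hEi) ?_
    refine (Finset.sum_le_sum fun k hk => ?_).trans
      (Finset.sum_le_sum_of_subset_of_nonneg (Finset.erase_subset i S) fun k hk _ => hβ k hk)
    have hk' := Finset.mem_erase.mp hk
    exact h1 k hk'.2 fun hEk => hk'.1 (hE k hk'.2 i hi hEk hEi)
  · push Not at hex
    have := Finset.sum_le_sum fun i hi => h1 i hi (hex i hi)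
    linarith

/-- Successive vectors. -/
structure IsBlock (y : ℕ → Vec) (s : ℕ → ℕ) : Prop where
  mono : Monotone s
  supp : ∀ i, SuppIn (s i) (s (i + 1)) (y i)

lemma IsBlock.eq_of_crossing {y : ℕ → Vec} {s : ℕ → ℕ} (h : IsBlock y s) {a i i' : ℕ}
    (h1 : s i ≤ a ∧ a < s (i + 1)) (h2 : s i' ≤ a ∧ a < s (i' + 1)) : i = i' := by
  rcases lt_trichotomy i i' with hlt | heq | hlt
  · have := h.mono (show i + 1 ≤ i' from hlt); omega
  · exact heq
  · have := h.mono (show i' + 1 ≤ i from hlt); omega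

lemma IsBlock.abs_ev_res_sum_le {y : ℕ → Vec} {s : ℕ → ℕ} (h : IsBlock y s) {C : ℚ} (hC : 0 ≤ C)
    {β : ℕ → ℚ} (hβ : ∀ i, 0 ≤ β i) {n a b : ℕ} (h1 : ∀ i, |ev n (res a b (y i))| ≤ C)
    (h2 : ∀ i, |ev n (res a b (y i))| ≤ β i) (K : ℕ) :
    |ev n (res a b (∑ i ∈ Finset.range K, y i))| ≤
      C + ∑ i ∈ Finset.range K, if a ≤ s i ∧ s i < b then β i else 0 := by
  rw [map_sum, map_sum]
  refine (Finset.abs_sum_le_sum_abs _ _).trans ?_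
  refine sum_le_of_exceptional (E := fun i => s i ≤ a ∧ a < s (i + 1)) _ hC ?_ ?_ ?_ ?_
  · exact fun i _ i' _ => h.eq_of_crossing
  · intro i _; split_ifs
    · exact hβ i
    · exact le_rfl
  · intro i _ hi
    split_ifs with hab
    · exact h2 i
    · rw [(h.supp i).res_eq_zero (by omega), map_zero, abs_zero]
  · exact fun i _ _ => h1 i

lemma IsBlock.abs_sum_apply_le {y : ℕ → Vec} {s : ℕ → ℕ} (h : IsBlock y s) {C : ℚ} (hC : 0 ≤ C)
    (h1 : ∀ i k, |y i k| ≤ C) (K k : ℕ) : |(∑ i ∈ Finset.range K, y i) k| ≤ C := by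
  rw [Finsupp.finsetSum_apply]
  refine (Finset.abs_sum_le_sum_abs _ _).trans ?_
  have := sum_le_of_exceptional (Finset.range K) (g := fun i => |y i k|) (β := fun _ => 0)
    (E := fun i => s i ≤ k ∧ k < s (i + 1)) hC (fun i _ i' _ => h.eq_of_crossing)
    (fun _ _ => le_rfl) (fun i _ hi => ?_) (fun i _ _ => h1 i k)
  · simpa using this
  · rw [(h.supp i).apply_eq_zero (by omega), abs_zero]

/-- Rapidly increasing sequences. -/
structure RIS (y : ℕ → Vec) (s J : ℕ → ℕ) (C : ℚ) : Prop extends IsBlock y s where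
  pos : 0 < C
  bdd : ∀ i n a b, |ev n (res a b (y i))| ≤ C
  low : ∀ i n a b, wt n ≠ 0 → wt n < J i → |ev n (res a b (y i))| ≤ C / mw (wt n)
  le : ∀ i, s i ≤ J i

namespace RIS

variable {y : ℕ → Vec} {s J : ℕ → ℕ} {C : ℚ}

lemma high (h : RIS y s J C) (i : ℕ) (n : ℕ) : wt n ≠ 0 → s (i + 1) ≤ wt n →
    ∀ a b, |ev n (res a b (y i))| ≤ C / mw (wt n) := by
  induction n using Nat.strong_induction_on with
  | _ n ih =>
    intro hw hs' a b
    have hsupp := (h.supp i).res a b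
    have hcomp : ∀ c : Comp, |ev c.node (res c.lo c.hi (res a b (y i)))| ≤ C := fun c => by
      rw [res_res]; exact h.bdd _ _ _ _
    rcases node_cases n with ⟨h0, -⟩ | ⟨c₁, c₂, hs⟩ | ⟨ξ, c₁, c₂, hs⟩
    · exact absurd h0 hw
    · rw [hs.ev_eq, hsupp.apply_eq_zero (Or.inr (hs'.trans hs.le)), zero_add]
      exact abs_inv_mw_mul_le (comb_le h.pos.le hs.coef (hcomp c₁) (hcomp c₂))
    · have hξ : wt n ≤ ξ := by
        rw [← hs.wt_eq]
        rcases node_cases ξ with ⟨h0, -⟩ | ⟨_, _, hs''⟩ | ⟨_, _, _, hs''⟩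
        · exact absurd h0 (by rw [hs.wt_eq]; exact hw)
        · exact hs''.le
        · exact hs''.le
      have hlo₁ := hs.lo₁
      have hlo₂ := hs.lo₂
      rw [hs.ev_eq, hsupp.apply_eq_zero (Or.inr (hs'.trans hs.le)), zero_add,
        cev_eq_zero hsupp (Or.inr (by omega)), cev_eq_zero hsupp (Or.inr (by omega)), add_zero,
        mul_zero, add_zero]
      have := ih ξ hs.lt (by rw [hs.wt_eq]; exact hw) (by rw [hs.wt_eq]; exact hs') a b
      rwa [hs.wt_eq] at this

lemma apply_le (h : RIS y s J C) (i k : ℕ) : |y i k| ≤ C := by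
  rw [← ev_res_self]; exact h.bdd _ _ _ _

lemma sum_le_trivial (h : RIS y s J C) (K n a b : ℕ) :
    |ev n (res a b (∑ i ∈ Finset.range K, y i))| ≤ C + C * cnt s K a b := by
  have := h.abs_ev_res_sum_le h.pos.le (β := fun _ => C) (fun _ => h.pos.le)
    (fun i => h.bdd i n a b) (fun i => h.bdd i n a b) K
  rwa [sum_ite_eq_mul_cnt] at this

lemma sum_le_of_wt_ne_zero (h : RIS y s J C) (K : ℕ) {n : ℕ} (hw : wt n ≠ 0) (a b : ℕ) :
    |ev n (res a b (∑ i ∈ Finset.range K, y i))| ≤ 2 * C + C / mw (wt n) * cnt s K a b := by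
  classical
  have hm := mw_pos (wt n)
  have hC := h.pos
  have h1 := h.abs_ev_res_sum_le (n := n) (a := a) (b := b) hC.le
    (β := fun i => if J i ≤ wt n ∧ wt n < s (i + 1) then C else C / mw (wt n))
    (fun i => by positivity) (fun i => h.bdd i n a b) (fun i => by
      split_ifs with hi
      · exact h.bdd i n a b
      · by_cases h1 : wt n < J i
        · exact h.low i n a b hw h1
        · exact h.high i n hw (by omega) a b) K
  have h2 : ∑ i ∈ Finset.range K, (if a ≤ s i ∧ s i < b then
      (if J i ≤ wt n ∧ wt n < s (i + 1) then C else C / mw (wt n)) else 0) ≤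
      C + ∑ i ∈ Finset.range K, (if a ≤ s i ∧ s i < b then C / mw (wt n) else 0) := by
    refine sum_le_of_exceptional (E := fun i => J i ≤ wt n ∧ wt n < s (i + 1)) _ hC.le ?_ ?_ ?_ ?_
    · intro i _ i' _ hi hi'
      exact h.eq_of_crossing (a := wt n) ⟨(h.le i).trans hi.1, hi.2⟩ ⟨(h.le i').trans hi'.1, hi'.2⟩
    · intro i _; positivity
    · intro i _ hi; simp [hi]
    · intro i _ hi
      split_ifs
      · exact le_rfl
      · exact hC.le
  rw [sum_ite_eq_mul_cnt] at h2
  linarith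

/-- Estimate of the sum of a rapidly increasing sequence by an induction over the depth of the
evaluation analysis. -/
lemma sum_le_depth (h : RIS y s J C) (j K d : ℕ) :
    ∀ n a b, |ev n (res a b (∑ i ∈ Finset.range K, y i))| ≤
      C * (2 * ageBound j + 2) ^ d + max (C / mw (j + 1)) (C / 4 ^ d) * cnt s K a b := by
  have hC := h.pos
  induction d with
  | zero =>
    intro n a b
    refine (h.sum_le_trivial K n a b).trans ?_
    have := cnt_nonneg s K a b
    have h2 : C ≤ max (C / mw (j + 1)) (C / 4 ^ 0) := by simp
    rw [pow_zero, mul_one]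
    gcongr
  | succ d ih =>
    intro n a b
    set Q : ℚ := 2 * ageBound j + 2 with hQ
    have hN : (1 : ℚ) ≤ ageBound j := by exact_mod_cast ageBound_pos j
    have hQd : (1 : ℚ) ≤ Q ^ d := one_le_pow₀ (by linarith)
    have hQd1 : Q ^ (d + 1) = Q ^ d * Q := pow_succ _ _
    have hcn := cnt_nonneg s K a b
    set τ := max (C / mw (j + 1)) (C / 4 ^ d) with hτ
    set τ' := max (C / mw (j + 1)) (C / 4 ^ (d + 1)) with hτ'
    have hm := mw_pos (j + 1)
    have hτ0 : 0 ≤ τ := le_max_of_le_left (by positivity)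
    have hτ'0 : 0 ≤ τ' := le_max_of_le_left (by positivity)
    have h2Q : 2 * C ≤ C * Q ^ (d + 1) := by
      rw [hQd1]
      have : 2 ≤ Q ^ d * Q := by nlinarith
      nlinarith
    by_cases hw : wt n = 0
    · rcases node_cases n with ⟨-, he⟩ | ⟨c₁, c₂, hs⟩ | ⟨ξ, c₁, c₂, hs⟩
      · have h1 := h.abs_sum_apply_le hC.le h.apply_le K n
        have h3 : 0 ≤ τ' * cnt s K a b := by positivity
        rw [he, res_apply]
        split_ifs
        · linarith
        · rw [abs_zero]; linarith
      · exact absurd hs.pos (by omega)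
      · exact absurd hs.pos (by omega)
    by_cases hwj : j + 1 ≤ wt n
    · refine (h.sum_le_of_wt_ne_zero K hw a b).trans ?_
      have h3 : C / mw (wt n) ≤ τ' := by
        refine le_max_of_le_left ?_
        gcongr
        exact mw_mono hwj
      gcongr
    · have h1 := ev_le_of_forall_le (by positivity) hτ0
        (h.abs_sum_apply_le hC.le h.apply_le K) ih n hw a b
      refine h1.trans ?_
      have hage : (age n : ℚ) ≤ ageBound j := by
        exact_mod_cast (age_le_ageBound n).trans (ageBound_mono (by omega))
      have hm4 : 1 / (mw (wt n) : ℚ) ≤ 1 / 4 :=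
        one_div_le_one_div_of_le (by norm_num) (four_le_mw_rat _)
      have hm0 : 0 ≤ 1 / (mw (wt n) : ℚ) := by have := mw_pos (wt n); positivity
      have hττ : τ / 4 ≤ τ' := by
        have e1 : C / mw (j + 1) ≤ τ' := le_max_left _ _
        have e2 : C / 4 ^ (d + 1) ≤ τ' := le_max_right _ _
        have e3 : C / 4 ^ d = 4 * (C / 4 ^ (d + 1)) := by rw [pow_succ]; field_simp
        have : τ ≤ 4 * τ' := max_le (by linarith) (by linarith)
        linarith
      have hage0 : (0 : ℚ) ≤ age n := Nat.cast_nonneg _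
      calc (age n : ℚ) * C + 1 / mw (wt n) * (age n * (C * Q ^ d) + τ * cnt s K a b)
          ≤ ageBound j * C + 1 / 4 * (ageBound j * (C * Q ^ d) + τ * cnt s K a b) := by
            gcongr
        _ ≤ C * Q ^ (d + 1) + τ / 4 * cnt s K a b := by
            rw [hQd1, hQ]
            have e1 : ageBound j * C ≤ ageBound j * C * Q ^ d :=
              le_mul_of_one_le_right (by positivity) hQd
            have e2 : 0 ≤ ageBound j * C * Q ^ d := by positivity
            have e3 : 0 ≤ C * Q ^ d := by positivity
            nlinarith
        _ ≤ C * Q ^ (d + 1) + τ' * cnt s K a b := by gcongr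

/-- The normalized averages of rapidly increasing sequences are exact. -/
theorem exact_average (h : RIS y s J C) (j n : ℕ) :
    Exact nodes n (j + 1) ((mw (j + 1) / (2 * C * ageBound (j + 1)) : ℚ) •
      ∑ i ∈ Finset.range (ageBound (j + 1)), y i) := by
  have hC := h.pos
  set M : ℚ := (mw (j + 1) : ℚ) with hM
  set N : ℚ := (ageBound (j + 1) : ℚ) with hN
  set Y := ∑ i ∈ Finset.range (ageBound (j + 1)), y i with hY
  have hM4 : 4 ≤ M := four_le_mw_rat _
  have hN2 : 2 * M * M ≤ N := by simp only [hM, hN]; exact_mod_cast mw_sq_le (j + 1)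
  have hNpos : 0 < N := by nlinarith
  set ρ : ℚ := M / (2 * C * N) with hρ
  have hρ0 : 0 < ρ := by positivity
  have hρC : ρ * C = M / (2 * N) := by rw [hρ]; field_simp
  have hMN : M / (2 * N) ≤ 1 / (4 * M) := by
    rw [div_le_div_iff₀ (by positivity) (by positivity)]; nlinarith
  have hM1 : 1 / (4 * M) = 1 / M / 4 := by rw [div_div, mul_comm]
  have hcnt : ∀ a b, cnt s (ageBound (j + 1)) a b ≤ N := fun a b => cnt_le _ _ _ _
  refine ⟨fun k => ?_, fun n _ _ hw a b => ?_⟩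
  · have h1 := h.abs_sum_apply_le hC.le h.apply_le (ageBound (j + 1)) k
    rw [Finsupp.smul_apply, smul_eq_mul, abs_mul, abs_of_pos hρ0]
    have h2 : ρ * |Y k| ≤ ρ * C := by gcongr
    have : 0 < 1 / M := by positivity
    linarith
  · rw [map_smul, map_smul, smul_eq_mul, abs_mul, abs_of_pos hρ0]
    change ρ * |ev n (res a b Y)| ≤ exactBound (wt n) (j + 1)
    change wt n ≠ 0 at hw
    set w := wt n with hw'
    have hmw := mw_pos w
    unfold exactBound
    split_ifs with h1 h2
    · have hd := ev_le_of_forall_le (κ := C * (2 * ageBound j + 2) ^ mw (j + 1)) (τ := C / M)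
        (s := s) (K := ageBound (j + 1)) (by positivity) (by positivity)
        (h.abs_sum_apply_le hC.le h.apply_le (ageBound (j + 1))) (fun n a b => by
          have h3 := h.sum_le_depth j (ageBound (j + 1)) (mw (j + 1)) n a b
          rwa [max_eq_left] at h3
          gcongr
          have : mw (j + 1) < 4 ^ mw (j + 1) := Nat.lt_pow_self (by norm_num)
          exact_mod_cast this.le) n hw a b
      rw [← hw'] at hd
      have hage : (age n : ℚ) ≤ ageBound j := by
        exact_mod_cast (age_le_ageBound n).trans (ageBound_mono (by omega))
      have hage0 : (0 : ℚ) ≤ age n := Nat.cast_nonneg _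
      have hcn := cnt_nonneg s (ageBound (j + 1)) a b
      have hmwM : (mw w : ℚ) ≤ M := by rw [hM]; exact_mod_cast mw_mono h1.le
      have hgrow : 2 * M * ageBound j * ((2 * ageBound j + 2) ^ mw (j + 1) + M) ≤ N := by
        simp only [hM, hN]; exact_mod_cast ageBound_growth j
      set Q : ℚ := (2 * ageBound j + 2) ^ mw (j + 1)
      have hQ0 : 0 ≤ Q := by positivity
      have h5 : (age n : ℚ) * C + 1 / mw w * (age n * (C * Q) +
          C / M * cnt s (ageBound (j + 1)) a b) ≤
          1 / mw w * (C * (ageBound j * (Q + M)) + C * (N / M)) := by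
        have e1 : (age n : ℚ) * C = 1 / mw w * (mw w * age n * C) := by field_simp
        rw [e1, ← mul_add]
        have e2 : (mw w : ℚ) * age n * C ≤ M * ageBound j * C := by gcongr
        have e3 : (age n : ℚ) * (C * Q) ≤ ageBound j * (C * Q) := by gcongr
        have e4 : C / M * cnt s (ageBound (j + 1)) a b ≤ C / M * N := by
          gcongr; exact hcnt a b
        have e5 : C / M * N = C * (N / M) := by ring
        refine mul_le_mul_of_nonneg_left ?_ (by positivity)
        nlinarith
      calc ρ * |ev n (res a b Y)| ≤ ρ * (1 / mw w * (C * (ageBound j * (Q + M)) + C * (N / M))) := by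
            gcongr; exact hd.trans h5
        _ = 1 / mw w * (ρ * C * (ageBound j * (Q + M) + N / M)) := by ring
        _ ≤ 1 / mw w * 1 := by
            refine mul_le_mul_of_nonneg_left ?_ (by positivity)
            rw [hρC]
            have e6 : M / (2 * N) * (ageBound j * (Q + M) + N / M) =
                (2 * M * ageBound j * (Q + M)) / (4 * N) + 1 / 2 := by field_simp; ring
            have e7 : (2 * M * ageBound j * (Q + M)) / (4 * N) ≤ 1 / 4 := by
              rw [div_le_iff₀ (by positivity)]; linarith
            linarith
        _ = 1 / mw w := mul_one _
    · have h3 := h.sum_le_of_wt_ne_zero (ageBound (j + 1)) hw a b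
      rw [← hw', h2] at h3
      have h4 : C / M * cnt s (ageBound (j + 1)) a b ≤ C / M * N := by
        gcongr; exact hcnt a b
      calc ρ * |ev n (res a b Y)| ≤ ρ * (2 * C + C / M * N) := by gcongr; linarith
        _ = 2 * (ρ * C) + ρ * C * N / M := by ring
        _ = 2 * (M / (2 * N)) + 1 / 2 := by rw [hρC]; field_simp
        _ ≤ 1 := by
            have : 1 / (4 * M) ≤ 1 / 4 := one_div_le_one_div_of_le (by norm_num) (by linarith)
            linarith
    · have h3 := h.sum_le_of_wt_ne_zero (ageBound (j + 1)) hw a b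
      rw [← hw'] at h3
      have hwM : M * M ≤ mw w := by
        have e1 : mw (j + 2) ≤ mw w := mw_mono (by omega)
        have e2 : mw (j + 1) * mw (j + 1) ≤ mw (j + 2) := by
          rw [mw_succ (j + 1)]
          have := mw_sq_le (j + 1)
          have := four_le_mw (j + 1)
          nlinarith
        simp only [hM]; exact_mod_cast e2.trans e1
      have h4 : C / mw w * cnt s (ageBound (j + 1)) a b ≤ C / (M * M) * N := by
        have := cnt_nonneg s (ageBound (j + 1)) a b
        gcongr; exact hcnt a b
      calc ρ * |ev n (res a b Y)| ≤ ρ * (2 * C + C / (M * M) * N) := by gcongr; linarith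
        _ = 2 * (ρ * C) + ρ * C * N / (M * M) := by ring
        _ = 2 * (M / (2 * N)) + 1 / M / 2 := by rw [hρC]; field_simp
        _ ≤ 1 / M := by linarith

end RIS

end BDSpace

namespace BDSpace

/-! ### Existence of nodes -/

/-- The functional given by two components. -/
def bev (B : Comp × Comp) : Vec →ₗ[ℚ] ℚ := cev B.1 + cev B.2

lemma bev_apply (B : Comp × Comp) (x : Vec) : bev B x = cev B.1 x + cev B.2 x := rfl

/-- The action of a component on the vector of its own weight in the special sequence `t`,
cut at `h`. -/
def matchC (c : Comp) (t : Seq) (h : ℕ) : ℚ :=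
  c.coef * ev c.node (res c.lo (min c.hi h) (partSum t (fun w => w = wt c.node)))

/-- The action of two components on the vectors of their own weights. -/
def matchB (B : Comp × Comp) (t : Seq) (h : ℕ) : ℚ := matchC B.1 t h + matchC B.2 t h

lemma abs_cev_sub_matchC_le {n j h : ℕ} {t : Seq} {c : Comp} (ht : Special nodes n t)
    (hn : c.node < n) (hc : j < wt c.node) :
    |cev c (res 0 h (partSum t (fun w => j < w))) - matchC c t h| ≤
      |c.coef| * (22 / mw (j + 1)) := by
  have h1 := ht.ev_sub_match_le hn hc c.lo (min c.hi h)
  rw [cev_res, matchC, ← mul_sub, abs_mul, max_eq_left (Nat.zero_le _)]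
  gcongr

lemma abs_cev_single_le {n j h : ℕ} {t : Seq} {c : Comp} (ht : Special nodes n t)
    (hc : c.Single) :
    |cev c (res 0 h (partSum t (fun w => j < w)))| ≤ |c.coef| * (22 / mw (j + 1)) := by
  have hm := mw_pos (j + 1)
  rw [cev_single hc, abs_mul]
  have h1 := ht.partSum_apply_le j c.node
  have h2 : (2 : ℚ) / mw (j + 1) ≤ 22 / mw (j + 1) := by gcongr; norm_num
  gcongr
  rw [res_apply]
  split_ifs
  · exact h1.trans h2
  · rw [abs_zero]; positivity

/-- A property which allows to sum the functionals `B i` with signs, where `B i` acts below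
`h i`. -/
def SignSummable (B : ℕ → Comp × Comp) (h : ℕ → ℕ) : Prop :=
  ∀ j n t, Special nodes n t → ∀ (S : Finset ℕ) (ε : ℕ → ℚ), (∀ i, |ε i| ≤ 1) →
    (∀ i ∈ S, j ≤ i ∧ h i ≤ n) → ∀ b,
      |∑ i ∈ S, ε i * bev (B i) (res 0 b (partSum t (fun w => j < w)))| ≤
        4 + S.card * (22 / mw (j + 1))

/-- A component is supported in `[l, h)` and comes from a node below `h`. -/
structure CompIn (i l h : ℕ) (c : Comp) : Prop where
  lo : l ≤ c.lo
  hi : c.hi ≤ h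
  node : c.node < h
  wt : c.Single ∨ i < wt c.node

/-- Sequences of vectors with functionals that can be summed by nodes. -/
structure GoodSeq (y : ℕ → Vec) (B : ℕ → Comp × Comp) (l h : ℕ → ℕ) (δ : ℚ) : Prop where
  pos : 0 < δ
  le : ∀ i, i ≤ l i
  lt : ∀ i, l i < h i
  succ : ∀ i, h i ≤ l (i + 1)
  supp : ∀ i, SuppIn (l i) (h i) (y i)
  comp₁ : ∀ i, CompIn i (l i) (h i) (B i).1
  comp₂ : ∀ i, CompIn i (l i) (h i) (B i).2
  coef : ∀ i, |(B i).1.coef| + |(B i).2.coef| ≤ 1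
  apply_ge : ∀ i, δ ≤ bev (B i) (y i)
  summable : SignSummable B h

lemma abs_sum_mul_le {S : Finset ℕ} {ε g : ℕ → ℚ} {C : ℚ} (hε : ∀ i, |ε i| ≤ 1)
    (hg : ∀ i ∈ S, |g i| ≤ C) : |∑ i ∈ S, ε i * g i| ≤ S.card * C := by
  refine (Finset.abs_sum_le_sum_abs _ _).trans ?_
  rw [← nsmul_eq_mul]
  refine Finset.sum_le_card_nsmul _ _ _ fun i hi => ?_
  rw [abs_mul]
  exact (mul_le_of_le_one_left (abs_nonneg _) (hε i)).trans (hg i hi)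

lemma signSummable_of_single {B : ℕ → Comp × Comp} {h : ℕ → ℕ}
    (hB : ∀ i, |(B i).1.coef| + |(B i).2.coef| ≤ 1) (h₁ : ∀ i, (B i).1.Single)
    (h₂ : ∀ i, (B i).2.Single) : SignSummable B h := by
  intro j n t ht S ε hε hS b
  have hm := mw_pos (j + 1)
  have := abs_sum_mul_le (S := S) (C := 22 / mw (j + 1)) hε
    (g := fun i => bev (B i) (res 0 b (partSum t (fun w => j < w)))) fun i _ => by
      rw [bev_apply]
      refine (abs_add_le _ _).trans ((add_le_add (abs_cev_single_le ht (h₁ i))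
        (abs_cev_single_le ht (h₂ i))).trans ?_)
      rw [← add_mul]
      exact mul_le_of_le_one_left (by positivity) (hB i)
  exact this.trans (by linarith)

lemma signSummable_of_matchB {B : ℕ → Comp × Comp} {h : ℕ → ℕ}
    (hB : ∀ i, |(B i).1.coef| + |(B i).2.coef| ≤ 1) (hn₁ : ∀ i, (B i).1.node < h i)
    (hn₂ : ∀ i, (B i).2.node < h i) (hw₁ : ∀ i, i < wt (B i).1.node)
    (hw₂ : ∀ i, i < wt (B i).2.node)
    (hM : ∀ n t, Special nodes n t → ∀ (S : Finset ℕ) (ε : ℕ → ℚ), (∀ i, |ε i| ≤ 1) →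
      (∀ i ∈ S, h i ≤ n) → ∀ b, |∑ i ∈ S, ε i * matchB (B i) t b| ≤ 4) : SignSummable B h := by
  intro j n t ht S ε hε hS b
  have hm := mw_pos (j + 1)
  have h1 := abs_sum_mul_le (S := S) (C := 22 / mw (j + 1)) hε
    (g := fun i => bev (B i) (res 0 b (partSum t (fun w => j < w))) - matchB (B i) t b)
    fun i hi => by
      have hi' := hS i hi
      rw [bev_apply, matchB, add_sub_add_comm]
      refine (abs_add_le _ _).trans ((add_le_add
        (abs_cev_sub_matchC_le ht ((hn₁ i).trans_le hi'.2) (hi'.1.trans_lt (hw₁ i)))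
        (abs_cev_sub_matchC_le ht ((hn₂ i).trans_le hi'.2) (hi'.1.trans_lt (hw₂ i)))).trans ?_)
      rw [← add_mul]
      exact mul_le_of_le_one_left (by positivity) (hB i)
  have h2 := hM n t ht S ε hε (fun i hi => (hS i hi).2) b
  simp only [mul_sub, Finset.sum_sub_distrib] at h1
  have := abs_sub_abs_le_abs_sub (∑ i ∈ S, ε i * bev (B i) (res 0 b (partSum t (fun w => j < w))))
    (∑ i ∈ S, ε i * matchB (B i) t b)
  linarith

/-- The sign of `i` given by a set. -/
def sgn (P : Finset ℕ) (i : ℕ) : ℚ := if i ∈ P then -1 else 1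

lemma abs_sgn (P : Finset ℕ) (i : ℕ) : |sgn P i| = 1 := by
  unfold sgn; split_ifs <;> simp

lemma cev_smul (ε : ℚ) (c : Comp) (x : Vec) : cev (ε * c.coef, c.2) x = ε * cev c x := by
  change (ε * c.coef) * ev c.node (res c.lo c.hi x) = ε * (c.coef * ev c.node (res c.lo c.hi x))
  ring

namespace GoodSeq

variable {y : ℕ → Vec} {B : ℕ → Comp × Comp} {l h : ℕ → ℕ} {δ : ℚ}

lemma monotone_l (G : GoodSeq y B l h δ) : StrictMono l :=
  strictMono_nat_of_lt_succ fun i => (G.lt i).trans_le (G.succ i)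

lemma h_le_l (G : GoodSeq y B l h δ) {i i' : ℕ} (hi : i < i') : h i ≤ l i' :=
  (G.succ i).trans (G.monotone_l.monotone hi)

lemma bev_eq_zero (G : GoodSeq y B l h δ) {i a b : ℕ} {x : Vec} (hx : SuppIn a b x)
    (hd : h i ≤ a ∨ b ≤ l i) : bev (B i) x = 0 := by
  have h1 := (G.comp₁ i).lo
  have h2 := (G.comp₁ i).hi
  have h3 := (G.comp₂ i).lo
  have h4 := (G.comp₂ i).hi
  rw [bev_apply, cev_eq_zero hx (by omega), cev_eq_zero hx (by omega), add_zero]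

lemma bev_ne (G : GoodSeq y B l h δ) {i i' : ℕ} (hi : i ≠ i') : bev (B i) (y i') = 0 := by
  refine G.bev_eq_zero (G.supp i') ?_
  rcases lt_or_gt_of_ne hi with hlt | hlt
  · exact Or.inl (G.h_le_l hlt)
  · exact Or.inr (G.h_le_l hlt)

/-- The state reached after summing the functionals with index in `S`. -/
structure Reached (B : ℕ → Comp × Comp) (l h : ℕ → ℕ) (j M : ℕ) (S P Q : Finset ℕ)
    (o : Option ℕ) : Prop where
  age_eq : o.elim 0 age = S.card
  card : Q.card ≤ S.card
  pred : ∀ ξ, o = some ξ → wt ξ = j ∧ ξ ≤ M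
  pos : ∀ k ∈ Q, wt k = j ∧ k ≤ M ∧ ∀ i ∈ S, k < l i ∨ h i ≤ k
  ev_eq : ∀ x, o.elim 0 (fun ξ => ev ξ) x =
    ∑ k ∈ Q, x k + 1 / mw j * ∑ i ∈ S, sgn P i * bev (B i) x

lemma exists_node_step (G : GoodSeq y B l h δ) {j M : ℕ} (hj : 1 ≤ j) {S P Q : Finset ℕ}
    {o : Option ℕ} (hS : S.card + 1 ≤ ageBound j) {q : ℕ} (hq : M < q) (hjq : j ≤ q)
    (hSq : ∀ i ∈ S, j ≤ i ∧ i < q) (hR : Reached B l h j M S P Q o) :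
    ∃ n, h q ≤ n ∧ ∀ M', n ≤ M' →
      Reached B l h j M' (insert q S) P (insert n Q) (some n) := by
  classical
  have hmj := mw_pos j
  have hmj1 := mw_pos (j + 1)
  have hqS : q ∉ S := fun hq' => absurd (hSq q hq').2 (lt_irrefl q)
  have hQlt : ∀ k ∈ Q, k < h q := fun k hk => by
    have := (hR.pos k hk).2.1; have := G.le q; have := G.lt q; omega
  let d : Data := (j, o, (sgn P q * (B q).1.coef, (B q).1.2), (sgn P q * (B q).2.coef, (B q).2.2))
  have hd : ∀ x, dataEv nodes d x =
      ∑ k ∈ Q, x k + 1 / mw j * ∑ i ∈ insert q S, sgn P i * bev (B i) x := fun x => by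
    have e1 : dataEv nodes d x = o.elim 0 (fun ξ => ev ξ) x + 1 / (mw j : ℚ) *
        (cev (sgn P q * (B q).1.coef, (B q).1.2) x +
          cev (sgn P q * (B q).2.coef, (B q).2.2) x) := rfl
    rw [e1, hR.ev_eq, cev_smul, cev_smul, Finset.sum_insert hqS, bev_apply]
    ring
  have hlegal : ∀ n, h q ≤ n → Legal nodes n d := fun n hn => by
    have hql := G.le q
    have hqh := G.lt q
    refine ⟨hj, (by change j ≤ n; omega), ?_, (G.comp₁ q).node.trans_le hn,
      (G.comp₂ q).node.trans_le hn, (G.comp₁ q).hi.trans hn, (G.comp₂ q).hi.trans hn,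
      fun ξ hξ => ?_, fun t ht b => ?_⟩
    · change |sgn P q * (B q).1.coef| + |sgn P q * (B q).2.coef| ≤ 1
      rw [abs_mul, abs_mul, abs_sgn, one_mul, one_mul]
      exact G.coef q
    · have h1 := hR.pred ξ hξ
      have h2 : age ξ = S.card := by
        have := hR.age_eq
        rw [show o = some ξ from hξ] at this
        exact this
      have h3 := (G.comp₁ q).lo
      have h4 := (G.comp₂ q).lo
      refine ⟨by omega, h1.1, (by change age ξ < ageBound j; omega), ?_, ?_, ?_, ?_⟩
      · change ξ < (B q).1.lo; omega
      · change ξ < (B q).2.lo; omega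
      · rcases (G.comp₁ q).wt with hs | hw
        · exact Or.inr hs
        · left; change ξ < wt (B q).1.node; omega
      · rcases (G.comp₂ q).wt with hs | hw
        · exact Or.inr hs
        · left; change ξ < wt (B q).2.node; omega
    · rw [hd]
      change |_ + 1 / (mw j : ℚ) * _| ≤ 5 / (mw j : ℚ)
      set x := res 0 b (partSum t fun w => j < w) with hx
      have hN : (S.card : ℚ) + 1 ≤ ageBound j := by exact_mod_cast hS
      have hNm : (mw (j + 1) : ℚ) = 64 * mw j * ageBound j := by rw [mw_succ]; push_cast; ring
      have hN1 : (1 : ℚ) ≤ ageBound j := by exact_mod_cast ageBound_pos j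
      have hcard : (Q.card : ℚ) ≤ S.card := by exact_mod_cast hR.card
      have hxk : ∀ k, |x k| ≤ 2 / mw (j + 1) := fun k => by
        rw [hx, res_apply]
        split_ifs
        · exact ht.partSum_apply_le j k
        · rw [abs_zero]; positivity
      have h1 : |∑ k ∈ Q, x k| ≤ ageBound j * (2 / mw (j + 1)) := by
        refine (Finset.abs_sum_le_sum_abs _ _).trans ((Finset.sum_le_card_nsmul Q _ _
          fun k _ => hxk k).trans ?_)
        rw [nsmul_eq_mul]
        have := hR.card
        gcongr
        omega
      have hSn : ∀ i ∈ insert q S, h i ≤ n := fun i hi => by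
        rcases Finset.mem_insert.mp hi with rfl | hi
        · exact hn
        · have := G.h_le_l (hSq i hi).2; omega
      have hSj : ∀ i ∈ insert q S, j ≤ i ∧ h i ≤ n := fun i hi => by
        refine ⟨?_, hSn i hi⟩
        rcases Finset.mem_insert.mp hi with rfl | hi
        · exact hjq
        · exact (hSq i hi).1
      have h2 := G.summable j n t ht (insert q S) (sgn P) (fun i => (abs_sgn P i).le) hSj b
      have h4 : |∑ i ∈ insert q S, sgn P i * bev (B i) x| ≤ 4 + ageBound j * (22 / mw (j + 1)) := by
        refine h2.trans ?_
        rw [Finset.card_insert_of_notMem hqS]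
        push_cast
        gcongr
      have h5 := abs_inv_mw_mul_le (w := j) h4
      refine (abs_add_le _ _).trans ((add_le_add h1 h5).trans ?_)
      have e1 : (ageBound j : ℚ) * (2 / mw (j + 1)) = (1 / 32) / mw j := by
        rw [hNm]; field_simp; norm_num
      have e2 : (ageBound j : ℚ) * (22 / mw (j + 1)) ≤ 22 / 64 := by
        rw [hNm]
        have : (ageBound j : ℚ) * (22 / (64 * mw j * ageBound j)) = 22 / 64 * (1 / mw j) := by
          field_simp
        rw [this]
        have : (1 : ℚ) / mw j ≤ 1 := by
          rw [div_le_one hmj]; linarith [four_le_mw_rat j]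
        linarith
      rw [e1, ← add_div]
      gcongr
      linarith
  obtain ⟨n, hn, hw, ha, he⟩ := exists_node_of_legal hlegal
  refine ⟨n, hn, fun M' hM' => ⟨?_, ?_, ?_, ?_, ?_⟩⟩
  · change age n = _
    rw [ha, Finset.card_insert_of_notMem hqS, ← hR.age_eq]
    change o.elim 1 (fun ξ => age ξ + 1) = o.elim 0 age + 1
    cases o <;> rfl
  · rw [Finset.card_insert_of_notMem hqS]
    exact (Finset.card_insert_le _ _).trans (Nat.succ_le_succ hR.card)
  · rintro ξ ⟨⟩
    exact ⟨hw, hM'⟩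
  · intro k hk
    have hql := G.le q
    rcases Finset.mem_insert.mp hk with rfl | hk
    · refine ⟨hw, hM', fun i hi => Or.inr ?_⟩
      rcases Finset.mem_insert.mp hi with rfl | hi
      · exact hn
      · have := G.h_le_l (hSq i hi).2; have := G.lt q; omega
    · have h1 := hR.pos k hk
      have := hQlt k hk
      refine ⟨h1.1, by omega, fun i hi => ?_⟩
      rcases Finset.mem_insert.mp hi with rfl | hi
      · left; omega
      · exact h1.2.2 i hi
  · intro x
    change ev n x = _
    rw [he, hd, Finset.sum_insert (s := Q) (fun hnQ => by have := hQlt n hnQ; omega)]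
    ring

/-- The signed sums of the functionals of a good sequence are realized by nodes. -/
theorem exists_nodes (G : GoodSeq y B l h δ) {j : ℕ} (hj : 1 ≤ j) (i₀ a : ℕ)
    (ha : a ≤ ageBound j) : ∃ S : Finset ℕ, S.card = a ∧ (∀ i ∈ S, i₀ ≤ i ∧ j ≤ i) ∧
      ∃ M, (∀ i ∈ S, i ≤ M) ∧ ∀ P, ∃ Q o, Reached B l h j M S P Q o := by
  classical
  induction a with
  | zero =>
    exact ⟨∅, rfl, by simp, 0, by simp, fun P => ⟨∅, none, by simp, by simp, by simp, by simp,
      by simp⟩⟩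
  | succ a ih =>
    obtain ⟨S, hS, hSi, M, hSM, hR⟩ := ih (by omega)
    set q := max (M + 1) (max i₀ j) with hq
    have hSq : ∀ i ∈ S, i < q := fun i hi => by have := hSM i hi; omega
    have hqS : q ∉ S := fun hq' => absurd (hSq q hq') (lt_irrefl q)
    have key : ∀ P : Finset ℕ, ∃ n Q, h q ≤ n ∧ ∀ M', n ≤ M' →
        Reached B l h j M' (insert q S) P Q (some n) := fun P => by
      obtain ⟨Q, o, hQ⟩ := hR P
      obtain ⟨n, hn, h1⟩ := G.exists_node_step hj (by omega) (show M < q by omega) (by omega)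
        (fun i hi => ⟨(hSi i hi).2, hSq i hi⟩) hQ
      exact ⟨n, _, hn, h1⟩
    choose f Q hf hfR using key
    refine ⟨insert q S, by rw [Finset.card_insert_of_notMem hqS, hS], fun i hi => ?_,
      max q ((insert q S).powerset.sup f), fun i hi => ?_, fun P => ?_⟩
    · rcases Finset.mem_insert.mp hi with rfl | hi
      · omega
      · exact hSi i hi
    · rcases Finset.mem_insert.mp hi with rfl | hi
      · exact le_max_left _ _
      · exact (hSq i hi).le.trans (le_max_left _ _)
    · set P' := P ∩ insert q S with hP'
      have h1 := hfR P' (max q ((insert q S).powerset.sup f))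
        ((Finset.le_sup (f := f) (Finset.mem_powerset.mpr Finset.inter_subset_right)).trans
          (le_max_right _ _))
      refine ⟨Q P', some (f P'), h1.age_eq, h1.card, h1.pred, h1.pos, fun x => ?_⟩
      rw [h1.ev_eq]
      congr 2
      refine Finset.sum_congr rfl fun i hi => ?_
      simp [sgn, hP', hi]

/-- The signed sums of the functionals of a good sequence are realized by nodes. -/
theorem exists_signed_nodes (G : GoodSeq y B l h δ) {j : ℕ} (hj : 1 ≤ j) (i₀ : ℕ) {a : ℕ}
    (ha₀ : 1 ≤ a) (ha : a ≤ ageBound j) : ∃ S : Finset ℕ, S.card = a ∧ (∀ i ∈ S, i₀ ≤ i) ∧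
      ∀ P, ∃ (Q : Finset ℕ) (n : ℕ), wt n = j ∧ Q.card ≤ a ∧
        (∀ k ∈ Q, wt k = j ∧ ∀ i ∈ S, k < l i ∨ h i ≤ k) ∧
        ∀ x, ev n x = ∑ k ∈ Q, x k + 1 / mw j * ∑ i ∈ S, sgn P i * bev (B i) x := by
  obtain ⟨S, hS, hi, M, -, hR⟩ := G.exists_nodes hj i₀ a ha
  refine ⟨S, hS, fun i hi' => (hi i hi').1, fun P => ?_⟩
  obtain ⟨Q, o, h1⟩ := hR P
  cases o with
  | none => have := h1.age_eq; simp only [Option.elim] at this; omega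
  | some n =>
    exact ⟨Q, n, (h1.pred n rfl).1, hS ▸ h1.card, fun k hk => ⟨(h1.pos k hk).1,
      (h1.pos k hk).2.2⟩, h1.ev_eq⟩

/-- The sum of the functionals of a good sequence is large on the sum of its vectors. -/
theorem exists_node_sum_ge (G : GoodSeq y B l h δ) {j : ℕ} (hj : 1 ≤ j) (i₀ : ℕ) {a : ℕ}
    (ha₀ : 1 ≤ a) (ha : a ≤ ageBound j) : ∃ S : Finset ℕ, S.card = a ∧ (∀ i ∈ S, i₀ ≤ i) ∧
      ∃ n, wt n = j ∧ a * δ / mw j ≤ ev n (∑ i ∈ S, y i) := by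
  obtain ⟨S, hS, hi, hR⟩ := G.exists_signed_nodes hj i₀ ha₀ ha
  obtain ⟨Q, n, hw, -, hQ, he⟩ := hR ∅
  refine ⟨S, hS, hi, n, hw, ?_⟩
  have h1 : ∑ k ∈ Q, (∑ i ∈ S, y i) k = 0 := Finset.sum_eq_zero fun k hk => by
    rw [Finsupp.finsetSum_apply]
    exact Finset.sum_eq_zero fun i hi => (G.supp i).apply_eq_zero ((hQ k hk).2 i hi)
  have h2 : a * δ ≤ ∑ i ∈ S, sgn ∅ i * bev (B i) (∑ i ∈ S, y i) := by
    rw [← hS, ← nsmul_eq_mul]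
    refine Finset.card_nsmul_le_sum _ _ _ fun i hi => ?_
    rw [map_sum, Finset.sum_eq_single i (fun i' _ hne => G.bev_ne hne.symm)
      (fun h => absurd hi h)]
    simpa [sgn] using G.apply_ge i
  have := mw_pos j
  rw [he, h1, zero_add, div_eq_mul_one_div, mul_comm]
  gcongr

end GoodSeq

end BDSpace

namespace BDSpace

/-! ### Matching of special sequences with chains and antichains of weights -/

lemma Special.partSum_eq_vec {n : ℕ} {t : Seq} (ht : Special nodes n t) {p : ℕ}
    (hp : p < t.length) : partSum t (fun w => w = wtSeq t p) = vec t p := by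
  have : (Finset.range t.length).filter (fun i' => wtSeq t i' = wtSeq t p) = {p} := by
    ext i'
    simp only [Finset.mem_filter, Finset.mem_range, Finset.mem_singleton]
    constructor
    · rintro ⟨h1, h2⟩
      rcases lt_trichotomy p i' with hlt | heq | hlt
      · have := ht.2 p i' hlt h1; omega
      · exact heq.symm
      · have := ht.2 i' p hlt hp; omega
    · rintro rfl; exact ⟨hp, rfl⟩
  rw [partSum, this, Finset.sum_singleton]

/-- The weight `w` occurs in the sequence `t`. -/
def Hit (t : Seq) (w : ℕ) : Prop := ∃ p < t.length, wtSeq t p = w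

lemma partSum_eq_zero {t : Seq} {w : ℕ} (h : ¬ Hit t w) :
    partSum t (fun v => v = w) = 0 := by
  unfold Hit at h
  push Not at h
  rw [partSum, Finset.filter_eq_empty_iff.mpr (fun i hi => h i (by simpa using hi))]
  simp

lemma wtSeq_append (s : Seq) (a : ℕ) (x : Vec) (r : Seq) :
    wtSeq (s ++ [(a, x)] ++ r) s.length = code s a ∧ vec (s ++ [(a, x)] ++ r) s.length = x := by
  simp [wtSeq, vec]

lemma matchC_eq_zero {c : Comp} {t : Seq} (h : ¬ Hit t (wt c.node)) (b : ℕ) :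
    matchC c t b = 0 := by
  rw [matchC, partSum_eq_zero h, map_zero, map_zero, mul_zero]

lemma matchC_eq_zero_of_le {c : Comp} {t : Seq} {b : ℕ} (h : b ≤ c.lo) : matchC c t b = 0 := by
  rw [matchC, res_eq_zero_of_le (by omega), map_zero, mul_zero]

lemma Special.abs_matchC_le {n : ℕ} {t : Seq} (ht : Special nodes n t) {c : Comp} (hc : c.node < n)
    (b : ℕ) : |matchC c t b| ≤ |c.coef| * 2 := by
  rw [matchC, abs_mul]
  have := ht.partSum_eq_le_two hc (wt c.node) c.lo (min c.hi b)
  gcongr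

lemma Special.abs_matchB_le {n : ℕ} {t : Seq} (ht : Special nodes n t) {B : Comp × Comp}
    (h₁ : B.1.node < n) (h₂ : B.2.node < n) (hB : |B.1.coef| + |B.2.coef| ≤ 1) (b : ℕ) :
    |matchB B t b| ≤ 2 := by
  refine (abs_add_le _ _).trans ((add_le_add (ht.abs_matchC_le h₁ b)
    (ht.abs_matchC_le h₂ b)).trans ?_)
  linarith

lemma abs_signed_sum_le {S : Finset ℕ} {ε g : ℕ → ℚ} (hε : ∀ i, |ε i| ≤ 1) :
    |∑ i ∈ S, ε i * g i| ≤ ∑ i ∈ S, |g i| := by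
  refine (Finset.abs_sum_le_sum_abs _ _).trans (Finset.sum_le_sum fun i _ => ?_)
  rw [abs_mul]
  exact mul_le_of_le_one_left (abs_nonneg _) (hε i)

/-- A weight codes an extension of the sequence coded by another weight. -/
def CodeLT (w w' : ℕ) : Prop :=
  ∃ s a z s' a', w = code s a ∧ w' = code s' a' ∧ s ++ [(a, z)] <+: s'

lemma CodeLT.trans {u v w : ℕ} (h : CodeLT u v) (h' : CodeLT v w) : CodeLT u w := by
  obtain ⟨s, a, z, s', a', h1, h2, h3⟩ := h
  obtain ⟨r, b, y, r', b', h4, h5, h6⟩ := h'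
  obtain ⟨rfl, rfl⟩ := code_inj (h2.symm.trans h4)
  exact ⟨s, a, z, r', b', h1, h5, h3.trans ((List.prefix_append _ _).trans h6)⟩

lemma codeLT_wtSeq (t : Seq) {p p' : ℕ} (h : p < p') (hp : p' ≤ t.length) :
    CodeLT (wtSeq t p) (wtSeq t p') := by
  refine ⟨t.take p, _, vec t p, t.take p', _, rfl, rfl, ?_⟩
  have h1 : t.take p ++ [((t.getD p (0, 0)).1, vec t p)] = t.take (p + 1) := by
    have hp' : p < t.length := by omega
    rw [List.take_add_one, vec, List.getD_eq_getElem _ _ hp', List.getElem?_eq_getElem hp']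
    simp
  rw [h1]
  exact List.take_prefix_take_left (by omega)

/-- A special sequence hits at most one element of an antichain of weights. -/
lemma abs_sum_matchB_le_of_antichain {η : ℕ → ℕ} {c : ℕ → Comp × Comp} {h : ℕ → ℕ}
    (hη₁ : ∀ i, (c i).1.node = η i) (hη₂ : ∀ i, (c i).2.node = η i) (hn : ∀ i, η i < h i)
    (hB : ∀ i, |(c i).1.coef| + |(c i).2.coef| ≤ 1) (hmono : StrictMono fun i => wt (η i))
    (hr : ∀ i i', i < i' → ¬ CodeLT (wt (η i)) (wt (η i'))) (n : ℕ) (t : Seq)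
    (ht : Special nodes n t) (S : Finset ℕ) (ε : ℕ → ℚ) (hε : ∀ i, |ε i| ≤ 1)
    (hS : ∀ i ∈ S, h i ≤ n) (b : ℕ) : |∑ i ∈ S, ε i * matchB (c i) t b| ≤ 4 := by
  refine (abs_signed_sum_le hε).trans ?_
  have hlt : ∀ i i', i < i' → Hit t (wt (η i)) → Hit t (wt (η i')) → False := by
    rintro i i' hi ⟨p, hp, h1⟩ ⟨p', hp', h2⟩
    have hw := hmono hi
    refine hr i i' hi ?_
    rw [← h1, ← h2]
    refine codeLT_wtSeq t ?_ hp'.le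
    rcases lt_trichotomy p p' with hlt | heq | hlt
    · exact hlt
    · subst heq; simp only at hw; omega
    · have := ht.2 p' p hlt hp; simp only at hw; omega
  have := sum_le_of_exceptional S (g := fun i => |matchB (c i) t b|) (β := fun _ => 0)
    (E := fun i => Hit t (wt (η i))) (C := 2) (by norm_num)
    (fun i _ i' _ hi hi' => by
      rcases lt_trichotomy i i' with hlt' | heq | hlt'
      · exact (hlt i i' hlt' hi hi').elim
      · exact heq
      · exact (hlt i' i hlt' hi' hi).elim) (fun _ _ => le_rfl)
    (fun i _ hi => by
      rw [matchB, matchC_eq_zero (by rwa [hη₁ i]), matchC_eq_zero (by rwa [hη₂ i])]; simp)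
    (fun i hi _ => ht.abs_matchB_le (by rw [hη₁]; exact (hn i).trans_le (hS i hi))
      (by rw [hη₂]; exact (hn i).trans_le (hS i hi)) (hB i) b)
  rw [Finset.sum_const_zero] at this
  linarith

/-- Components whose weights code the initial parts of a sequence of vectors. -/
structure WeightChain (w : ℕ → ℕ) (x : ℕ → Vec) (s : ℕ → Seq) (a : ℕ → ℕ) : Prop where
  wt_eq : ∀ k, w k = code (s k) (a k)
  succ : ∀ k, s k ++ [(a k, x k)] <+: s (k + 1)

lemma WeightChain.isPrefix {w : ℕ → ℕ} {x : ℕ → Vec} {s : ℕ → Seq} {a : ℕ → ℕ}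
    (C : WeightChain w x s a) {k k' : ℕ} (h : k < k') : s k ++ [(a k, x k)] <+: s k' := by
  induction k', h using Nat.le_induction with
  | base => exact C.succ k
  | succ m _ ih => exact ih.trans ((List.prefix_append _ _).trans (C.succ m))

lemma WeightChain.hit {w : ℕ → ℕ} {x : ℕ → Vec} {s : ℕ → Seq} {a : ℕ → ℕ}
    (C : WeightChain w x s a) {n : ℕ} {t : Seq} (ht : Special nodes n t) {k k' : ℕ} (h : k < k')
    (hk' : Hit t (w k')) :
    Hit t (w k) ∧ partSum t (fun v => v = w k) = x k := by
  obtain ⟨p, hp, hpw⟩ := hk'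
  have h1 : t.take p = s k' := (code_inj (hpw.trans (C.wt_eq k'))).1
  obtain ⟨r, hr⟩ := ((C.isPrefix h).trans (h1 ▸ (⟨t.drop p, List.take_append_drop p t⟩ : t.take p <+: t)) : s k ++ [(a k, x k)] <+: t)
  subst hr
  obtain ⟨h2, h3⟩ := wtSeq_append (s k) (a k) (x k) r
  have h4 : (s k).length < (s k ++ [(a k, x k)] ++ r).length := by simp
  refine ⟨⟨_, h4, h2.trans (C.wt_eq k).symm⟩, ?_⟩
  have := ht.partSum_eq_vec h4
  rwa [h2, h3, ← C.wt_eq k] at this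

/-- Pairs of components which cancel on a chain. -/
lemma WeightChain.abs_sum_matchB_le {η lo hi : ℕ → ℕ} {x : ℕ → Vec} {s : ℕ → Seq} {a : ℕ → ℕ}
    (C : WeightChain (fun k => wt (η k)) x s a) {p q : ℕ → ℚ} {l h : ℕ → ℕ}
    {B : ℕ → Comp × Comp} (hB : ∀ i, B i = ((p i, η (2 * i), lo (2 * i), hi (2 * i)),
      (q i, η (2 * i + 1), lo (2 * i + 1), hi (2 * i + 1))))
    (hsucc : ∀ i, h i ≤ l (i + 1)) (hlh : ∀ i, l i < h i)
    (hlo₁ : ∀ i, l i ≤ lo (2 * i)) (hlo₂ : ∀ i, l i ≤ lo (2 * i + 1))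
    (hhi₁ : ∀ i, hi (2 * i) ≤ h i) (hhi₂ : ∀ i, hi (2 * i + 1) ≤ h i)
    (hn₁ : ∀ i, η (2 * i) < h i) (hn₂ : ∀ i, η (2 * i + 1) < h i)
    (hpq : ∀ i, |p i| + |q i| ≤ 1)
    (hz : ∀ i, p i * ev (η (2 * i)) (res (lo (2 * i)) (hi (2 * i)) (x (2 * i))) +
      q i * ev (η (2 * i + 1)) (res (lo (2 * i + 1)) (hi (2 * i + 1)) (x (2 * i + 1))) = 0)
    (n : ℕ) (t : Seq)
    (ht : Special nodes n t) (S : Finset ℕ) (ε : ℕ → ℚ) (hε : ∀ i, |ε i| ≤ 1)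
    (hS : ∀ i ∈ S, h i ≤ n) (b : ℕ) :
    |∑ i ∈ S, ε i * matchB (B i) t b| ≤ 4 := by
  refine (abs_signed_sum_le hε).trans ?_
  have hmono : ∀ i i', i < i' → h i ≤ l i' := fun i i' hi => by
    induction i', hi using Nat.le_induction with
    | base => exact hsucc i
    | succ m _ ih => exact ih.trans ((hlh m).le.trans (hsucc m))
  have hdown : ∀ k k', k < k' → Hit t (wt (η k')) →
      Hit t (wt (η k)) ∧ partSum t (fun v => v = wt (η k)) = x k :=
    fun k k' hk h' => C.hit ht hk h'
  have hbd : ∀ i ∈ S, |matchB (B i) t b| ≤ 2 := fun i hi' =>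
    ht.abs_matchB_le (by rw [hB]; exact (hn₁ i).trans_le (hS i hi'))
      (by rw [hB]; exact (hn₂ i).trans_le (hS i hi')) (by rw [hB]; exact hpq i) b
  classical
  have hcut : ∑ i ∈ S, (if l i < b ∧ b < h i then (2 : ℚ) else 0) ≤ 2 := by
    have := sum_le_of_exceptional S (g := fun i => if l i < b ∧ b < h i then (2 : ℚ) else 0)
      (β := fun _ => 0) (E := fun i => l i < b ∧ b < h i) (C := 2) (by norm_num)
      (fun i _ i' _ h1 h2 => by
        rcases lt_trichotomy i i' with hlt | heq | hlt
        · have := hmono i i' hlt; omega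
        · exact heq
        · have := hmono i' i hlt; omega) (fun _ _ => le_rfl) (fun i _ h1 => by rw [if_neg h1])
      (fun i _ h1 => by rw [if_pos h1])
    rwa [Finset.sum_const_zero, add_zero] at this
  refine (sum_le_of_exceptional S (β := fun i => if l i < b ∧ b < h i then (2 : ℚ) else 0)
    (E := fun i => Hit t (wt (η (2 * i))) ∧ ¬ Hit t (wt (η (2 * i + 2)))) (C := 2) (by norm_num) ?_ ?_ ?_ ?_).trans
      (by linarith)
  · have : ∀ i i', i < i' → ¬ Hit t (wt (η (2 * i + 2))) → ¬ Hit t (wt (η (2 * i'))) := fun i i' hlt h1 h2 => by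
      rcases Nat.lt_or_ge (2 * i + 2) (2 * i') with h3 | h3
      · exact h1 (hdown _ _ h3 h2).1
      · have e : 2 * i + 2 = 2 * i' := by omega
        rw [e] at h1
        exact h1 h2
    intro i _ i' _ h1 h2
    rcases lt_trichotomy i i' with hlt | heq | hlt
    · exact (this i i' hlt h1.2 h2.1).elim
    · exact heq
    · exact (this i' i hlt h2.2 h1.1).elim
  · intro i _; split_ifs <;> norm_num
  · intro i hi' hE
    split_ifs with hb
    · exact hbd i hi'
    refine le_of_eq (abs_eq_zero.mpr ?_)
    by_cases hbl : b ≤ l i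
    · rw [matchB, matchC_eq_zero_of_le (c := (B i).1) (by rw [hB]; exact hbl.trans (hlo₁ i)),
        matchC_eq_zero_of_le (c := (B i).2) (by rw [hB]; exact hbl.trans (hlo₂ i)), add_zero]
    by_cases h0 : Hit t (wt (η (2 * i)))
    · have h2 : Hit t (wt (η (2 * i + 2))) := by tauto
      have e1 := (hdown (2 * i) (2 * i + 2) (by omega) h2).2
      have e2 := (hdown (2 * i + 1) (2 * i + 2) (by omega) h2).2
      have e3 := hhi₁ i
      have e4 := hhi₂ i
      rw [matchB, hB, matchC, matchC]
      change p i * ev (η (2 * i)) (res (lo (2 * i)) (min (hi (2 * i)) b)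
        (partSum t fun w => w = wt (η (2 * i)))) + q i * ev (η (2 * i + 1))
        (res (lo (2 * i + 1)) (min (hi (2 * i + 1)) b)
          (partSum t fun w => w = wt (η (2 * i + 1)))) = 0
      rw [e1, e2, min_eq_left (by omega), min_eq_left (by omega)]
      exact hz i
    · have h1 : ¬ Hit t (wt (η (2 * i + 1))) := fun h1 => h0 (hdown (2 * i) (2 * i + 1) (by omega) h1).1
      rw [matchB, matchC_eq_zero (c := (B i).1) (by rw [hB]; exact h0),
        matchC_eq_zero (c := (B i).2) (by rw [hB]; exact h1), add_zero]
  · exact fun i hmem _ => hbd i hmem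

/-! ### Extraction of good sequences -/

/-- Vectors which are normed by nodes of increasing weights. -/
structure NormSeq (y : ℕ → Vec) (η lo hi l h : ℕ → ℕ) (δ : ℚ) : Prop where
  pos : 0 < δ
  le : ∀ i, i ≤ l i
  lt : ∀ i, l i < h i
  succ : ∀ i, h i ≤ l (i + 1)
  supp : ∀ i, SuppIn (l i) (h i) (y i)
  lo_ge : ∀ i, l i ≤ lo i
  hi_le : ∀ i, hi i ≤ h i
  node : ∀ i, η i < h i
  wt_gt : ∀ i, i < wt (η i)
  wt_mono : StrictMono fun i => wt (η i)
  ge : ∀ i, δ ≤ |ev (η i) (res (lo i) (hi i) (y i))|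

lemma NormSeq.monotone_l {y : ℕ → Vec} {η lo hi l h : ℕ → ℕ} {δ : ℚ}
    (A : NormSeq y η lo hi l h δ) : StrictMono l :=
  strictMono_nat_of_lt_succ fun i => (A.lt i).trans_le (A.succ i)

lemma NormSeq.comp {y : ℕ → Vec} {η lo hi l h : ℕ → ℕ} {δ : ℚ} (A : NormSeq y η lo hi l h δ)
    {φ : ℕ → ℕ} (hφ : StrictMono φ) :
    NormSeq (y ∘ φ) (η ∘ φ) (lo ∘ φ) (hi ∘ φ) (l ∘ φ) (h ∘ φ) δ where
  pos := A.pos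
  le i := (hφ.id_le i).trans (A.le _)
  lt _ := A.lt _
  succ i := (A.succ _).trans (A.monotone_l.monotone (hφ (Nat.lt_succ_self i)))
  supp _ := A.supp _
  lo_ge _ := A.lo_ge _
  hi_le _ := A.hi_le _
  node _ := A.node _
  wt_gt i := (hφ.id_le i).trans_lt (A.wt_gt _)
  wt_mono := A.wt_mono.comp hφ
  ge _ := A.ge _

lemma IsBlock.exists_normSeq {y : ℕ → Vec} {s : ℕ → ℕ} (hy : IsBlock y s) (hs : StrictMono s)
    {δ : ℚ} (hδ : 0 < δ)
    (H : ∀ W, ∃ k, W ≤ k ∧ ∃ m a b, W ≤ wt m ∧ δ ≤ |ev m (res a b (y k))|) :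
    ∃ κ η lo hi l h, StrictMono κ ∧ NormSeq (y ∘ κ) η lo hi l h δ := by
  choose K hK m a b hm hge using H
  let W : ℕ → ℕ := fun i => Nat.rec 1
    (fun _ W => K W + s (K W + 1) + m W + wt (m W) + W + 1) i
  have hW : ∀ i, W (i + 1) =
    K (W i) + s (K (W i) + 1) + m (W i) + wt (m (W i)) + W i + 1 := fun i => rfl
  have hWi : ∀ i, i < W i := fun i => by
    induction i with
    | zero => exact Nat.one_pos
    | succ i ih => rw [hW]; omega
  refine ⟨fun i => K (W i), fun i => m (W i), fun i => max (s (K (W i))) (a (W i)),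
    fun i => min (s (K (W i) + 1)) (b (W i)), fun i => s (K (W i)),
    fun i => max (s (K (W i) + 1)) (m (W i) + 1), strictMono_nat_of_lt_succ fun i => ?_,
    ⟨hδ, fun i => ?_, fun i => ?_, fun i => ?_, fun i => ?_, fun i => le_max_left _ _, fun i => ?_,
      fun i => ?_, fun i => ?_, strictMono_nat_of_lt_succ fun i => ?_, fun i => ?_⟩⟩
  · have := hK (W (i + 1)); rw [hW] at this ⊢; omega
  · have h1 := hK (W i); have h2 := hs.id_le (K (W i)); have := hWi i; simp only [id] at h2; omega
  · exact (hs (Nat.lt_succ_self _)).trans_le (le_max_left _ _)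
  · have h1 := hK (W (i + 1)); have h2 := hs.id_le (K (W (i + 1))); have := hW i
    simp only [id] at h2; omega
  · exact (hy.supp _).mono le_rfl (le_max_left _ _)
  · exact (min_le_left _ _).trans (le_max_left _ _)
  · exact (Nat.lt_succ_self _).trans_le (le_max_right _ _)
  · exact (hWi i).trans_le (hm _)
  · have := hm (W (i + 1)); have := hW i; omega
  · have h1 := hge (W i)
    rw [← (hy.supp (K (W i))).res_eq le_rfl le_rfl, res_res, max_comm, min_comm] at h1
    exact h1

lemma exists_sign_mul {δ β : ℚ} (h : δ ≤ |β|) : ∃ ε : ℚ, |ε| = 1 ∧ δ ≤ ε * β := by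
  rcases abs_cases β with ⟨h1, -⟩ | ⟨h1, -⟩
  · exact ⟨1, by simp, by linarith⟩
  · exact ⟨-1, by simp, by linarith⟩

lemma IsBlock.exists_goodSeq_of_apply {y : ℕ → Vec} {s : ℕ → ℕ} (hy : IsBlock y s)
    (hs : StrictMono s) {δ : ℚ} (hδ : 0 < δ) (H : ∀ W, ∃ k, W ≤ k ∧ ∃ m, δ ≤ |y k m|) :
    ∃ κ B l h, StrictMono κ ∧ GoodSeq (y ∘ κ) B l h δ := by
  choose K hK m hge using H
  choose ε hε hεge using fun W => exists_sign_mul (hge W)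
  let W : ℕ → ℕ := fun i => Nat.rec 1 (fun _ W => K W + W + 1) i
  have hW : ∀ i, W (i + 1) = K (W i) + W i + 1 := fun i => rfl
  have hWi : ∀ i, i < W i := fun i => by
    induction i with
    | zero => exact Nat.one_pos
    | succ i ih => rw [hW]; omega
  have hm : ∀ W, s (K W) ≤ m W ∧ m W < s (K W + 1) := fun W => hy.supp (K W) (m W) (by
    intro h0
    have := hge W
    rw [h0, abs_zero] at this
    linarith)
  have hKK : ∀ i, K (W i) < K (W (i + 1)) := fun i => by
    have := hK (W (i + 1)); rw [hW] at this ⊢; omega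
  let B : ℕ → Comp × Comp := fun i => ((ε (W i), m (W i), m (W i), m (W i) + 1),
    (0, m (W i), m (W i), m (W i) + 1))
  have hs₁ : ∀ i, (B i).1.Single := fun i => ⟨rfl, rfl⟩
  have hs₂ : ∀ i, (B i).2.Single := fun i => ⟨rfl, rfl⟩
  have hcoef : ∀ i, |(B i).1.coef| + |(B i).2.coef| ≤ 1 := fun i => by
    change |ε (W i)| + |(0 : ℚ)| ≤ 1
    rw [hε, abs_zero, add_zero]
  refine ⟨fun i => K (W i), B, fun i => s (K (W i)), fun i => s (K (W i) + 1),
    strictMono_nat_of_lt_succ hKK,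
    ⟨hδ, fun i => ?_, fun i => hs (Nat.lt_succ_self _), fun i => hs.monotone (hKK i),
      fun i => hy.supp _, fun i => ⟨(hm _).1, (hm _).2, (hm _).2, Or.inl (hs₁ i)⟩,
      fun i => ⟨(hm _).1, (hm _).2, (hm _).2, Or.inl (hs₂ i)⟩, hcoef, fun i => ?_,
      signSummable_of_single hcoef hs₁ hs₂⟩⟩
  · have h1 := hK (W i); have h2 := hs.id_le (K (W i)); have := hWi i; simp only [id] at h2; omega
  · rw [bev_apply, cev_single (hs₁ i), cev_single (hs₂ i)]
    change δ ≤ ε (W i) * y (K (W i)) (m (W i)) + 0 * y (K (W i)) (m (W i))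
    rw [zero_mul, add_zero]
    exact hεge _

lemma NormSeq.exists_goodSeq_of_antichain {y : ℕ → Vec} {η lo hi l h : ℕ → ℕ} {δ : ℚ}
    (A : NormSeq y η lo hi l h δ) (hr : ∀ i i', i < i' → ¬ CodeLT (wt (η i)) (wt (η i'))) :
    ∃ B, GoodSeq y B l h δ := by
  choose ε hε hεge using fun i => exists_sign_mul (A.ge i)
  let B : ℕ → Comp × Comp := fun i => ((ε i, η i, lo i, hi i), (0, η i, lo i, hi i))
  have hcoef : ∀ i, |(B i).1.coef| + |(B i).2.coef| ≤ 1 := fun i => by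
    change |ε i| + |(0 : ℚ)| ≤ 1
    rw [hε, abs_zero, add_zero]
  refine ⟨B, A.pos, A.le, A.lt, A.succ, A.supp,
    fun i => ⟨A.lo_ge i, A.hi_le i, A.node i, Or.inr (A.wt_gt i)⟩,
    fun i => ⟨A.lo_ge i, A.hi_le i, A.node i, Or.inr (A.wt_gt i)⟩, hcoef, fun i => ?_,
    signSummable_of_matchB hcoef A.node A.node A.wt_gt A.wt_gt
      (abs_sum_matchB_le_of_antichain (η := η) (fun _ => rfl) (fun _ => rfl) A.node hcoef
        A.wt_mono hr)⟩
  rw [bev_apply, cev_apply, cev_apply]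
  change δ ≤ ε i * ev (η i) (res (lo i) (hi i) (y i)) + 0 * _
  rw [zero_mul, add_zero]
  exact hεge i

lemma exists_cancelling_of_abs_le {α α' β δ : ℚ} (hβ : δ ≤ |β|) (h : |α| ≤ |α'|) :
    ∃ p q : ℚ, |p| + |q| ≤ 1 ∧ p * α + q * α' = 0 ∧ δ / 2 ≤ p * β := by
  obtain ⟨ε, hε, hεβ⟩ := exists_sign_mul hβ
  have hp : |ε / 2| = 1 / 2 := by rw [abs_div, hε]; norm_num
  by_cases h0 : α' = 0
  · have : α = 0 := by rw [h0, abs_zero] at h; exact abs_nonpos_iff.mp h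
    exact ⟨ε / 2, 0, by rw [hp, abs_zero]; norm_num, by rw [this]; ring, by linarith⟩
  · refine ⟨ε / 2, -(ε / 2 * (α / α')), ?_, by field_simp; ring, by linarith⟩
    rw [abs_neg, abs_mul, hp, abs_div]
    have : |α| / |α'| ≤ 1 := div_le_one_of_le₀ h (abs_nonneg _)
    linarith

lemma NormSeq.exists_goodSeq_of_chain {y : ℕ → Vec} {η lo hi l h : ℕ → ℕ} {δ : ℚ}
    (A : NormSeq y η lo hi l h δ) {x : ℕ → Vec} {s : ℕ → Seq} {a : ℕ → ℕ}
    (C : WeightChain (fun k => wt (η k)) x s a) :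
    ∃ κ B l' h', StrictMono κ ∧ GoodSeq (y ∘ κ) B l' h' (δ / 2) := by
  set α : ℕ → ℚ := fun k => ev (η k) (res (lo k) (hi k) (x k)) with hα
  set β : ℕ → ℚ := fun k => ev (η k) (res (lo k) (hi k) (y k)) with hβ
  have key : ∀ i, ∃ (e : ℕ) (p q : ℚ), |p| + |q| ≤ 1 ∧ p * α (2 * i) + q * α (2 * i + 1) = 0 ∧
      ((e = 2 * i ∧ δ / 2 ≤ p * β (2 * i)) ∨ (e = 2 * i + 1 ∧ δ / 2 ≤ q * β (2 * i + 1))) := by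
    intro i
    rcases le_total |α (2 * i)| |α (2 * i + 1)| with hle | hle
    · obtain ⟨p, q, h1, h2, h3⟩ := exists_cancelling_of_abs_le (A.ge (2 * i)) hle
      exact ⟨2 * i, p, q, h1, h2, Or.inl ⟨rfl, h3⟩⟩
    · obtain ⟨q, p, h1, h2, h3⟩ := exists_cancelling_of_abs_le (A.ge (2 * i + 1)) hle
      exact ⟨2 * i + 1, p, q, by linarith, by linarith, Or.inr ⟨rfl, h3⟩⟩
  choose e p q hpq hz he using key
  have he' : ∀ i, e i = 2 * i ∨ e i = 2 * i + 1 := fun i => (he i).imp And.left And.left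
  have hl := A.monotone_l
  have hl01 : ∀ i, l (2 * i) < l (2 * i + 1) := fun i => hl (Nat.lt_succ_self _)
  have hh01 : ∀ i, h (2 * i) ≤ l (2 * i + 1) := fun i => A.succ (2 * i)
  have hlt1 : ∀ i, l (2 * i + 1) < h (2 * i + 1) := fun i => A.lt _
  let B : ℕ → Comp × Comp := fun i => ((p i, η (2 * i), lo (2 * i), hi (2 * i)),
    (q i, η (2 * i + 1), lo (2 * i + 1), hi (2 * i + 1)))
  have hn₁ : ∀ i, η (2 * i) < h (2 * i + 1) := fun i => by
    have := A.node (2 * i); have := hh01 i; have := hlt1 i; omega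
  have hn₂ : ∀ i, η (2 * i + 1) < h (2 * i + 1) := fun i => A.node _
  have hw₁ : ∀ i, i < wt (η (2 * i)) := fun i => by have := A.wt_gt (2 * i); omega
  have hw₂ : ∀ i, i < wt (η (2 * i + 1)) := fun i => by have := A.wt_gt (2 * i + 1); omega
  have hlo₁ : ∀ i, l (2 * i) ≤ lo (2 * i) := fun i => A.lo_ge _
  have hlo₂ : ∀ i, l (2 * i) ≤ lo (2 * i + 1) := fun i => (hl01 i).le.trans (A.lo_ge _)
  have hhi₁ : ∀ i, hi (2 * i) ≤ h (2 * i + 1) := fun i => by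
    have := A.hi_le (2 * i); have := hh01 i; have := hlt1 i; omega
  have hhi₂ : ∀ i, hi (2 * i + 1) ≤ h (2 * i + 1) := fun i => A.hi_le _
  have hlh : ∀ i, l (2 * i) < h (2 * i + 1) := fun i => (hl01 i).trans (hlt1 i)
  have hsucc : ∀ i, h (2 * i + 1) ≤ l (2 * (i + 1)) := fun i => A.succ (2 * i + 1)
  refine ⟨e, B, fun i => l (2 * i), fun i => h (2 * i + 1), strictMono_nat_of_lt_succ fun i => ?_,
    ⟨by have := A.pos; positivity, fun i => ?_, hlh, hsucc, fun i => ?_,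
      fun i => ⟨hlo₁ i, hhi₁ i, hn₁ i, Or.inr (hw₁ i)⟩,
      fun i => ⟨hlo₂ i, hhi₂ i, hn₂ i, Or.inr (hw₂ i)⟩, hpq, fun i => ?_,
      signSummable_of_matchB hpq hn₁ hn₂ hw₁ hw₂
        (C.abs_sum_matchB_le (fun _ => rfl) hsucc hlh hlo₁ hlo₂ hhi₁ hhi₂ hn₁ hn₂ hpq hz)⟩⟩
  · have := he' i; have := he' (i + 1); omega
  · have := A.le (2 * i); omega
  · have h1 := hh01 i
    have h2 := hlt1 i
    rcases he' i with h0 | h0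
    · rw [Function.comp, h0]
      exact (A.supp (2 * i)).mono le_rfl (by omega)
    · rw [Function.comp, h0]
      exact (A.supp (2 * i + 1)).mono (hl01 i).le le_rfl
  · rw [bev_apply]
    have h1 := hh01 i
    rcases he i with ⟨h, h'⟩ | ⟨h, h'⟩
    · have : cev (B i).2 ((y ∘ e) i) = 0 := by
        rw [Function.comp, h]
        exact cev_eq_zero (A.supp (2 * i)) (Or.inr (h1.trans (A.lo_ge (2 * i + 1))))
      rw [this, add_zero, cev_apply, Function.comp, h]
      exact h'
    · have : cev (B i).1 ((y ∘ e) i) = 0 := by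
        rw [Function.comp, h]
        exact cev_eq_zero (A.supp (2 * i + 1)) (Or.inl ((A.hi_le (2 * i)).trans h1))
      rw [this, zero_add, cev_apply, Function.comp, h]
      exact h'

lemma NormSeq.exists_goodSeq {y : ℕ → Vec} {η lo hi l h : ℕ → ℕ} {δ : ℚ}
    (A : NormSeq y η lo hi l h δ) :
    ∃ κ B l' h', StrictMono κ ∧ ∃ δ', GoodSeq (y ∘ κ) B l' h' δ' := by
  have : IsTrans ℕ CodeLT := ⟨fun _ _ _ => CodeLT.trans⟩
  obtain ⟨g, hg | hg⟩ := exists_increasing_or_nonincreasing_subseq CodeLT fun k => wt (η k)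
  · have hg' : StrictMono g := g.strictMono
    choose s a x s' a' h1 h2 h3 using fun k => hg k (k + 1) (Nat.lt_succ_self k)
    have C : WeightChain (fun k => wt ((η ∘ g) k)) x s a := ⟨h1, fun k => by
      have := (code_inj ((h2 k).symm.trans (h1 (k + 1)))).1
      exact this ▸ h3 k⟩
    obtain ⟨κ, B, l', h', hκ, hG⟩ := (A.comp hg').exists_goodSeq_of_chain C
    exact ⟨g ∘ κ, B, l', h', hg'.comp hκ, _, hG⟩
  · obtain ⟨B, hB⟩ := (A.comp g.strictMono).exists_goodSeq_of_antichain hg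
    exact ⟨g, B, _, _, g.strictMono, _, hB⟩

/-- A vector with small coordinates on which nodes of large weight are small is small. -/
lemma abs_ev_le_quarter {y : Vec} {p q W₀ W₁ : ℕ} {ε : ℚ} (hy : SuppIn p q y) (hp : W₁ ≤ p)
    (hε : 0 ≤ ε) (hN : 16 * (ageBound W₀ * ε) ≤ 1) (hco : ∀ k, |y k| ≤ ε)
    (h₀ : ∀ n a b, W₀ ≤ wt n → |ev n (res a b y)| ≤ 1 / 8)
    (h₁ : ∀ n a b, W₁ ≤ wt n → |ev n (res a b y)| ≤ ε) (n : ℕ) :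
    ∀ a b, |ev n (res a b y)| ≤ 1 / 4 ∧
      (wt n < W₀ → |ev n (res a b y)| ≤ 1 / 16 + age n * (2 * ε)) := by
  have hN1 : (1 : ℚ) ≤ ageBound W₀ := by exact_mod_cast ageBound_pos W₀
  have hε16 : 16 * ε ≤ 1 := by nlinarith
  have hco' : ∀ n a b, |res a b y n| ≤ ε := fun n a b => by
    rw [res_apply]
    split_ifs
    · exact hco n
    · rwa [abs_zero]
  induction n using Nat.strong_induction_on with
  | _ n ih =>
    intro a b
    suffices hmain : wt n < W₀ → |ev n (res a b y)| ≤ 1 / 16 + age n * (2 * ε) by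
      refine ⟨?_, hmain⟩
      rcases Nat.lt_or_ge (wt n) W₀ with hlt | hge
      · refine (hmain hlt).trans ?_
        have h1 : (age n : ℚ) ≤ ageBound W₀ := by
          exact_mod_cast (age_le_ageBound n).trans (ageBound_mono hlt.le)
        have h2 : (age n : ℚ) * ε ≤ ageBound W₀ * ε := by gcongr
        linarith
      · linarith [h₀ n a b hge]
    intro hlt
    have hcomp : ∀ c : Comp, c.node < n → |ev c.node (res c.lo c.hi (res a b y))| ≤ 1 / 4 :=
      fun c hc => by rw [res_res]; exact (ih _ hc _ _).1
    have hquart : ∀ {w : ℕ} {u : ℚ}, |u| ≤ 1 / 4 → |1 / (mw w : ℚ) * u| ≤ 1 / 16 :=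
      fun hu => (abs_inv_mw_mul_le hu).trans ((div_mw_le (by norm_num)).trans (by norm_num))
    rcases node_cases n with ⟨-, he⟩ | ⟨c₁, c₂, hs⟩ | ⟨ξ, c₁, c₂, hs⟩
    · rw [he]
      have h1 := hco' n a b
      have h2 : (0 : ℚ) ≤ age n := Nat.cast_nonneg _
      have h3 : 0 ≤ (age n : ℚ) * (2 * ε) := by positivity
      linarith
    · have hB := comb_le (by norm_num) hs.coef (hcomp c₁ hs.node₁) (hcomp c₂ hs.node₂)
      rw [hs.ev_eq, hs.age_eq]
      refine (abs_add_le _ _).trans ((add_le_add (hco' n a b) (hquart hB)).trans ?_)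
      push_cast
      linarith
    · have hage : (0 : ℚ) ≤ age ξ := Nat.cast_nonneg _
      rw [hs.ev_eq, hs.age_eq]
      by_cases hξ : ξ < p
      · have hB := comb_le (by norm_num) hs.coef (hcomp c₁ hs.node₁) (hcomp c₂ hs.node₂)
        rw [ev_eq_zero_of_suppIn (hy.res a b) hξ, add_zero]
        refine (abs_add_le _ _).trans ((add_le_add (hco' n a b) (hquart hB)).trans ?_)
        push_cast
        have : 0 ≤ (age ξ : ℚ) * ε := by positivity
        linarith
      · have hcomp' : ∀ c : Comp, ξ < wt c.node ∨ c.Single →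
            |ev c.node (res c.lo c.hi (res a b y))| ≤ ε := fun c hc => by
          rcases hc with hw | hs'
          · rw [res_res]; exact h₁ _ _ _ (by omega)
          · rw [hs'.1, hs'.2, ev_res_self]; exact hco' _ _ _
        have hB := comb_le hε hs.coef (hcomp' c₁ hs.comp₁) (hcomp' c₂ hs.comp₂)
        have h1 := abs_inv_mw_mul_le (w := wt n) hB
        have h2 := div_mw_le (w := wt n) hε
        have h3 := (ih ξ hs.lt a b).2 (by rw [hs.wt_eq]; exact hlt)
        refine (abs_add_le _ _).trans ((add_le_add ((abs_add_le _ _).trans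
          (add_le_add (hco' n a b) h3)) h1).trans ?_)
        push_cast
        linarith

/-- Every block sequence which does not tend to zero has a good subsequence. -/
theorem IsBlock.exists_goodSeq {y : ℕ → Vec} {s : ℕ → ℕ} (hy : IsBlock y s) (hs : StrictMono s)
    (h1 : ∀ k, ∃ m, 1 / 2 < |ev m (y k)|) :
    ∃ κ B l h, StrictMono κ ∧ ∃ δ, GoodSeq (y ∘ κ) B l h δ := by
  by_cases hc0 : ∃ δ : ℚ, 0 < δ ∧ ∀ W, ∃ k, W ≤ k ∧ ∃ m, δ ≤ |y k m|
  · obtain ⟨δ, hδ, H⟩ := hc0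
    obtain ⟨κ, B, l, h, hκ, hG⟩ := hy.exists_goodSeq_of_apply hs hδ H
    exact ⟨κ, B, l, h, hκ, δ, hG⟩
  by_cases hc1 : ∃ δ : ℚ, 0 < δ ∧
      ∀ W, ∃ k, W ≤ k ∧ ∃ m a b, W ≤ wt m ∧ δ ≤ |ev m (res a b (y k))|
  · obtain ⟨δ, hδ, H⟩ := hc1
    obtain ⟨κ, η, lo, hi, l, h, hκ, hA⟩ := hy.exists_normSeq hs hδ H
    obtain ⟨κ', B, l', h', hκ', δ', hG⟩ := hA.exists_goodSeq
    exact ⟨κ ∘ κ', B, l', h', hκ.comp hκ', δ', hG⟩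
  exfalso
  push Not at hc0 hc1
  obtain ⟨W₀, hW₀⟩ := hc1 (1 / 8) (by norm_num)
  have hN1 : (1 : ℚ) ≤ ageBound W₀ := by exact_mod_cast ageBound_pos W₀
  set ε : ℚ := 1 / (16 * ageBound W₀) with hε
  have hε0 : 0 < ε := by positivity
  obtain ⟨W₁, hW₁⟩ := hc1 ε hε0
  obtain ⟨W₂, hW₂⟩ := hc0 ε hε0
  set k := max W₀ (max W₁ W₂) with hk
  have hks := hs.id_le k
  obtain ⟨m, hm⟩ := h1 k
  have hfin := (abs_ev_le_quarter (hy.supp k) (W₀ := W₀) (W₁ := W₁) (ε := ε)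
    (by simp only [id] at hks; omega) hε0.le (by rw [hε]; field_simp; norm_num)
    (fun m => (hW₂ k (by omega) m).le) (fun n a b hn => (hW₀ k (by omega) n a b hn).le)
    (fun n a b hn => (hW₁ k (by omega) n a b hn).le) m (s k) (s (k + 1))).1
  rw [(hy.supp k).res_eq le_rfl le_rfl] at hfin
  linarith

end BDSpace

namespace BDSpace

/-! ### Averages and exact pairs -/

/-- A finite set is enumerated increasingly by an infinite sequence. -/
lemma exists_strictMono_enum {S : Finset ℕ} {a p : ℕ} (hS : S.card = a) (hp : ∀ i ∈ S, p ≤ i) :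
    ∃ e : ℕ → ℕ, StrictMono e ∧ (∀ i, p ≤ e i) ∧ (∀ i < a, e i ∈ S) ∧
      ∀ f : ℕ → Vec, ∑ i ∈ S, f i = ∑ i ∈ Finset.range a, f (e i) := by
  induction a generalizing S with
  | zero =>
    obtain rfl := Finset.card_eq_zero.mp hS
    exact ⟨fun i => p + i, fun i i' h => by simpa using h, fun i => by simp, by simp, fun f => by simp⟩
  | succ a ih =>
    have hne : S.Nonempty := Finset.card_pos.mp (by omega)
    set M := S.max' hne with hM
    have hMS : M ∈ S := S.max'_mem hne
    obtain ⟨e, he, hpe, hmem, hsum⟩ := ih (S := S.erase M)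
      (by rw [Finset.card_erase_of_mem hMS, hS]; rfl) fun i hi => hp i (Finset.mem_of_mem_erase hi)
    have hlt : ∀ i < a, e i < M := fun i hi => by
      have h1 := Finset.mem_erase.mp (hmem i hi)
      exact lt_of_le_of_ne (S.le_max' _ h1.2) h1.1
    refine ⟨fun i => if i < a then e i else M + (i - a), fun i i' h => ?_, fun i => ?_,
      fun i hi => ?_, fun f => ?_⟩
    · dsimp only
      split_ifs with h1 h2 h2
      · exact he h
      · have := hlt i h1; omega
      · omega
      · omega
    · dsimp only
      split_ifs
      · exact hpe i
      · have := hp M hMS; omega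
    · dsimp only
      split_ifs with h1
      · exact Finset.mem_of_mem_erase (hmem i h1)
      · rwa [show M + (i - a) = M by omega]
    · rw [← Finset.add_sum_erase S f hMS, hsum, Finset.sum_range_succ, add_comm]
      congr 1
      · exact Finset.sum_congr rfl fun i hi => by simp [Finset.mem_range.mp hi]
      · simp

lemma sum_range_mul_eq (f : ℕ → Vec) (N M : ℕ) : ∑ i ∈ Finset.range (N * M), f i =
    ∑ q ∈ Finset.range N, ∑ i ∈ Finset.range M, f (q * M + i) := by
  induction N with
  | zero => simp
  | succ N ih => rw [Nat.succ_mul, Finset.sum_range_add, ih, Finset.sum_range_succ]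

lemma sq_le_two_pow {m : ℕ} (h : 4 ≤ m) : m * m ≤ 2 ^ m := by
  induction m, h using Nat.le_induction with
  | base => norm_num
  | succ m hm ih => rw [pow_succ]; nlinarith

/-- The tail span of a sequence. -/
def tailSpan (u : ℕ → Vec) (p : ℕ) : Submodule ℚ Vec := Submodule.span ℚ (u '' Set.Ici p)

lemma mem_tailSpan (u : ℕ → Vec) {p k : ℕ} (h : p ≤ k) : u k ∈ tailSpan u p :=
  Submodule.subset_span ⟨k, h, rfl⟩

lemma tailSpan_mono (u : ℕ → Vec) {p q : ℕ} (h : p ≤ q) : tailSpan u q ≤ tailSpan u p :=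
  Submodule.span_mono (Set.image_mono (Set.Ici_subset_Ici.mpr h))

/-- Seminormalized block sequences. -/
structure NormBlock (u : ℕ → Vec) (s : ℕ → ℕ) : Prop extends IsBlock u s where
  strict : StrictMono s
  le_one : ∀ k m, |ev m (u k)| ≤ 1
  half_lt : ∀ k, ∃ m, 1 / 2 < |ev m (u k)|

lemma IsBlock.comp {y : ℕ → Vec} {s : ℕ → ℕ} (h : IsBlock y s) {φ : ℕ → ℕ} (hφ : StrictMono φ) :
    IsBlock (y ∘ φ) (s ∘ φ) :=
  ⟨h.mono.comp hφ.monotone, fun i => (h.supp _).mono le_rfl (h.mono (hφ (Nat.lt_succ_self i)))⟩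

lemma IsBlock.sum {y : ℕ → Vec} {s : ℕ → ℕ} (h : IsBlock y s) (a M : ℕ) :
    SuppIn (s a) (s (a + M)) (∑ i ∈ Finset.range M, y (a + i)) :=
  SuppIn.sum _ _ fun i hi => (h.supp _).mono (h.mono (by omega))
    (h.mono (by have := Finset.mem_range.mp hi; omega))

/-- Block sequences have averages of successive blocks which are not small. -/
lemma NormBlock.exists_average_aux {u : ℕ → Vec} {s : ℕ → ℕ} (hu : NormBlock u s) (p : ℕ) {N : ℕ}
    (hN : 1 ≤ N) : ∃ v r, IsBlock v r ∧ p ≤ r 0 ∧ (∀ l, v l ∈ tailSpan u p) ∧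
      (∀ l m, |ev m (v l)| ≤ 1) ∧
      ∃ m, 1 / 2 < |ev m ((1 / N : ℚ) • ∑ l ∈ Finset.range N, v l)| := by
  by_contra hcon
  push Not at hcon
  have hN0 : (0 : ℚ) < N := by exact_mod_cast hN
  have key : ∀ L (e : ℕ → ℕ), StrictMono e → p ≤ e 0 → ∀ m,
      |ev m ((2 / N : ℚ) ^ L • ∑ i ∈ Finset.range (N ^ L), u (e i))| ≤ 1 := by
    intro L
    induction L with
    | zero => intro e _ _ m; simpa using hu.le_one (e 0) m
    | succ L ih =>
      intro e he hp m
      have hblk := hu.toIsBlock.comp he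
      have h1 := hcon (fun q => (2 / N : ℚ) ^ L •
        ∑ i ∈ Finset.range (N ^ L), u (e (q * N ^ L + i))) (fun q => s (e (q * N ^ L)))
        ⟨fun q q' hq => hu.mono (he.monotone (Nat.mul_le_mul_right _ hq)), fun q => ?_⟩ ?_ ?_ ?_ m
      · rw [pow_succ' N, sum_range_mul_eq]
        rw [← Finset.smul_sum, map_smul, map_smul, smul_eq_mul, smul_eq_mul] at h1
        rw [map_smul, smul_eq_mul, pow_succ]
        rw [abs_mul, abs_of_pos (by positivity)] at h1
        rw [mul_comm ((2 / N : ℚ) ^ L), mul_assoc, abs_mul, abs_of_pos (by positivity)]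
        have h2 : ∀ t : ℚ, 2 / N * t = 2 * (1 / N * t) := fun t => by ring
        rw [h2]
        linarith
      · have := (hblk.sum (q * N ^ L) (N ^ L)).smul ((2 / N : ℚ) ^ L)
        rw [Nat.succ_mul]
        exact this
      · have := hu.strict.id_le (e (0 * N ^ L))
        simp only [id] at this
        have := he.monotone (Nat.zero_le (0 * N ^ L))
        omega
      · intro q
        refine Submodule.smul_mem _ _ (Submodule.sum_mem _ fun i _ => mem_tailSpan u ?_)
        exact hp.trans (he.monotone (Nat.zero_le _))
      · intro q m'
        exact ih (fun i => e (q * N ^ L + i)) (fun i i' hi => he (by omega))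
          (hp.trans (he.monotone (Nat.zero_le _))) m'
  obtain ⟨κ, B, l, h, hκ, δ, G⟩ := hu.toIsBlock.exists_goodSeq hu.strict hu.half_lt
  have hδ := G.pos
  obtain ⟨c, hc⟩ := exists_nat_gt (1 / δ)
  set j := max (max 1 N) c with hj
  have hjm := lt_mw j
  obtain ⟨S, hS, hSp, n, -, hn⟩ := G.exists_node_sum_ge (j := j) (by omega) p (a := N ^ mw j)
    (Nat.one_le_pow _ _ hN) (pow_le_ageBound (by omega) (by omega))
  obtain ⟨e, he, hpe, -, hsum⟩ := exists_strictMono_enum hS hSp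
  have h1 := key (mw j) (κ ∘ e) (hκ.comp he) ((hpe 0).trans (hκ.id_le _)) n
  rw [hsum] at hn
  rw [map_smul, smul_eq_mul, abs_mul, abs_of_pos (by positivity)] at h1
  have hm := mw_pos j
  have h2 : (2 / N : ℚ) ^ mw j * (((N ^ mw j : ℕ) : ℚ) * δ / mw j) ≤ 1 :=
    le_trans (mul_le_mul_of_nonneg_left (hn.trans (le_abs_self _)) (by positivity)) h1
  have h3 : (2 / N : ℚ) ^ mw j * (((N ^ mw j : ℕ) : ℚ) * δ / mw j) = 2 ^ mw j * δ / mw j := by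
    rw [div_pow]; push_cast; field_simp
  have h4 : ((mw j : ℚ) * mw j) ≤ 2 ^ mw j := by exact_mod_cast sq_le_two_pow (four_le_mw j)
  have h5 : (mw j : ℚ) * δ ≤ 1 := by
    calc (mw j : ℚ) * δ = mw j * mw j * δ / mw j := by field_simp
      _ ≤ 2 ^ mw j * δ / mw j := by gcongr
      _ ≤ 1 := h3 ▸ h2
  have h6 : (c : ℚ) ≤ mw j := by exact_mod_cast (show c ≤ mw j by omega)
  rw [div_lt_iff₀ hδ] at hc
  nlinarith

/-- Vectors on which nodes of small weight act by their weight. -/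
lemma NormBlock.exists_average {u : ℕ → Vec} {s : ℕ → ℕ} (hu : NormBlock u s) (p : ℕ) :
    ∃ Y q, p < q ∧ SuppIn p q Y ∧ Y ∈ tailSpan u p ∧ (∀ m, |ev m Y| ≤ 1) ∧
      (∃ m, 1 / 2 < |ev m Y|) ∧
      ∀ n a b, wt n ≠ 0 → wt n < p → |ev n (res a b Y)| ≤ 12 / mw (wt n) := by
  set N := ageBound p * mw p with hN
  have hmp := four_le_mw p
  have hN1 : 1 ≤ N := Nat.mul_pos (ageBound_pos p) (by omega)
  have hN0 : (0 : ℚ) < N := by exact_mod_cast hN1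
  obtain ⟨v, r, hv, hpr, hvu, hv1, hhalf⟩ := hu.exists_average_aux p hN1
  set Z := ∑ l ∈ Finset.range N, v l with hZ
  have hv4 : ∀ l n a b, |ev n (res a b (v l))| ≤ 4 := fun l n a b => by
    have := ev_res_le_four (hv1 l) n a b; linarith
  have hbd : ∀ n a b, |ev n (res a b ((1 / N : ℚ) • Z))| ≤ 4 / N + 4 / N * cnt r N a b := by
    intro n a b
    have h1 := hv.abs_ev_res_sum_le (C := 4) (by norm_num) (β := fun _ => 4)
      (fun _ => by norm_num) (fun l => hv4 l n a b) (fun l => hv4 l n a b) N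
    rw [sum_ite_eq_mul_cnt] at h1
    rw [map_smul, map_smul, smul_eq_mul, abs_mul, abs_of_pos (by positivity)]
    calc 1 / (N : ℚ) * |ev n (res a b Z)| ≤ 1 / N * (4 + 4 * cnt r N a b) := by gcongr
      _ = _ := by ring
  have hco : ∀ k, |((1 / N : ℚ) • Z) k| ≤ 4 / N := fun k => by
    have h1 := hv.abs_sum_apply_le (C := 4) (by norm_num)
      (fun i k => by have := apply_le_four (hv1 i) k; linarith) N k
    rw [Finsupp.smul_apply, smul_eq_mul, abs_mul, abs_of_pos (by positivity)]
    calc 1 / (N : ℚ) * |Z k| ≤ 1 / N * 4 := by gcongr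
      _ = _ := by ring
  refine ⟨(1 / N : ℚ) • Z, max (r N) (p + 1), by omega, ?_, ?_, fun m => ?_, hhalf,
    fun n a b hw hwp => ?_⟩
  · have := (hv.sum 0 N).smul (1 / N : ℚ)
    simp only [zero_add] at this
    exact this.mono hpr (le_max_left _ _)
  · exact Submodule.smul_mem _ _ (Submodule.sum_mem _ fun l _ => hvu l)
  · rw [map_smul, map_sum, smul_eq_mul, abs_mul, abs_of_pos (by positivity)]
    have h1 : |∑ l ∈ Finset.range N, ev m (v l)| ≤ N := by
      refine (Finset.abs_sum_le_sum_abs _ _).trans ((Finset.sum_le_card_nsmul _ _ 1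
        fun l _ => hv1 l m).trans (by simp))
    calc 1 / (N : ℚ) * _ ≤ 1 / N * N := by gcongr
      _ = 1 := by field_simp
  · have h1 := ev_le_of_forall_le (by positivity) (by positivity) hco hbd n hw a b
    refine h1.trans ?_
    have hm := mw_pos (wt n)
    have hcn := cnt_le r N a b
    have hage : (age n : ℚ) ≤ ageBound p := by
      exact_mod_cast (age_le_ageBound n).trans (ageBound_mono hwp.le)
    have hmwp : (mw (wt n) : ℚ) ≤ mw p := by exact_mod_cast mw_mono hwp.le
    have hNN : (ageBound p : ℚ) * mw p = N := by rw [hN]; push_cast; ring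
    have hm4 : (4 : ℚ) ≤ mw p := four_le_mw_rat p
    have hage0 : (0 : ℚ) ≤ age n := Nat.cast_nonneg _
    have e0 : (age n : ℚ) * mw (wt n) ≤ N := by rw [← hNN]; gcongr
    have e1 : (age n : ℚ) ≤ N := by
      rw [← hNN]; nlinarith [Nat.cast_nonneg (α := ℚ) (ageBound p)]
    have e2 : (age n : ℚ) * (4 / N) * mw (wt n) ≤ 4 := by
      calc (age n : ℚ) * (4 / N) * mw (wt n) = (age n * mw (wt n)) * (4 / N) := by ring
        _ ≤ N * (4 / N) := by gcongr
        _ = 4 := by field_simp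
    have e3 : (age n : ℚ) * (4 / N) ≤ 4 := by
      calc (age n : ℚ) * (4 / N) ≤ N * (4 / N) := by gcongr
        _ = 4 := by field_simp
    have e4 : 4 / N * cnt r N a b ≤ 4 := by
      calc 4 / N * cnt r N a b ≤ 4 / N * N := by gcongr
        _ = 4 := by field_simp
    rw [le_div_iff₀ hm, add_mul]
    have e5 : 1 / (mw (wt n) : ℚ) * (age n * (4 / N) + 4 / N * cnt r N a b) * mw (wt n) =
        age n * (4 / N) + 4 / N * cnt r N a b := by field_simp
    rw [e5]
    linarith

lemma RIS.comp {y : ℕ → Vec} {s J : ℕ → ℕ} {C : ℚ} (h : RIS y s J C) {φ : ℕ → ℕ}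
    (hφ : StrictMono φ) : RIS (y ∘ φ) (s ∘ φ) (J ∘ φ) C where
  toIsBlock := h.toIsBlock.comp hφ
  pos := h.pos
  bdd _ := h.bdd _
  low _ := h.low _
  le _ := h.le _

/-- Exact vectors in the span of a block sequence together with nodes of the same weight. -/
theorem NormBlock.exists_exact_pair {u : ℕ → Vec} {s : ℕ → ℕ} (hu : NormBlock u s) :
    ∃ δ : ℚ, 0 < δ ∧ ∀ j, 1 ≤ j → ∀ p, ∃ x η q, x ∈ tailSpan u p ∧ SuppIn p q x ∧
      (∀ n, Exact nodes n j x) ∧ wt η = j ∧ δ ≤ ev η x := by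
  choose Y q hpq hsupp hmem hone hhalf hlow using hu.exists_average
  let r : ℕ → ℕ := fun i => Nat.rec 0 (fun _ p => q p) i
  have hr : StrictMono r := strictMono_nat_of_lt_succ fun i => hpq (r i)
  have hris : RIS (fun i => Y (r i)) r r 12 :=
    { mono := hr.monotone
      supp := fun i => hsupp (r i)
      pos := by norm_num
      bdd := fun i n a b => (ev_res_le_four (hone (r i)) n a b).trans (by norm_num)
      low := fun i n a b => hlow (r i) n a b
      le := fun i => le_rfl }
  obtain ⟨κ, B, l, h, hκ, δ, G⟩ := hris.toIsBlock.exists_goodSeq hr fun i => hhalf (r i)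
  refine ⟨δ / 24, by have := G.pos; positivity, fun j hj p => ?_⟩
  obtain ⟨i, rfl⟩ : ∃ i, j = i + 1 := ⟨j - 1, by omega⟩
  obtain ⟨S, hS, hSp, η, hη, hge⟩ := G.exists_node_sum_ge hj p (ageBound_pos _) le_rfl
  obtain ⟨e, he, hpe, -, hsum⟩ := exists_strictMono_enum hS hSp
  have hκe : StrictMono (κ ∘ e) := hκ.comp he
  have hris' := hris.comp hκe
  have hp : ∀ i, p ≤ r (κ (e i)) := fun i =>
    (hpe i).trans ((hκ.id_le _).trans (hr.id_le _))
  have hblk := hris'.toIsBlock.sum 0 (ageBound (i + 1))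
  simp only [zero_add] at hblk
  refine ⟨_, η, _, Submodule.smul_mem _ _ (Submodule.sum_mem _ fun k _ => ?_),
    (hblk.smul _).mono (hp 0) le_rfl, fun n => hris'.exact_average i n, hη, ?_⟩
  · exact tailSpan_mono u (hp k) (hmem _)
  · rw [hsum] at hge
    rw [map_smul, smul_eq_mul]
    have hm := mw_pos (i + 1)
    have hN : (0 : ℚ) < ageBound (i + 1) := by exact_mod_cast ageBound_pos (i + 1)
    calc δ / 24 = (mw (i + 1) : ℚ) / (2 * 12 * ageBound (i + 1)) *
          (ageBound (i + 1) * δ / mw (i + 1)) := by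
            have := G.pos
            rw [div_mul_div_comm, div_eq_div_iff (by norm_num) (by positivity)]; ring
      _ ≤ _ := by gcongr; exact hge

end BDSpace

namespace BDSpace

/-! ### Infinite special sequences -/

/-- A sequence of exact vectors whose weights code the preceding vectors, with norming nodes. -/
structure CodedSeq (x : ℕ → Vec) (η l : ℕ → ℕ) (δ : ℚ) : Prop where
  pos : 0 < δ
  lt : ∀ k, k < l k
  strict : StrictMono l
  supp : ∀ k, SuppIn (l k) (l (k + 1)) (x k)
  node : ∀ k, η k < l (k + 1)
  wt_lt : ∀ k, wt (η k) < l (k + 1)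
  wt_eq : ∀ k, wt (η k) = code ((List.range k).map fun i => (l i, x i)) (l k)
  exact : ∀ n k, Exact nodes n (wt (η k)) (x k)
  ge : ∀ k, δ ≤ ev (η k) (x k)

/-- Two block sequences have a common coded sequence, which alternates between their spans. -/
theorem exists_codedSeq {u v : ℕ → Vec} {s r : ℕ → ℕ} (hu : NormBlock u s) (hv : NormBlock v r) :
    ∃ x η l δ, CodedSeq x η l δ ∧ (∀ i, x (2 * i) ∈ tailSpan u (2 * i)) ∧
      ∀ i, x (2 * i + 1) ∈ tailSpan v (2 * i + 1) := by
  obtain ⟨δ₀, hδ₀, H₀⟩ := hu.exists_exact_pair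
  obtain ⟨δ₁, hδ₁, H₁⟩ := hv.exists_exact_pair
  have H : ∀ k j p, ∃ (x : Vec) (η q : ℕ), 1 ≤ j → (k % 2 = 0 → x ∈ tailSpan u p) ∧
      (k % 2 = 1 → x ∈ tailSpan v p) ∧ SuppIn p q x ∧ (∀ n, Exact nodes n j x) ∧ wt η = j ∧
      min δ₀ δ₁ ≤ ev η x := by
    intro k j p
    by_cases hj : 1 ≤ j
    · rcases Nat.mod_two_eq_zero_or_one k with hk | hk
      · obtain ⟨x, η, q, h1, h2, h3, h4, h5⟩ := H₀ j hj p
        exact ⟨x, η, q, fun _ => ⟨fun _ => h1, fun h => by omega, h2, h3, h4,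
          (min_le_left _ _).trans h5⟩⟩
      · obtain ⟨x, η, q, h1, h2, h3, h4, h5⟩ := H₁ j hj p
        exact ⟨x, η, q, fun _ => ⟨fun h => by omega, fun _ => h1, h2, h3, h4,
          (min_le_right _ _).trans h5⟩⟩
    · exact ⟨0, 0, 0, fun h => absurd h hj⟩
  choose X E Q hX using H
  let st : ℕ → Seq × ℕ := fun k => Nat.rec ([], 1) (fun k t =>
    (t.1 ++ [(t.2, X k (code t.1 t.2) t.2)],
      E k (code t.1 t.2) t.2 + Q k (code t.1 t.2) t.2 + code t.1 t.2 + t.2 + 1)) k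
  set w : ℕ → ℕ := fun k => code (st k).1 (st k).2 with hw
  set l : ℕ → ℕ := fun k => (st k).2 with hl
  set x : ℕ → Vec := fun k => X k (w k) (l k) with hx
  set η : ℕ → ℕ := fun k => E k (w k) (l k) with hη
  have hst : ∀ k, (st (k + 1)).1 = (st k).1 ++ [(l k, x k)] := fun k => rfl
  have hl1 : ∀ k, l (k + 1) = η k + Q k (w k) (l k) + w k + l k + 1 := fun k => rfl
  have hlk : ∀ k, k < l k := fun k => by
    induction k with
    | zero => exact Nat.one_pos
    | succ k ih => rw [hl1]; omega
  have hwk : ∀ k, 1 ≤ w k := fun k =>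
    le_trans (by have := hlk k; omega) (le_code (st k).1 (l k))
  have hlist : ∀ k, (st k).1 = (List.range k).map fun i => (l i, x i) := fun k => by
    induction k with
    | zero => rfl
    | succ k ih => rw [hst, ih, List.range_succ, List.map_append]; rfl
  have hspec := fun k => hX k (w k) (l k) (hwk k)
  refine ⟨x, η, l, min δ₀ δ₁, ⟨lt_min hδ₀ hδ₁, hlk, strictMono_nat_of_lt_succ fun k => ?_,
    fun k => ?_, fun k => ?_, fun k => ?_, fun k => ?_, fun n k => ?_, fun k => ?_⟩,
    fun i => ?_, fun i => ?_⟩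
  · rw [hl1]; omega
  · exact (hspec k).2.2.1.mono le_rfl (by rw [hl1]; omega)
  · rw [hl1]; omega
  · rw [(hspec k).2.2.2.2.1, hl1]; omega
  · rw [(hspec k).2.2.2.2.1, ← hlist]
  · have h1 : wt (η k) = w k := (hspec k).2.2.2.2.1
    rw [h1]
    exact (hspec k).2.2.2.1 n
  · exact (hspec k).2.2.2.2.2
  · exact tailSpan_mono u (hlk (2 * i)).le ((hspec (2 * i)).1 (by omega))
  · exact tailSpan_mono v (hlk (2 * i + 1)).le ((hspec (2 * i + 1)).2.1 (by omega))

namespace CodedSeq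

variable {x : ℕ → Vec} {η l : ℕ → ℕ} {δ : ℚ}

lemma isBlock (C : CodedSeq x η l δ) : IsBlock x l := ⟨C.strict.monotone, C.supp⟩

lemma wt_gt (C : CodedSeq x η l δ) (k : ℕ) : k < wt (η k) := by
  rw [C.wt_eq]; exact (C.lt k).trans_le (le_code _ _)

lemma wt_mono (C : CodedSeq x η l δ) : StrictMono fun k => wt (η k) :=
  strictMono_nat_of_lt_succ fun k => by
    refine (C.wt_lt k).trans_le ?_
    rw [C.wt_eq (k + 1)]; exact le_code _ _

/-- The partial sums of a coded sequence are bounded. -/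
theorem abs_ev_sum_le (C : CodedSeq x η l δ) (K m : ℕ) :
    |ev m (∑ k ∈ Finset.range K, x k)| ≤ 10 := by
  set t : Seq := (List.range K).map fun i => (l i, x i) with ht
  have hlen : t.length = K := by simp [ht]
  have hget : ∀ i < K, t.getD i (0, 0) = (l i, x i) := fun i hi => by
    rw [List.getD_eq_getElem _ _ (by omega)]; simp [ht]
  have hwt : ∀ i < K, wtSeq t i = wt (η i) := fun i hi => by
    rw [wtSeq, hget i hi, C.wt_eq i]
    congr 1
    rw [ht, ← List.map_take, List.take_range, min_eq_left hi.le]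
  have hvec : ∀ i < K, vec t i = x i := fun i hi => by rw [vec, hget i hi]
  have hsp : Special nodes (m + 1) t := by
    refine ⟨fun i hi => ?_, fun i i' hi hi' => ?_⟩
    · rw [hlen] at hi
      rw [hwt i hi, hvec i hi]
      exact C.exact _ i
    · rw [hlen] at hi'
      rw [hwt i (by omega), hwt i' hi']
      exact C.wt_mono hi
  have := hsp.ev_sum_le (Nat.lt_succ_self m)
  rwa [hlen, Finset.sum_congr rfl fun i hi => hvec i (Finset.mem_range.mp hi)] at this

lemma weightChain (C : CodedSeq x η l δ) : WeightChain (fun k => wt (η k)) x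
    (fun k => (List.range k).map fun i => (l i, x i)) l :=
  ⟨C.wt_eq, fun k => by rw [List.range_succ, List.map_append]; exact List.prefix_rfl⟩

lemma goodSeq (C : CodedSeq x η l δ) : ∃ B, GoodSeq (fun i => x (2 * i) - x (2 * i + 1)) B
    (fun i => l (2 * i)) (fun i => l (2 * i + 2)) (δ ^ 2 / 2) := by
  have hδ := C.pos
  set α : ℕ → ℚ := fun k => ev (η k) (x k) with hα
  have hαle : ∀ k, |α k| ≤ 2 := fun k => by
    have := (C.exact (η k + 1) k).ev_le_two (Nat.lt_succ_self _) (l k) (l (k + 1))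
    rwa [(C.supp k).res_eq le_rfl le_rfl] at this
  set p : ℕ → ℚ := fun i => α (2 * i + 1) / 4 with hp
  set q : ℕ → ℚ := fun i => -(α (2 * i) / 4) with hq
  have hpq : ∀ i, |p i| + |q i| ≤ 1 := fun i => by
    have h1 := hαle (2 * i)
    have h2 := hαle (2 * i + 1)
    simp only [hp, hq]
    rw [abs_neg, abs_div, abs_div, abs_of_pos (by norm_num : (0 : ℚ) < 4)]
    linarith
  let B : ℕ → Comp × Comp := fun i => ((p i, η (2 * i), l (2 * i), l (2 * i + 1)),
    (q i, η (2 * i + 1), l (2 * i + 1), l (2 * i + 1 + 1)))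
  have hl0 : ∀ i, l (2 * i) < l (2 * i + 1) := fun i => C.strict (Nat.lt_succ_self _)
  have hl1 : ∀ i, l (2 * i + 1) < l (2 * i + 2) := fun i => C.strict (Nat.lt_succ_self _)
  have hn₁ : ∀ i, η (2 * i) < l (2 * i + 2) := fun i => (C.node (2 * i)).trans (hl1 i)
  have hn₂ : ∀ i, η (2 * i + 1) < l (2 * i + 2) := fun i => C.node (2 * i + 1)
  have hw₁ : ∀ i, i < wt (η (2 * i)) := fun i => by have := C.wt_gt (2 * i); omega
  have hw₂ : ∀ i, i < wt (η (2 * i + 1)) := fun i => by have := C.wt_gt (2 * i + 1); omega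
  have hlh : ∀ i, l (2 * i) < l (2 * i + 2) := fun i => (hl0 i).trans (hl1 i)
  have hM := C.weightChain.abs_sum_matchB_le (lo := l) (hi := fun k => l (k + 1)) (p := p) (q := q)
    (l := fun i => l (2 * i)) (h := fun i => l (2 * i + 2)) (B := B) (fun _ => rfl)
    (fun i => le_rfl) hlh (fun i => le_rfl) (fun i => (hl0 i).le) (fun i => (hl1 i).le)
    (fun i => le_rfl) hn₁ hn₂ hpq (fun i => by
      rw [(C.supp _).res_eq le_rfl le_rfl, (C.supp _).res_eq le_rfl le_rfl]
      simp only [hp, hq, hα]; ring)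
  refine ⟨B, by positivity, fun i => ?_, hlh, fun i => le_rfl, fun i => ?_,
    fun i => ⟨le_rfl, (hl1 i).le, hn₁ i, Or.inr (hw₁ i)⟩,
    fun i => ⟨(hl0 i).le, le_rfl, hn₂ i, Or.inr (hw₂ i)⟩, hpq, fun i => ?_,
    signSummable_of_matchB hpq hn₁ hn₂ hw₁ hw₂ hM⟩
  · have := C.lt (2 * i); omega
  · rw [sub_eq_add_neg, ← neg_one_smul ℚ (x (2 * i + 1))]
    exact ((C.supp (2 * i)).mono le_rfl (hl1 i).le).add
      (((C.supp (2 * i + 1)).mono (hl0 i).le le_rfl).smul _)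
  · have h1 : cev (B i).1 (x (2 * i + 1)) = 0 :=
      cev_eq_zero (C.supp (2 * i + 1)) (Or.inl le_rfl)
    have h2 : cev (B i).2 (x (2 * i)) = 0 := cev_eq_zero (C.supp (2 * i)) (Or.inr le_rfl)
    have h3 : cev (B i).1 (x (2 * i)) = p i * α (2 * i) := by
      rw [cev_apply]
      change p i * ev (η (2 * i)) (res (l (2 * i)) (l (2 * i + 1)) _) = _
      rw [(C.supp _).res_eq le_rfl le_rfl]
    have h4 : cev (B i).2 (x (2 * i + 1)) = q i * α (2 * i + 1) := by
      rw [cev_apply]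
      change q i * ev (η (2 * i + 1)) (res (l (2 * i + 1)) (l (2 * i + 1 + 1)) _) = _
      rw [(C.supp _).res_eq le_rfl le_rfl]
    rw [bev_apply, map_sub, map_sub, h1, h2, h3, h4]
    have e1 : δ ≤ α (2 * i) := C.ge _
    have e2 : δ ≤ α (2 * i + 1) := C.ge _
    simp only [hp, hq]
    nlinarith

/-- The alternating sums of a coded sequence are unbounded. -/
theorem exists_alternating_gt (C : CodedSeq x η l δ) (R : ℚ) : ∃ i₀ K m,
    R < ev m (∑ i ∈ Finset.range K, (x (2 * (i₀ + i)) - x (2 * (i₀ + i) + 1))) := by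
  obtain ⟨B, G⟩ := C.goodSeq
  set δ' := δ ^ 2 / 2 with hδ'
  have hδ := G.pos
  obtain ⟨c, hc⟩ := exists_nat_gt (R / δ')
  set j := c + 1 with hj
  have hm := mw_pos j
  obtain ⟨i₀, hi₀⟩ := exists_nat_gt (4 * mw j / δ')
  obtain ⟨S, hS, hSi, hR⟩ := G.exists_signed_nodes (j := j) (by omega) i₀ (ageBound_pos j) le_rfl
  obtain ⟨Q, n, -, hQ, -, he⟩ := hR ∅
  set K := S.sup id + 1 with hK
  set y : ℕ → Vec := fun i => x (2 * i) - x (2 * i + 1) with hy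
  refine ⟨i₀, K, n, ?_⟩
  change R < ev n (∑ i ∈ Finset.range K, y (i₀ + i))
  set v := ∑ i ∈ Finset.range K, y (i₀ + i) with hv
  have hmi : (i₀ : ℚ) < mw i₀ := by exact_mod_cast lt_mw i₀
  have hmi0 := mw_pos i₀
  have hsmall : 2 / (mw i₀ : ℚ) ≤ δ' / (2 * mw j) := by
    rw [div_lt_iff₀ hδ] at hi₀
    rw [div_le_div_iff₀ hmi0 (by positivity)]
    nlinarith
  have hblk : IsBlock (fun i => y (i₀ + i)) (fun i => l (2 * (i₀ + i))) :=
    ⟨fun i i' hi => C.strict.monotone (by omega), fun i => G.supp (i₀ + i)⟩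
  have hcoord : ∀ k, |v k| ≤ 2 / mw i₀ := fun k => by
    refine hblk.abs_sum_apply_le (by positivity) (fun i k => ?_) K k
    have h1 : ∀ k', i₀ ≤ k' → |x k' k| ≤ 1 / mw i₀ := fun k' hk' =>
      ((C.exact 0 k').1 k).trans (inv_mw_le (hk'.trans (C.wt_gt k').le))
    rw [hy, Finsupp.sub_apply]
    refine (abs_sub _ _).trans ((add_le_add (h1 _ (by omega)) (h1 _ (by omega))).trans_eq ?_)
    ring
  have h1 : |∑ k ∈ Q, v k| ≤ ageBound j * (δ' / (2 * mw j)) := by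
    refine (Finset.abs_sum_le_sum_abs _ _).trans ((Finset.sum_le_card_nsmul Q _ _
      fun k _ => (hcoord k).trans hsmall).trans ?_)
    rw [nsmul_eq_mul]
    gcongr
  have h2 : ageBound j * δ' ≤ ∑ i ∈ S, sgn ∅ i * bev (B i) v := by
    rw [← hS, ← nsmul_eq_mul]
    refine Finset.card_nsmul_le_sum _ _ _ fun i hi => ?_
    have hi1 := hSi i hi
    have hi2 : i ≤ S.sup id := Finset.le_sup (f := id) hi
    rw [hv, map_sum, Finset.sum_eq_single (i - i₀) (fun i' _ hne => G.bev_ne (by omega))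
      (fun h => absurd (Finset.mem_range.mpr (by omega)) h), show i₀ + (i - i₀) = i by omega]
    simpa [sgn] using G.apply_ge i
  have h3 : 1 / (mw j : ℚ) * (ageBound j * δ') ≤
      1 / mw j * ∑ i ∈ S, sgn ∅ i * bev (B i) v := by gcongr
  have h4 := neg_abs_le (∑ k ∈ Q, v k)
  have h5 : (2 * mw j * mw j : ℚ) ≤ ageBound j := by exact_mod_cast mw_sq_le j
  have h6 : 1 / (mw j : ℚ) * (ageBound j * δ') - ageBound j * (δ' / (2 * mw j)) =
      ageBound j * δ' / (2 * mw j) := by field_simp; ring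
  have h7 : mw j * δ' ≤ ageBound j * δ' / (2 * mw j) := by
    rw [le_div_iff₀ (by positivity)]; nlinarith
  have h8 : (c : ℚ) < mw j := by exact_mod_cast (show c < mw j from by have := lt_mw j; omega)
  rw [div_lt_iff₀ hδ] at hc
  rw [he]
  nlinarith

end CodedSeq

end BDSpace

namespace BDSpace

open BoundedContinuousFunction Filter Topology

/-! ### The space -/

lemma exists_ev_bound (x : Vec) : ∃ C : ℚ, ∀ n, |ev n x| ≤ C := by
  obtain ⟨q, hq⟩ := exists_suppIn x
  refine ⟨2 * ∑ i ∈ Finset.range q, |ev i x|, fun n => ?_⟩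
  have := ev_res_le n q x (∑ i ∈ Finset.range q, |ev i x|)
    (Finset.sum_nonneg fun _ _ => abs_nonneg _) fun i hi =>
      Finset.single_le_sum (f := fun i => |ev i x|) (fun _ _ => abs_nonneg _)
        (Finset.mem_range.mpr hi)
  rwa [hq.res_eq le_rfl le_rfl] at this

/-- A finitely supported vector as a bounded function on the set of nodes. -/
def emb (x : Vec) : ℕ →ᵇ ℝ :=
  BoundedContinuousFunction.ofNormedAddCommGroupDiscrete (fun n => (ev n x : ℝ))
    ((exists_ev_bound x).choose : ℝ) fun n => by
      rw [Real.norm_eq_abs, ← Rat.cast_abs]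
      exact_mod_cast (exists_ev_bound x).choose_spec n

lemma emb_apply (x : Vec) (n : ℕ) : emb x n = (ev n x : ℝ) := rfl

/-- The closed linear span of the basis. -/
def space : Submodule ℝ (ℕ →ᵇ ℝ) where
  carrier := closure (Set.range emb)
  zero_mem' := subset_closure ⟨0, by ext n; simp [emb_apply]⟩
  add_mem' ha hb := map_mem_closure₂ continuous_add ha hb (by
    rintro _ ⟨x, rfl⟩ _ ⟨y, rfl⟩
    exact ⟨x + y, by ext n; simp [emb_apply]⟩)
  smul_mem' c f hf := map_mem_closure₂ (s := Set.range ((↑) : ℚ → ℝ)) continuous_smul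
    (Rat.denseRange_cast (𝕜 := ℝ) c) hf (by
      rintro _ ⟨q, rfl⟩ _ ⟨y, rfl⟩
      exact ⟨q • y, by ext n; simp [emb_apply]⟩)

/-- The Banach space. -/
def X : Type := ↥space

instance : NormedAddCommGroup X := inferInstanceAs (NormedAddCommGroup ↥space)

instance : NormedSpace ℝ X := inferInstanceAs (NormedSpace ℝ ↥space)

instance : CompleteSpace X :=
  (isClosed_closure : IsClosed (space : Set (ℕ →ᵇ ℝ))).completeSpace_coe

/-- The evaluation at a node. -/
def φ (n : ℕ) : X →L[ℝ] ℝ :=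
  LinearMap.mkContinuous ⟨⟨fun f : ↥space => f.1 n, fun _ _ => rfl⟩, fun _ _ => rfl⟩ 1 fun f => by
    rw [one_mul]; exact BoundedContinuousFunction.norm_coe_le_norm (Subtype.val f) n

lemma ext_φ {f g : X} (h : ∀ n, φ n f = φ n g) : f = g :=
  Subtype.ext (BoundedContinuousFunction.ext h)

lemma norm_le_iff {f : X} {c : ℝ} (hc : 0 ≤ c) : ‖f‖ ≤ c ↔ ∀ n, |φ n f| ≤ c :=
  BoundedContinuousFunction.norm_le (f := (Subtype.val f : ℕ →ᵇ ℝ)) hc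

lemma abs_φ_le (n : ℕ) (f : X) : |φ n f| ≤ ‖f‖ :=
  BoundedContinuousFunction.norm_coe_le_norm (Subtype.val f : ℕ →ᵇ ℝ) n

/-- A finitely supported vector as an element of the space. -/
def toX (x : Vec) : X := ⟨emb x, subset_closure ⟨x, rfl⟩⟩

/-- The embedding of the finitely supported vectors. -/
def ι : Vec →+ X where
  toFun := toX
  map_zero' := ext_φ fun n => by
    rw [map_zero]
    change ((ev n 0 : ℚ) : ℝ) = 0
    rw [map_zero, Rat.cast_zero]
  map_add' x y := ext_φ fun n => by
    rw [map_add]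
    change ((ev n (x + y) : ℚ) : ℝ) = (ev n x : ℝ) + (ev n y : ℝ)
    rw [map_add, Rat.cast_add]

lemma φ_ι (n : ℕ) (x : Vec) : φ n (ι x) = (ev n x : ℝ) := rfl

lemma ι_smul (q : ℚ) (x : Vec) : ι (q • x) = (q : ℝ) • ι x := ext_φ fun n => by
  rw [(φ n).map_smul, φ_ι, φ_ι, (ev n).map_smul, smul_eq_mul, smul_eq_mul, Rat.cast_mul]

lemma norm_ι_le {x : Vec} {c : ℚ} (h : ∀ n, |ev n x| ≤ c) : ‖ι x‖ ≤ c := by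
  have hc : 0 ≤ c := (abs_nonneg _).trans (h 0)
  rw [norm_le_iff (by exact_mod_cast hc)]
  intro n
  rw [φ_ι, ← Rat.cast_abs]
  exact_mod_cast h n

lemma ev_le_of_norm_ι_le {x : Vec} {c : ℚ} (h : ‖ι x‖ ≤ c) (n : ℕ) : |ev n x| ≤ c := by
  have := (abs_φ_le n (ι x)).trans h
  rw [φ_ι, ← Rat.cast_abs] at this
  exact_mod_cast this

lemma exists_norm_sub_ι_lt (f : X) {e : ℝ} (he : 0 < e) : ∃ x, ‖f - ι x‖ < e := by
  obtain ⟨_, ⟨x, rfl⟩, hx⟩ := Metric.mem_closure_iff.mp f.2 e he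
  refine ⟨x, ?_⟩
  rw [dist_eq_norm] at hx
  exact hx

lemma denseRange_ι : DenseRange ι := by
  rw [Metric.denseRange_iff]
  intro f e he
  obtain ⟨x, hx⟩ := exists_norm_sub_ι_lt f he
  exact ⟨x, by rwa [dist_eq_norm]⟩

instance : TopologicalSpace.SeparableSpace X :=
  ⟨Set.range ι, Set.countable_range _, denseRange_ι⟩

/-- The matrix of the evaluations. -/
def entry (n k : ℕ) : ℚ := ev n (Finsupp.single k 1)

lemma res_zero_eq_sum (n : ℕ) (x : Vec) :
    res 0 n x = ∑ k ∈ Finset.range n, x k • Finsupp.single k (1 : ℚ) := by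
  ext i
  simp [res_apply, Finsupp.finsetSum_apply, Finsupp.single_apply]

lemma ev_eq_sum (n : ℕ) (x : Vec) : ev n x = x n + ∑ k ∈ Finset.range n, x k * entry n k := by
  rw [← ev_res_of_lt (Nat.lt_succ_self n), res_zero_eq_sum, map_sum, Finset.sum_range_succ, add_comm]
  congr 1
  · rw [map_smul, ← ev_res_self n, smul_eq_mul, ev_res_self]
    have h : ev n (Finsupp.single n 1) = 1 := by
      have h1 := ev_res_self n (Finsupp.single n (1 : ℚ))
      rw [SuppIn.res_eq (a := n) (b := n + 1) (fun k hk => ?_) le_rfl le_rfl] at h1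
      · simpa using h1
      · have : n = k := by
          by_contra hne
          exact hk (Finsupp.single_eq_of_ne (Ne.symm hne))
        omega
    rw [h, mul_one]
  · exact Finset.sum_congr rfl fun k _ => by rw [map_smul, smul_eq_mul]; rfl

/-- The coordinate functionals. -/
def co (n : ℕ) : X →L[ℝ] ℝ := φ n - ∑ k : Fin n, (entry n k : ℝ) • co k
termination_by n
decreasing_by exact k.2

lemma co_eq (n : ℕ) (f : X) : co n f = φ n f - ∑ k ∈ Finset.range n, (entry n k : ℝ) * co k f := by
  rw [co, _root_.sub_apply, _root_.sum_apply,
    ← Fin.sum_univ_eq_sum_range (fun k => (entry n k : ℝ) * co k f)]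
  rfl

lemma co_ι (n : ℕ) (x : Vec) : co n (ι x) = (x n : ℝ) := by
  induction n using Nat.strong_induction_on with
  | _ n ih =>
    rw [co_eq, φ_ι, ev_eq_sum]
    push_cast
    rw [add_sub_assoc, add_eq_left, sub_eq_zero]
    exact Finset.sum_congr rfl fun k hk => by rw [ih k (Finset.mem_range.mp hk), mul_comm]

/-- The basis. -/
def bas (k : ℕ) : X := ι (Finsupp.single k 1)

lemma co_bas (n k : ℕ) : co n (bas k) = if n = k then 1 else 0 := by
  rw [bas, co_ι, Finsupp.single_apply]
  simp only [eq_comm (a := k)]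
  split_ifs <;> simp

lemma linearIndependent_bas : LinearIndependent ℝ bas := by
  rw [linearIndependent_iff']
  intro s g hg i hi
  have := congrArg (co i) hg
  rw [map_sum, map_zero, Finset.sum_eq_single i (fun j _ hj => by
    rw [map_smul, co_bas, if_neg (Ne.symm hj), smul_zero]) (fun h => absurd hi h), map_smul, co_bas,
    if_pos rfl] at this
  simpa using this

/-- The projections of the basis. -/
def proj (n : ℕ) : X →L[ℝ] X := ∑ k ∈ Finset.range n, (co k).smulRight (bas k)

lemma proj_apply (n : ℕ) (f : X) : proj n f = ∑ k ∈ Finset.range n, co k f • bas k := by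
  simp [proj, _root_.sum_apply]

lemma proj_ι (n : ℕ) (x : Vec) : proj n (ι x) = ι (res 0 n x) := by
  rw [proj_apply, res_zero_eq_sum, map_sum]
  exact Finset.sum_congr rfl fun k _ => by rw [co_ι, ι_smul]; rfl

lemma norm_proj_le {n : ℕ} {f : X} {c : ℝ} (hc : 0 ≤ c) (h : ∀ i < n, |φ i f| ≤ c) :
    ‖proj n f‖ ≤ 2 * c := by
  refine le_of_forall_pos_le_add fun e he => ?_
  have hP : 0 < ‖proj n‖ + 4 := by positivity
  set t := e / (‖proj n‖ + 4) with ht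
  have ht0 : 0 < t := by positivity
  obtain ⟨x, hx⟩ := exists_norm_sub_ι_lt f ht0
  obtain ⟨q, hq1, hq2⟩ := exists_rat_btwn (show c + t < c + 2 * t by linarith)
  have hq0 : 0 ≤ q := by
    have : (0 : ℝ) ≤ q := by linarith
    exact_mod_cast this
  have h1 : ∀ i < n, |ev i x| ≤ q := fun i hi => by
    have e1 := abs_φ_le i (f - ι x)
    rw [map_sub] at e1
    have e2 := abs_sub_abs_le_abs_sub (φ i (ι x)) (φ i f)
    rw [abs_sub_comm] at e1
    have e3 := h i hi
    have e4 : |φ i (ι x)| ≤ q := by linarith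
    rw [φ_ι, ← Rat.cast_abs] at e4
    exact_mod_cast e4
  have h2 : ‖proj n (ι x)‖ ≤ 2 * q := by
    rw [proj_ι]
    have := norm_ι_le (x := res 0 n x) (c := 2 * q) fun m => ev_res_le m n x q hq0 h1
    exact_mod_cast this
  have h3 : ‖proj n (f - ι x)‖ ≤ ‖proj n‖ * t :=
    ((proj n).le_opNorm _).trans (by gcongr)
  have h4 : proj n f = proj n (f - ι x) + proj n (ι x) := by rw [map_sub]; abel
  have h5 : (‖proj n‖ + 4) * t = e := by rw [ht]; field_simp
  rw [h4]
  refine (norm_add_le _ _).trans ?_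
  nlinarith

lemma norm_proj_apply_le (n : ℕ) (f : X) : ‖proj n f‖ ≤ 2 * ‖f‖ :=
  norm_proj_le (norm_nonneg _) fun i _ => abs_φ_le i f

lemma tendsto_proj (f : X) : Tendsto (fun n => proj n f) atTop (𝓝 f) := by
  rw [Metric.tendsto_atTop]
  intro e he
  obtain ⟨x, hx⟩ := exists_norm_sub_ι_lt f (show 0 < e / 4 by positivity)
  obtain ⟨q, hq⟩ := exists_suppIn x
  refine ⟨q, fun n hn => ?_⟩
  have h1 : proj n (ι x) = ι x := by rw [proj_ι, hq.res_eq le_rfl hn]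
  have h2 : proj n f - f = proj n (f - ι x) - (f - ι x) := by rw [map_sub, h1]; abel
  have h3 := norm_proj_apply_le n (f - ι x)
  rw [dist_eq_norm, h2]
  refine (norm_sub_le _ _).trans_lt ?_
  linarith

/-- The finite-dimensional subspaces of the basis. -/
def fin (n : ℕ) : Submodule ℝ X := Submodule.span ℝ (Set.range fun i : Fin n => bas i)

instance (n : ℕ) : FiniteDimensional ℝ (fin n) :=
  FiniteDimensional.span_of_finite ℝ (Set.finite_range _)

lemma finrank_fin (n : ℕ) : Module.finrank ℝ (fin n) = n := by
  have : LinearIndependent ℝ fun i : Fin n => bas i :=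
    linearIndependent_bas.comp _ Fin.val_injective
  rw [fin, finrank_span_eq_card this, Fintype.card_fin]

lemma proj_of_mem_fin {n : ℕ} {f : X} (hf : f ∈ fin n) : proj n f = f := by
  induction hf using Submodule.span_induction with
  | mem f hf =>
    obtain ⟨i, rfl⟩ := hf
    change proj n (ι _) = ι _
    rw [proj_ι, SuppIn.res_eq (a := 0) (b := n) (fun k hk => ?_) le_rfl le_rfl]
    have : (i : ℕ) = k := by
      by_contra hne
      exact hk (Finsupp.single_eq_of_ne (Ne.symm hne))
    have := i.2
    omega
  | zero => exact map_zero _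
  | add f g _ _ hf hg => rw [map_add, hf, hg]
  | smul c f _ hf => rw [map_smul, hf]

lemma proj_mem_fin (n : ℕ) (f : X) : proj n f ∈ fin n := by
  rw [proj_apply]
  exact Submodule.sum_mem _ fun k hk => Submodule.smul_mem _ _
    (Submodule.subset_span ⟨⟨k, Finset.mem_range.mp hk⟩, rfl⟩)

/-- The values at the first nodes. -/
def values (n : ℕ) : fin n →ₗ[ℝ] (Fin n → ℝ) :=
  LinearMap.pi fun i => (φ i : X →ₗ[ℝ] ℝ).comp (fin n).subtype

lemma norm_le_values (n : ℕ) (f : fin n) : ‖f‖ ≤ 2 * ‖values n f‖ := by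
  have := norm_proj_le (n := n) (f := (f : X)) (norm_nonneg (values n f)) fun i hi =>
    norm_le_pi_norm (values n f) ⟨i, hi⟩
  rwa [proj_of_mem_fin f.2] at this

lemma values_injective (n : ℕ) : Function.Injective (values n) := by
  rw [injective_iff_map_eq_zero]
  intro f hf
  have := norm_le_values n f
  rw [hf, norm_zero, mul_zero] at this
  exact norm_le_zero_iff.mp this

theorem isLinftySpace : IsLinftySpace X := by
  refine ⟨2, by norm_num, fin, fun n m h => ?_, fun n => inferInstance, ?_, fun n => ?_⟩
  · refine Submodule.span_mono ?_
    rintro _ ⟨i, rfl⟩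
    exact ⟨⟨i, i.2.trans_le h⟩, rfl⟩
  · refine Dense.mono ?_ denseRange_ι
    rintro _ ⟨x, rfl⟩
    obtain ⟨q, hq⟩ := exists_suppIn x
    refine Set.mem_iUnion.mpr ⟨q, ?_⟩
    have := proj_mem_fin q (ι x)
    rwa [proj_ι, hq.res_eq le_rfl le_rfl] at this
  · rw [finrank_fin n]
    let T : fin n ≃ₗ[ℝ] (Fin n → ℝ) :=
      LinearMap.linearEquivOfInjective (values n) (values_injective n) (by simp [finrank_fin])
    refine ⟨T.toContinuousLinearEquiv, ?_⟩
    have h1 : ‖(T.toContinuousLinearEquiv : fin n →L[ℝ] (Fin n → ℝ))‖ ≤ 1 := by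
      refine ContinuousLinearMap.opNorm_le_bound _ zero_le_one fun f => ?_
      rw [one_mul]
      exact (pi_norm_le_iff_of_nonneg (norm_nonneg _)).mpr fun i => abs_φ_le i (f : X)
    have h2 : ‖(T.toContinuousLinearEquiv.symm : (Fin n → ℝ) →L[ℝ] fin n)‖ ≤ 2 := by
      refine ContinuousLinearMap.opNorm_le_bound _ zero_le_two fun v => ?_
      have := norm_le_values n (T.symm v)
      have h3 : values n (T.symm v) = v := T.apply_symm_apply v
      rwa [h3] at this
    calc _ ≤ 1 * 2 := mul_le_mul h1 h2 (ContinuousLinearMap.opNorm_nonneg _) zero_le_one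
      _ = (2 : ℝ) := by norm_num

/-! ### Gliding humps -/

lemma exists_mem_proj_eq_zero {U : Submodule ℝ X} (hU : ¬ FiniteDimensional ℝ U) (p : ℕ) :
    ∃ f ∈ U, ‖f‖ = 3 / 4 ∧ proj p f = 0 := by
  set g : U →ₗ[ℝ] (Fin p → ℝ) :=
    LinearMap.pi fun i => (co i : X →ₗ[ℝ] ℝ).comp U.subtype with hg
  have hne : ¬ Function.Injective g := fun hinj => hU (FiniteDimensional.of_injective g hinj)
  rw [← LinearMap.ker_eq_bot, Submodule.eq_bot_iff] at hne
  push Not at hne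
  obtain ⟨f, hf, hf0⟩ := hne
  have hfn : 0 < ‖f‖ := norm_pos_iff.mpr hf0
  refine ⟨((3 / 4) / ‖f‖) • (f : X), U.smul_mem _ f.2, ?_, ?_⟩
  · rw [norm_smul, Real.norm_of_nonneg (by positivity)]
    change (3 / 4) / ‖f‖ * ‖f‖ = 3 / 4
    field_simp
  · rw [map_smul, proj_apply, Finset.sum_eq_zero, smul_zero]
    intro k hk
    have : co k (f : X) = 0 := congrFun hf ⟨k, Finset.mem_range.mp hk⟩
    rw [this, zero_smul]

lemma exists_hump {U : Submodule ℝ X} (hU : ¬ FiniteDimensional ℝ U) (p : ℕ) {e : ℝ} (he : 0 < e) :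
    ∃ u q, ∃ f ∈ U, p < q ∧ SuppIn p q u ∧ ‖ι u - f‖ ≤ e ∧ (∀ m, |ev m u| ≤ 1) ∧
      ∃ m, 1 / 2 < |ev m u| := by
  obtain ⟨f, hfU, hf, hpf⟩ := exists_mem_proj_eq_zero hU p
  set t := min (e / 3) (1 / 24) with ht
  have ht1 : t ≤ e / 3 := min_le_left _ _
  have ht2 : t ≤ 1 / 24 := min_le_right _ _
  have ht0 : 0 < t := lt_min (by positivity) (by norm_num)
  obtain ⟨x, hx⟩ := exists_norm_sub_ι_lt f ht0
  obtain ⟨q, hq⟩ := exists_suppIn x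
  set u := x - res 0 p x with hu
  have hsupp : SuppIn p (max q (p + 1)) u := fun k hk => by
    rw [hu, Finsupp.sub_apply, res_apply] at hk
    by_cases hkp : k < p
    · rw [if_pos ⟨Nat.zero_le _, hkp⟩, sub_self] at hk
      exact absurd rfl hk
    · rw [if_neg (by omega), sub_zero] at hk
      have := hq k hk
      omega
  have h1 : ‖ι u - f‖ ≤ 3 * t := by
    have h2 : ι u - f = proj p (f - ι x) - (f - ι x) := by
      rw [hu, map_sub, map_sub, hpf, proj_ι]; abel
    have h3 := norm_proj_apply_le p (f - ι x)
    rw [h2]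
    refine (norm_sub_le _ _).trans ?_
    linarith
  have h2 : ‖ι u‖ ≤ 1 := by
    have := norm_le_norm_add_norm_sub' (ι u) f
    linarith
  have h3 : 1 / 2 < ‖ι u‖ := by
    have := norm_le_norm_add_norm_sub' f (ι u)
    rw [norm_sub_rev] at this
    linarith
  refine ⟨u, _, f, hfU, by omega, hsupp, by linarith,
    fun m => ev_le_of_norm_ι_le (by simpa using h2) m, ?_⟩
  by_contra hcon
  push Not at hcon
  have := norm_ι_le hcon
  push_cast at this
  linarith

/-- Approximation of a block sequence by a subspace. -/
structure Approx (U : Submodule ℝ X) (u : ℕ → Vec) (s : ℕ → ℕ) (g : ℕ → X) (e : ℝ) : Prop extends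
    NormBlock u s where
  mem : ∀ i, g i ∈ U
  close : ∀ i, ‖ι (u i) - g i‖ ≤ e / 2 ^ i

lemma exists_approx {U : Submodule ℝ X} (hU : ¬ FiniteDimensional ℝ U) {e : ℝ} (he : 0 < e) :
    ∃ u s g, Approx U u s g e := by
  choose u q g hg hpq hsupp hclose hone hhalf using
    fun p : ℕ => exists_hump hU p (show 0 < e / 2 ^ p by positivity)
  let r : ℕ → ℕ := fun i => Nat.rec 0 (fun _ p => q p) i
  have hr : StrictMono r := strictMono_nat_of_lt_succ fun i => hpq (r i)
  refine ⟨fun i => u (r i), r, fun i => g (r i),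
    { mono := hr.monotone
      supp := fun i => hsupp (r i)
      strict := hr
      le_one := fun i => hone (r i)
      half_lt := fun i => hhalf (r i)
      mem := fun i => hg (r i)
      close := fun i => (hclose (r i)).trans ?_ }⟩
  have : i ≤ r i := hr.id_le i
  gcongr
  norm_num

lemma mem_tailSpan_iff {u : ℕ → Vec} {p : ℕ} {x : Vec} (hx : x ∈ tailSpan u p) :
    ∃ c : ℕ → ℚ, ∃ K, x = ∑ i ∈ Finset.range K, c i • u (p + i) := by
  induction hx using Submodule.span_induction with
  | mem x hx =>
    obtain ⟨k, hk, rfl⟩ := hx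
    have hk' : p ≤ k := hk
    refine ⟨fun i => if i = k - p then 1 else 0, k - p + 1, ?_⟩
    rw [Finset.sum_eq_single (k - p) (fun i _ hi => by simp [hi])
      (fun h => absurd (Finset.mem_range.mpr (by omega)) h)]
    simp [show p + (k - p) = k by omega]
  | zero => exact ⟨0, 0, by simp⟩
  | add x y _ _ hx hy =>
    obtain ⟨c, K, rfl⟩ := hx
    obtain ⟨c', K', rfl⟩ := hy
    have hext : ∀ (c : ℕ → ℚ) (K M : ℕ), K ≤ M → ∑ i ∈ Finset.range K, c i • u (p + i) =
        ∑ i ∈ Finset.range M, (if i < K then c i else 0) • u (p + i) := fun c K M h => by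
      rw [← Finset.sum_subset (Finset.range_subset_range.mpr h) fun i _ hi => by
        rw [if_neg (by simpa using hi), zero_smul]]
      exact Finset.sum_congr rfl fun i hi => by rw [if_pos (Finset.mem_range.mp hi)]
    refine ⟨fun i => (if i < K then c i else 0) + (if i < K' then c' i else 0), max K K', ?_⟩
    rw [hext c K _ (le_max_left K K'), hext c' K' _ (le_max_right K K'), ← Finset.sum_add_distrib]
    exact Finset.sum_congr rfl fun i _ => by rw [add_smul]
  | smul q x _ hx =>
    obtain ⟨c, K, rfl⟩ := hx
    refine ⟨fun i => q * c i, K, ?_⟩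
    rw [Finset.smul_sum]
    exact Finset.sum_congr rfl fun i _ => by rw [smul_smul]

lemma sum_geometric_le (K : ℕ) : ∑ i ∈ Finset.range K, (1 : ℝ) / 2 ^ i ≤ 2 := by
  have := geom_sum_eq (show (1 / 2 : ℝ) ≠ 1 by norm_num) K
  simp only [one_div, inv_pow] at this ⊢
  rw [this, div_le_iff_of_neg (by norm_num)]
  have : (0 : ℝ) < (2 ^ K)⁻¹ := by positivity
  linarith

/-- Vectors of the span of an approximated sequence are close to the subspace. -/
lemma Approx.exists_close {U : Submodule ℝ X} {u : ℕ → Vec} {s : ℕ → ℕ} {g : ℕ → X} {e : ℝ}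
    (A : Approx U u s g e) {p : ℕ} {x : Vec} (hx : x ∈ tailSpan u p) {c : ℚ}
    (hc : ∀ m, |ev m x| ≤ c) : ∃ f ∈ U, ‖ι x - f‖ ≤ 16 * c * e / 2 ^ p := by
  obtain ⟨a, K, rfl⟩ := mem_tailSpan_iff hx
  have hc0 : 0 ≤ c := (abs_nonneg _).trans (hc 0)
  have he : 0 ≤ e := by have := (norm_nonneg _).trans (A.close 0); simpa using this
  have ha : ∀ i ∈ Finset.range K, |a i| ≤ 8 * c := fun i hi => by
    obtain ⟨m, hm⟩ := A.half_lt (p + i)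
    have h1 := ev_res_le_four hc m (s (p + i)) (s (p + i + 1))
    rw [map_sum, Finset.sum_eq_single i (fun k _ hk => ?_) (fun h => absurd hi h), map_smul,
      (A.supp (p + i)).res_eq le_rfl le_rfl, map_smul, smul_eq_mul, abs_mul] at h1
    · nlinarith [abs_nonneg (a i)]
    · rw [map_smul, (A.supp (p + k)).res_eq_zero, smul_zero]
      rcases lt_or_gt_of_ne hk with h | h
      · exact Or.inr (A.mono (by omega))
      · exact Or.inl (A.mono (by omega))
  refine ⟨∑ i ∈ Finset.range K, (a i : ℝ) • g (p + i),
    Submodule.sum_mem _ fun i _ => Submodule.smul_mem _ _ (A.mem _), ?_⟩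
  rw [map_sum, ← Finset.sum_sub_distrib]
  have h1 : ∀ i ∈ Finset.range K, ‖ι (a i • u (p + i)) - (a i : ℝ) • g (p + i)‖ ≤
      8 * c * e / 2 ^ p * (1 / 2 ^ i) := fun i hi => by
    rw [ι_smul, ← smul_sub, norm_smul, Real.norm_eq_abs, ← Rat.cast_abs]
    have h2 : ((|a i| : ℚ) : ℝ) ≤ 8 * c := by exact_mod_cast ha i hi
    have h3 := A.close (p + i)
    have h0 : (0 : ℝ) ≤ c := by exact_mod_cast hc0
    calc _ ≤ (8 * c : ℝ) * (e / 2 ^ (p + i)) := mul_le_mul h2 h3 (norm_nonneg _) (by positivity)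
      _ = _ := by rw [pow_add]; field_simp
  refine (norm_sum_le _ _).trans ((Finset.sum_le_sum h1).trans ?_)
  rw [← Finset.mul_sum]
  have h0 : (0 : ℝ) ≤ c := by exact_mod_cast hc0
  calc _ ≤ 8 * c * e / 2 ^ p * 2 := by
        gcongr
        exact sum_geometric_le K
    _ = _ := by ring

end BDSpace

namespace BDSpace

open Filter Topology

/-! ### Hereditary indecomposability -/

lemma sum_pairs_eq (f : ℕ → Vec) (a K : ℕ) :
    ∑ i ∈ Finset.range K, f (2 * (a + i)) + ∑ i ∈ Finset.range K, f (2 * (a + i) + 1) =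
      ∑ k ∈ Finset.range (2 * (a + K)), f k - ∑ k ∈ Finset.range (2 * a), f k := by
  induction K with
  | zero => simp
  | succ K ih =>
    rw [Finset.sum_range_succ, Finset.sum_range_succ, add_add_add_comm, ih,
      show 2 * (a + (K + 1)) = 2 * (a + K) + 1 + 1 by ring, Finset.sum_range_succ,
      Finset.sum_range_succ]
    abel

lemma exists_norm_sub_le_of_isClosed {Z U V : Submodule ℝ X} (hZ : IsClosed (Z : Set X))
    (hU : IsClosed (U : Set X)) (hV : IsClosed (V : Set X)) (hUV : U ⊓ V = ⊥) (hsup : U ⊔ V = Z) :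
    ∃ K : ℝ, 0 ≤ K ∧ ∀ f ∈ U, ∀ g ∈ V, ‖f - g‖ ≤ K * ‖f + g‖ := by
  have := hU.completeSpace_coe
  have := hV.completeSpace_coe
  let T : U × V →L[ℝ] X := U.subtypeL.coprod V.subtypeL
  have hT : ∀ p : U × V, T p = (p.1 : X) + (p.2 : X) := fun p => by
    simp [T, ContinuousLinearMap.coprod_apply]
  have hinj : Function.Injective T := by
    rw [injective_iff_map_eq_zero]
    rintro ⟨f, g⟩ h
    rw [hT] at h
    have h1 : (f : X) = -(g : X) := eq_neg_of_add_eq_zero_left h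
    have h2 : (f : X) ∈ U ⊓ V := ⟨f.2, h1 ▸ V.neg_mem g.2⟩
    rw [hUV, Submodule.mem_bot] at h2
    have h3 : (g : X) = 0 := by rw [h2, zero_add] at h; exact h
    exact Prod.ext (Subtype.ext h2) (Subtype.ext h3)
  have hrange : Set.range T = (Z : Set X) := by
    ext f
    rw [← hsup, SetLike.mem_coe, Submodule.mem_sup]
    constructor
    · rintro ⟨p, rfl⟩
      exact ⟨p.1, p.1.2, p.2, p.2.2, (hT p).symm⟩
    · rintro ⟨g, hg, h, hh, rfl⟩
      exact ⟨(⟨g, hg⟩, ⟨h, hh⟩), hT _⟩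
  obtain ⟨K, hK⟩ := T.antilipschitz_of_injective_of_isClosed_range hinj (hrange ▸ hZ)
  refine ⟨2 * K, by positivity, fun f hf g hg => ?_⟩
  have h1 := T.bound_of_antilipschitz hK (⟨f, hf⟩, ⟨g, hg⟩)
  rw [hT] at h1
  have h2 : ‖f‖ ≤ K * ‖f + g‖ := (norm_fst_le ((⟨f, hf⟩, ⟨g, hg⟩) : U × V)).trans h1
  have h3 : ‖g‖ ≤ K * ‖f + g‖ := (norm_snd_le ((⟨f, hf⟩, ⟨g, hg⟩) : U × V)).trans h1
  refine (norm_sub_le _ _).trans ?_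
  linarith

theorem hereditarilyIndecomposable : HereditarilyIndecomposable X := by
  intro Z U V hZ _ hU hV hUf hVf hUV hsup
  obtain ⟨K, hK0, hK⟩ := exists_norm_sub_le_of_isClosed hZ hU hV hUV hsup
  set e : ℝ := 1 / (32 * (1 + K)) with he
  have he0 : 0 < e := by positivity
  obtain ⟨u, s, g, A⟩ := exists_approx hUf he0
  obtain ⟨v, r, g', A'⟩ := exists_approx hVf he0
  obtain ⟨x, η, l, δ, C, hxu, hxv⟩ := exists_codedSeq A.toNormBlock A'.toNormBlock
  obtain ⟨R, hR⟩ := exists_rat_gt (40 * K + 22)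
  obtain ⟨i₀, N, m, hm⟩ := C.exists_alternating_gt R
  set y := ∑ i ∈ Finset.range N, x (2 * (i₀ + i)) with hy
  set z := ∑ i ∈ Finset.range N, x (2 * (i₀ + i) + 1) with hz
  rw [Finset.sum_sub_distrib, ← hy, ← hz] at hm
  have hyu : y ∈ tailSpan u 0 := Submodule.sum_mem _ fun i _ =>
    tailSpan_mono u (Nat.zero_le _) (hxu _)
  have hzv : z ∈ tailSpan v 0 := Submodule.sum_mem _ fun i _ =>
    tailSpan_mono v (Nat.zero_le _) (hxv _)
  have hadd : ‖ι y + ι z‖ ≤ 20 := by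
    rw [← map_add]
    have := norm_ι_le (x := y + z) (c := 20) fun n => by
      rw [sum_pairs_eq, map_sub]
      have h1 := C.abs_ev_sum_le (2 * (i₀ + N)) n
      have h2 := C.abs_ev_sum_le (2 * i₀) n
      exact (abs_sub _ _).trans (by linarith)
    simpa using this
  set T := ‖ι y - ι z‖ with hT
  have hTR : (R : ℝ) < T := by
    have h1 := abs_φ_le m (ι (y - z))
    rw [φ_ι, map_sub ι] at h1
    have h2 : (R : ℝ) < (ev m (y - z) : ℝ) := by exact_mod_cast hm
    exact h2.trans_le ((le_abs_self _).trans h1)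
  obtain ⟨c, hc1, hc2⟩ := exists_rat_btwn (show T / 2 + 10 < T / 2 + 11 by linarith)
  have hyc : ‖ι y‖ ≤ c := by
    have h1 : (2 : ℝ) • ι y = (ι y + ι z) + (ι y - ι z) := by rw [two_smul]; abel
    have h2 := norm_add_le (ι y + ι z) (ι y - ι z)
    rw [← h1, norm_smul, Real.norm_of_nonneg zero_le_two] at h2
    linarith
  have hzc : ‖ι z‖ ≤ c := by
    have h1 : (2 : ℝ) • ι z = (ι y + ι z) - (ι y - ι z) := by rw [two_smul]; abel
    have h2 := norm_sub_le (ι y + ι z) (ι y - ι z)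
    rw [← h1, norm_smul, Real.norm_of_nonneg zero_le_two] at h2
    linarith
  obtain ⟨f₁, hf₁, h1⟩ := A.exists_close hyu (ev_le_of_norm_ι_le hyc)
  obtain ⟨f₂, hf₂, h2⟩ := A'.exists_close hzv (ev_le_of_norm_ι_le hzc)
  rw [pow_zero, div_one] at h1 h2
  have h3 := hK f₁ hf₁ f₂ hf₂
  have h4 : ‖f₁ + f₂‖ ≤ 20 + 32 * c * e := by
    have h5 : f₁ + f₂ = (ι y + ι z) - (ι y - f₁) - (ι z - f₂) := by abel
    rw [h5]
    refine (norm_sub_le _ _).trans ((add_le_add (norm_sub_le _ _) le_rfl).trans ?_)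
    linarith
  have h5 : T ≤ ‖f₁ - f₂‖ + 32 * c * e := by
    have h6 : ι y - ι z = (f₁ - f₂) + (ι y - f₁) - (ι z - f₂) := by abel
    rw [hT, h6]
    refine (norm_sub_le _ _).trans ((add_le_add (norm_add_le _ _) le_rfl).trans ?_)
    linarith
  have h6 : 32 * c * e * (1 + K) = c := by rw [he]; field_simp
  have h7 : K * ‖f₁ + f₂‖ ≤ K * (20 + 32 * c * e) := by gcongr
  nlinarith

/-! ### Absence of reflexive subspaces -/

lemma eq_of_mapClusterPt_of_tendsto {f : ℕ → ℝ} {a b : ℝ} (h : MapClusterPt a atTop f)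
    (h' : Tendsto f atTop (𝓝 b)) : a = b := by
  have h1 : ClusterPt a (𝓝 b) := ClusterPt.mono h h'
  exact eq_of_nhds_neBot h1

/-- Bounded sequences of functionals have weak-star cluster points. -/
lemma exists_weakStar_limit {D : Type*} [NormedAddCommGroup D] [NormedSpace ℝ D]
    {ψ : ℕ → StrongDual ℝ D} {M : ℝ} (hψ : ∀ K, ‖ψ K‖ ≤ M) : ∃ Λ : StrongDual ℝ D, ∀ F b,
      Tendsto (fun K => ψ K F) atTop (𝓝 b) → Λ F = b := by
  obtain ⟨Λ, -, hΛ⟩ := (WeakDual.isCompact_closedBall (0 : StrongDual ℝ D) M).exists_mapClusterPt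
    (f := atTop) (u := fun K => StrongDual.toWeakDual (ψ K))
    (tendsto_principal.mpr (Filter.Eventually.of_forall fun K =>
      show ψ K ∈ Metric.closedBall (0 : StrongDual ℝ D) M by
        rw [Metric.mem_closedBall, dist_zero_right]; exact hψ K))
  refine ⟨WeakDual.toStrongDual Λ, fun F b hF => ?_⟩
  have h1 := hΛ.continuousAt_comp (WeakDual.eval_continuous F).continuousAt
  exact eq_of_mapClusterPt_of_tendsto h1 hF

/-- In a reflexive space bounded sequences have weak cluster points. -/
lemma exists_weak_limit {Y : Type*} [NormedAddCommGroup Y] [NormedSpace ℝ Y]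
    (hY : IsReflexiveSpace Y) {G : ℕ → Y} {M : ℝ}
    (hG : ∀ K, ‖G K‖ ≤ M) : ∃ y : Y, ∀ (F : StrongDual ℝ Y) (b : ℝ),
      Tendsto (fun K => F (G K)) atTop (𝓝 b) → F y = b := by
  obtain ⟨Λ, hΛ⟩ := exists_weakStar_limit
    (ψ := fun K => NormedSpace.inclusionInDoubleDual ℝ Y (G K))
    fun K => (NormedSpace.double_dual_bound ℝ Y (G K)).trans (hG K)
  obtain ⟨y, rfl⟩ := hY Λ
  exact ⟨y, fun F b hF => hΛ F b hF⟩

lemma co_sum_eq {x : ℕ → Vec} {η l : ℕ → ℕ} {δ : ℚ} (C : CodedSeq x η l δ) {i K K' : ℕ}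
    (hK : i < l K) (hK' : i < l K') :
    co i (ι (∑ k ∈ Finset.range K, x k)) = co i (ι (∑ k ∈ Finset.range K', x k)) := by
  have key : ∀ a b, i < l a → co i (ι (∑ k ∈ Finset.range (a + b), x k)) =
      co i (ι (∑ k ∈ Finset.range a, x k)) := fun a b ha => by
    rw [co_ι, co_ι, Finset.sum_range_add, Finsupp.add_apply,
      (C.isBlock.sum a b).apply_eq_zero (Or.inl ha), add_zero]
  rcases le_total K K' with h | h
  · obtain ⟨b, rfl⟩ := Nat.exists_eq_add_of_le h
    exact (key K b hK).symm
  · obtain ⟨b, rfl⟩ := Nat.exists_eq_add_of_le h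
    exact key K' b hK'

theorem noReflexiveSubspace : NoReflexiveSubspace X := by
  intro Y _ hYf hrefl
  obtain ⟨u, s, g, A⟩ := exists_approx hYf one_pos
  obtain ⟨x, η, l, δ, C, hxu, hxv⟩ := exists_codedSeq A.toNormBlock A.toNormBlock
  have hmem : ∀ k, x k ∈ tailSpan u k := fun k => by
    rcases Nat.even_or_odd' k with ⟨i, rfl | rfl⟩
    · exact hxu i
    · exact hxv i
  have hx2 : ∀ k m, |ev m (x k)| ≤ 2 := fun k m => by
    have := (C.exact (m + 1) k).ev_le_two (Nat.lt_succ_self m) (l k) (l (k + 1))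
    rwa [(C.supp k).res_eq le_rfl le_rfl] at this
  choose f hfY hf using fun k => A.exists_close (hmem k) (hx2 k)
  have hf' : ∀ k, ‖ι (x k) - f k‖ ≤ 32 * (1 / 2) ^ k := fun k => by
    refine (hf k).trans_eq ?_
    push_cast
    rw [one_div, inv_pow]
    ring
  have hsum : Summable fun k => ι (x k) - f k :=
    Summable.of_norm_bounded ((summable_geometric_of_lt_one (by norm_num)
      (by norm_num : (1 / 2 : ℝ) < 1)).mul_left 32) hf'
  set E := ∑' k, (ι (x k) - f k) with hE
  have hlim : Tendsto (fun K => ∑ k ∈ Finset.range K, (ι (x k) - f k)) atTop (𝓝 E) :=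
    hsum.hasSum.tendsto_sum_nat
  set σ : ℕ → Vec := fun K => ∑ k ∈ Finset.range K, x k with hσ
  let G : ℕ → Y := fun K => ∑ k ∈ Finset.range K, ⟨f k, hfY k⟩
  have hGX : ∀ K, (G K : X) = ι (σ K) - ∑ k ∈ Finset.range K, (ι (x k) - f k) := fun K => by
    rw [Finset.sum_sub_distrib, hσ, map_sum, sub_sub_cancel]
    simp [G]
  obtain ⟨M, hM⟩ := hlim.norm.bddAbove_range
  have hG : ∀ K, ‖G K‖ ≤ 10 + M := fun K => by
    have h1 : ‖ι (σ K)‖ ≤ 10 := by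
      exact_mod_cast norm_ι_le (C.abs_ev_sum_le K)
    have h2 := hM ⟨K, rfl⟩
    change ‖(G K : X)‖ ≤ _
    rw [hGX]
    exact (norm_sub_le _ _).trans (add_le_add h1 h2)
  obtain ⟨y, hy⟩ := exists_weak_limit hrefl hG
  have hco : ∀ i K, i < l K → co i ((y : X) + E) = co i (ι (σ K)) := fun i K hi => by
    have h1 := hy ((co i).comp Y.subtypeL) (co i (ι (σ K)) - co i E) (by
      have h2 : Tendsto (fun N => co i (ι (σ K)) - co i (∑ k ∈ Finset.range N, (ι (x k) - f k)))
          atTop (𝓝 (co i (ι (σ K)) - co i E)) :=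
        tendsto_const_nhds.sub (((co i).continuous.tendsto E).comp hlim)
      refine h2.congr' ?_
      filter_upwards [eventually_ge_atTop i] with N hN
      change _ = co i (G N : X)
      rw [hGX, map_sub, co_sum_eq C hi (hN.trans_lt (C.lt N))])
    have h2 : co i (y : X) = co i (ι (σ K)) - co i E := h1
    rw [map_add, h2, sub_add_cancel]
  have hproj : ∀ K, proj (l K) ((y : X) + E) = ι (σ K) := fun K => by
    have hs : SuppIn 0 (l K) (σ K) := by
      have := C.isBlock.sum 0 K
      simp only [zero_add] at this
      exact this.mono (Nat.zero_le _) le_rfl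
    rw [← hs.res_eq le_rfl le_rfl, ← proj_ι, proj_apply, proj_apply]
    exact Finset.sum_congr rfl fun i hi => by rw [hco i K (Finset.mem_range.mp hi)]
  have hσlim : Tendsto (fun K => ι (σ K)) atTop (𝓝 ((y : X) + E)) :=
    ((tendsto_proj ((y : X) + E)).comp C.strict.tendsto_atTop).congr hproj
  have hzero : Tendsto (fun K => ‖ι (σ (K + 1)) - ι (σ K)‖) atTop (𝓝 0) := by
    have := ((hσlim.comp (tendsto_add_atTop_nat 1)).sub hσlim).norm
    simpa using this
  have hδ : (0 : ℝ) < δ := by exact_mod_cast C.pos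
  obtain ⟨K, hK⟩ := (hzero.eventually (gt_mem_nhds hδ)).exists
  have h1 : ι (σ (K + 1)) - ι (σ K) = ι (x K) := by
    rw [← map_sub, hσ]
    simp only [Finset.sum_range_succ]
    rw [add_sub_cancel_left]
  rw [h1] at hK
  have h2 := (le_abs_self _).trans (abs_φ_le (η K) (ι (x K)))
  rw [φ_ι] at h2
  have h3 : (δ : ℝ) ≤ (ev (η K) (x K) : ℝ) := by exact_mod_cast C.ge K
  linarith

/-! ### The subspace of the base nodes -/

/-- The vectors whose coordinates at the nodes of positive weight vanish. -/
def baseSpace : Submodule ℝ X where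
  carrier := {f | ∀ k, wt k ≠ 0 → co k f = 0}
  zero_mem' := fun k _ => map_zero _
  add_mem' hf hg := fun k hk => by rw [map_add, hf k hk, hg k hk, add_zero]
  smul_mem' c f hf := fun k hk => by rw [map_smul, hf k hk, smul_zero]

lemma isClosed_baseSpace : IsClosed (baseSpace : Set X) := by
  have : (baseSpace : Set X) = ⋂ k, ⋂ (_ : wt k ≠ 0), {f | co k f = 0} := by
    ext f; simp [baseSpace]
  rw [this]
  exact isClosed_iInter fun k => isClosed_iInter fun _ =>
    isClosed_eq (co k).continuous continuous_const

lemma exists_wt_eq_zero (n : ℕ) : ∃ k, n ≤ k ∧ wt k = 0 := by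
  obtain ⟨k, hk, hd⟩ := exists_dataSeq_eq (0, none, (0, 0, 0, 0), (0, 0, 0, 0)) n
  refine ⟨k, hk, ?_⟩
  have h1 := nodes_eq k
  rw [step, hd, if_neg (fun hl => absurd hl.pos (by simp))] at h1
  simp only [wt]
  rw [h1]
  rfl

lemma not_finiteDimensional_baseSpace : ¬ FiniteDimensional ℝ baseSpace := by
  intro hfd
  let v : {k // wt k = 0} → baseSpace := fun k => ⟨bas k, fun i hi => by
    rw [co_bas, if_neg]
    rintro rfl
    exact hi k.2⟩
  have hv : LinearIndependent ℝ v := by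
    refine LinearIndependent.of_comp baseSpace.subtype ?_
    exact linearIndependent_bas.comp _ Subtype.val_injective
  have hfin : Finite {k // wt k = 0} := hv.finite
  have hinf : Set.Infinite {k | wt k = 0} := Set.infinite_of_not_bddAbove fun ⟨b, hb⟩ => by
    obtain ⟨k, hk, hk0⟩ := exists_wt_eq_zero (b + 1)
    have := hb hk0
    omega
  exact hinf hfin

theorem not_finiteDimensional : ¬ FiniteDimensional ℝ X := fun _ =>
  not_finiteDimensional_baseSpace inferInstance

end BDSpace

namespace BDSpace

open Filter Topology

/-! ### Random signs -/

/-- The signed sum with signs given by `P`. -/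
def signSum (S P : Finset ℕ) (c : ℕ → ℝ) : ℝ := ∑ i ∈ S, (sgn P i : ℝ) * c i

lemma sum_powerset_insert_signSum {S : Finset ℕ} {a : ℕ} (ha : a ∉ S) (c : ℕ → ℝ) (F : ℝ → ℝ) :
    ∑ P ∈ (insert a S).powerset, F (signSum (insert a S) P c) =
      ∑ P ∈ S.powerset, (F (c a + signSum S P c) + F (-c a + signSum S P c)) := by
  rw [Finset.sum_powerset_insert ha, ← Finset.sum_add_distrib]
  refine Finset.sum_congr rfl fun P hP => ?_
  have haP : a ∉ P := fun h => ha (Finset.mem_powerset.mp hP h)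
  have h1 : signSum (insert a S) P c = c a + signSum S P c := by
    rw [signSum, Finset.sum_insert ha, sgn, if_neg haP]
    simp [signSum]
  have h2 : signSum (insert a S) (insert a P) c = -c a + signSum S P c := by
    rw [signSum, Finset.sum_insert ha, sgn, if_pos (Finset.mem_insert_self _ _)]
    congr 1
    · simp
    · refine Finset.sum_congr rfl fun i hi => ?_
      have hne : i ≠ a := fun h => ha (h ▸ hi)
      simp [sgn, Finset.mem_insert, hne]
  rw [h1, h2]

lemma sum_signSum_sq (S : Finset ℕ) (c : ℕ → ℝ) :
    ∑ P ∈ S.powerset, signSum S P c ^ 2 = 2 ^ S.card * ∑ i ∈ S, c i ^ 2 := by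
  induction S using Finset.induction_on with
  | empty => simp [signSum]
  | insert a S ha ih =>
    rw [sum_powerset_insert_signSum ha c (fun t => t ^ 2), Finset.sum_insert ha,
      Finset.card_insert_of_notMem ha]
    have : ∀ P, (c a + signSum S P c) ^ 2 + (-c a + signSum S P c) ^ 2 =
        2 * signSum S P c ^ 2 + 2 * c a ^ 2 := fun P => by ring
    simp only [this]
    rw [Finset.sum_add_distrib, ← Finset.mul_sum, ih, Finset.sum_const, Finset.card_powerset,
      nsmul_eq_mul]
    push_cast
    ring

lemma sum_signSum_pow_four_le (S : Finset ℕ) (c : ℕ → ℝ) :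
    ∑ P ∈ S.powerset, signSum S P c ^ 4 ≤ 2 ^ S.card * (3 * (∑ i ∈ S, c i ^ 2) ^ 2) := by
  induction S using Finset.induction_on with
  | empty => simp [signSum]
  | insert a S ha ih =>
    rw [sum_powerset_insert_signSum ha c (fun t => t ^ 4), Finset.sum_insert ha,
      Finset.card_insert_of_notMem ha]
    have : ∀ P, (c a + signSum S P c) ^ 4 + (-c a + signSum S P c) ^ 4 =
        2 * signSum S P c ^ 4 + 12 * c a ^ 2 * signSum S P c ^ 2 + 2 * c a ^ 4 := fun P => by ring
    simp only [this]
    rw [Finset.sum_add_distrib, Finset.sum_add_distrib, ← Finset.mul_sum, ← Finset.mul_sum,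
      sum_signSum_sq, Finset.sum_const, Finset.card_powerset, nsmul_eq_mul, pow_succ (2 : ℝ)]
    push_cast
    have h1 : 0 ≤ (2 : ℝ) ^ S.card * c a ^ 4 := by positivity
    nlinarith

/-- The lower Khintchine inequality. -/
lemma le_sum_abs_signSum (S : Finset ℕ) (c : ℕ → ℝ) :
    2 ^ S.card * (√(∑ i ∈ S, c i ^ 2) / 4) ≤ ∑ P ∈ S.powerset, |signSum S P c| := by
  set V := ∑ i ∈ S, c i ^ 2 with hV
  have hV0 : 0 ≤ V := Finset.sum_nonneg fun i _ => sq_nonneg _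
  set t := √V with ht
  have ht0 : 0 ≤ t := Real.sqrt_nonneg _
  have htV : t ^ 2 = V := Real.sq_sqrt hV0
  rcases ht0.eq_or_lt with h0 | hpos
  · rw [← h0, zero_div, mul_zero]
    exact Finset.sum_nonneg fun P _ => abs_nonneg _
  have hpt : ∀ a : ℝ, 4 * t ^ 2 * a ^ 2 - a ^ 4 ≤ 4 * t ^ 3 * |a| := fun a => by
    have e1 : a ^ 2 = |a| ^ 2 := (sq_abs a).symm
    have e2 : a ^ 4 = |a| ^ 4 := by rw [show (4 : ℕ) = 2 * 2 by norm_num, pow_mul, pow_mul, e1]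
    rw [e1, e2]
    have hb : 0 ≤ |a| := abs_nonneg a
    set b := |a|
    have h1 : 0 ≤ b * (b * (b - t) ^ 2) := by positivity
    have h2 : 0 ≤ b * (t * (2 * (b - 5 / 4 * t) ^ 2 + 7 / 8 * t ^ 2)) := by positivity
    nlinarith
  have h1 := Finset.sum_le_sum fun P (_ : P ∈ S.powerset) => hpt (signSum S P c)
  rw [Finset.sum_sub_distrib, ← Finset.mul_sum, ← Finset.mul_sum, sum_signSum_sq] at h1
  have h2 := sum_signSum_pow_four_le S c
  rw [← hV, ← htV] at h1 h2
  have h3 : 4 * t ^ 3 * (2 ^ S.card * (t / 4)) ≤ 4 * t ^ 3 * ∑ P ∈ S.powerset, |signSum S P c| := by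
    nlinarith
  exact le_of_mul_le_mul_left h3 (by positivity)

/-- The dual of a finite-dimensional space with the supremum norm has cotype two. -/
lemma sqrt_card_mul_le {d : ℕ} {S : Finset ℕ} {β : ℕ → Fin d → ℝ} {M θ : ℝ}
    (hM : ∀ P, ∑ r, |signSum S P fun i => β i r| ≤ M) (hθ : ∀ i ∈ S, θ ≤ ∑ r, |β i r|) :
    √S.card * θ ≤ 4 * M := by
  rcases S.eq_empty_or_nonempty with rfl | hne
  · have := (Finset.sum_nonneg fun r _ => abs_nonneg _).trans (hM ∅)
    simpa using this
  have hcard : (0 : ℝ) < S.card := by exact_mod_cast hne.card_pos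
  have hs : 0 < √(S.card : ℝ) := Real.sqrt_pos.mpr hcard
  have h1 : ∀ r, (∑ i ∈ S, |β i r|) / √S.card ≤ √(∑ i ∈ S, β i r ^ 2) := fun r => by
    rw [div_le_iff₀ hs, ← Real.sqrt_mul (Finset.sum_nonneg fun i _ => sq_nonneg _)]
    refine Real.le_sqrt_of_sq_le ?_
    have := sq_sum_le_card_mul_sum_sq (s := S) (f := fun i => |β i r|)
    simp only [sq_abs] at this
    linarith
  have h2 : ∑ P ∈ S.powerset, ∑ r, |signSum S P fun i => β i r| ≤ 2 ^ S.card * M := by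
    refine (Finset.sum_le_card_nsmul _ _ M fun P _ => hM P).trans_eq ?_
    rw [Finset.card_powerset, nsmul_eq_mul]
    push_cast
    ring
  rw [Finset.sum_comm] at h2
  have h3 : ∑ r, 2 ^ S.card * ((∑ i ∈ S, |β i r|) / √S.card / 4) ≤ 2 ^ S.card * M := by
    refine le_trans (Finset.sum_le_sum fun r _ => ?_) h2
    refine le_trans ?_ (le_sum_abs_signSum S fun i => β i r)
    have := h1 r
    gcongr
  rw [← Finset.mul_sum, ← Finset.sum_div, ← Finset.sum_div, Finset.sum_comm] at h3
  have h4 := le_of_mul_le_mul_left h3 (by positivity)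
  have h5 : (S.card : ℝ) * θ ≤ ∑ i ∈ S, ∑ r, |β i r| := by
    rw [← nsmul_eq_mul]; exact Finset.card_nsmul_le_sum _ _ _ hθ
  have h6 : √(S.card : ℝ) * θ = (S.card : ℝ) * θ / √S.card := by
    rw [eq_div_iff hs.ne', mul_right_comm, Real.mul_self_sqrt hcard.le]
  rw [h6]
  have h7 : (S.card : ℝ) * θ / √S.card ≤ (∑ i ∈ S, ∑ r, |β i r|) / √S.card := by gcongr
  linarith

/-! ### Functionals on the space -/

/-- The functional of a component. -/
def compFun (c : Comp) : X →L[ℝ] ℝ :=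
  (c.coef : ℝ) • (φ c.node).comp (proj (max c.lo c.hi) - proj c.lo)

lemma compFun_apply (c : Comp) (f : X) :
    compFun c f = c.coef * φ c.node (proj (max c.lo c.hi) f - proj c.lo f) := rfl

lemma compFun_ι (c : Comp) (x : Vec) : compFun c (ι x) = (cev c x : ℝ) := by
  have h : res c.lo c.hi x = res 0 (max c.lo c.hi) x - res 0 c.lo x := by
    rcases le_total c.lo c.hi with h | h
    · rw [max_eq_right h, res_sub h]
    · rw [max_eq_left h, sub_self, res_eq_zero_of_le h]
  rw [compFun_apply, proj_ι, proj_ι, ← map_sub, ← h, φ_ι, cev_apply, Rat.cast_mul]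

lemma abs_compFun_le (c : Comp) (f : X) : |compFun c f| ≤ |(c.coef : ℝ)| * (4 * ‖f‖) := by
  rw [compFun_apply, abs_mul]
  gcongr
  refine (abs_φ_le _ _).trans ((norm_sub_le _ _).trans ?_)
  have h1 := norm_proj_apply_le (max c.lo c.hi) f
  have h2 := norm_proj_apply_le c.lo f
  linarith

/-- The functional of two components. -/
def blockFun (B : Comp × Comp) : X →L[ℝ] ℝ := compFun B.1 + compFun B.2

lemma blockFun_apply (B : Comp × Comp) (f : X) : blockFun B f = compFun B.1 f + compFun B.2 f := rfl

lemma blockFun_ι (B : Comp × Comp) (x : Vec) : blockFun B (ι x) = (bev B x : ℝ) := by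
  rw [blockFun_apply, compFun_ι, compFun_ι, bev_apply, Rat.cast_add]

lemma abs_blockFun_le {B : Comp × Comp} (hB : |B.1.coef| + |B.2.coef| ≤ 1) (f : X) :
    |blockFun B f| ≤ 4 * ‖f‖ := by
  rw [blockFun_apply]
  refine (abs_add_le _ _).trans ((add_le_add (abs_compFun_le _ _) (abs_compFun_le _ _)).trans ?_)
  rw [← add_mul]
  refine mul_le_of_le_one_left (by positivity) ?_
  rw [← Rat.cast_abs, ← Rat.cast_abs]
  exact_mod_cast hB

/-- On the space of the base nodes, the signed sums of the functionals of a good sequence are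
uniformly bounded. -/
lemma GoodSeq.exists_signSum_le {y : ℕ → Vec} {B : ℕ → Comp × Comp} {l h : ℕ → ℕ} {δ : ℚ}
    (G : GoodSeq y B l h δ) {j : ℕ} (hj : 1 ≤ j) (i₀ : ℕ) : ∃ S : Finset ℕ, S.card = ageBound j ∧
      (∀ i ∈ S, i₀ ≤ i) ∧ ∀ P, ∀ f ∈ baseSpace,
        |signSum S P fun i => blockFun (B i) f| ≤ mw j * ‖f‖ := by
  obtain ⟨S, hS, hSi, hR⟩ := G.exists_signed_nodes hj i₀ (ageBound_pos j) le_rfl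
  refine ⟨S, hS, hSi, fun P f hf => ?_⟩
  obtain ⟨Q, n, -, -, hQ, he⟩ := hR P
  have key : φ n f = ∑ k ∈ Q, co k f +
      1 / (mw j : ℝ) * signSum S P fun i => blockFun (B i) f := by
    refine denseRange_ι.induction_on (p := fun f => φ n f = ∑ k ∈ Q, co k f +
      1 / (mw j : ℝ) * signSum S P fun i => blockFun (B i) f) f ?_ fun x => ?_
    · refine isClosed_eq (φ n).continuous (Continuous.add (by fun_prop) (Continuous.mul
        continuous_const ?_))
      unfold signSum
      fun_prop
    · rw [φ_ι, he]
      simp only [co_ι, blockFun_ι, signSum]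
      push_cast
      rfl
  have h0 : ∑ k ∈ Q, co k f = 0 := Finset.sum_eq_zero fun k hk =>
    hf k (by rw [(hQ k hk).1]; omega)
  have hm : (0 : ℝ) < mw j := by exact_mod_cast mw_pos j
  rw [h0, zero_add] at key
  have h1 : (signSum S P fun i => blockFun (B i) f) = mw j * φ n f := by
    rw [key]; field_simp
  rw [h1, abs_mul, abs_of_pos hm]
  have := abs_φ_le n f
  gcongr

lemma mw_sq_le_sqrt {j : ℕ} (hj : 1 ≤ j) : (mw j : ℝ) ^ 2 ≤ √(ageBound j : ℝ) := by
  refine Real.le_sqrt_of_sq_le ?_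
  obtain ⟨i, rfl⟩ : ∃ i, j = i + 1 := ⟨j - 1, by omega⟩
  rw [← pow_mul]
  have h1 : mw (i + 1) ≤ i + 1 + mw (i + 1) * (2 * ageBound i + 2) := by nlinarith
  have h2 : mw (i + 1) ^ (2 * 2) ≤ ageBound (i + 1) := by
    rw [ageBound_succ]
    have := four_le_mw (i + 1)
    exact (Nat.pow_le_pow_left h1 _).trans (Nat.pow_le_pow_right (by omega) (by omega))
  exact_mod_cast h2

/-- Functionals on a space isomorphic to a finite-dimensional space with the supremum norm. -/
lemma sqrt_card_mul_le_of_equiv {E : Type*} [NormedAddCommGroup E] [NormedSpace ℝ E] {d : ℕ}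
    (T : E ≃L[ℝ] (Fin d → ℝ)) {C : ℝ}
    (hT : ‖(T : E →L[ℝ] (Fin d → ℝ))‖ * ‖(T.symm : (Fin d → ℝ) →L[ℝ] E)‖ ≤ C)
    {S : Finset ℕ} {b : ℕ → E →L[ℝ] ℝ} {f : ℕ → E} {M θ R : ℝ} (hM0 : 0 ≤ M) (hR0 : 0 ≤ R)
    (hM : ∀ P f, |signSum S P fun i => b i f| ≤ M * ‖f‖) (hf : ∀ i ∈ S, ‖f i‖ ≤ R)
    (hb : ∀ i ∈ S, θ ≤ b i (f i)) : √S.card * θ ≤ 4 * M * (R * C) := by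
  set t := ‖(T : E →L[ℝ] (Fin d → ℝ))‖ with ht
  set t' := ‖(T.symm : (Fin d → ℝ) →L[ℝ] E)‖ with ht'
  have ht0 : 0 ≤ t := norm_nonneg _
  have ht'0 : 0 ≤ t' := norm_nonneg _
  set β : ℕ → Fin d → ℝ := fun i r => b i (T.symm (Pi.single r 1)) with hβ
  have hexp : ∀ i v, b i (T.symm v) = ∑ r, v r * β i r := fun i v => by
    conv_lhs => rw [show v = ∑ r, v r • (Pi.single r 1 : Fin d → ℝ) by
      ext k; simp [Finset.sum_apply, Pi.single_apply]]
    simp [map_sum, hβ]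
  have h1 : ∀ P, ∑ r, |signSum S P fun i => β i r| ≤ M * t' := fun P => by
    set v : Fin d → ℝ := fun r => SignType.sign (signSum S P fun i => β i r) with hv
    have hv1 : ‖v‖ ≤ 1 := (pi_norm_le_iff_of_nonneg zero_le_one).mpr fun r => by
      rw [Real.norm_eq_abs, hv]
      rcases lt_trichotomy (signSum S P fun i => β i r) 0 with h | h | h
      · simp [h]
      · simp [h]
      · simp [h]
    have e1 : (signSum S P fun i => b i (T.symm v)) = ∑ r, |signSum S P fun i => β i r| := by
      simp only [hexp, signSum, Finset.mul_sum]
      rw [Finset.sum_comm]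
      refine Finset.sum_congr rfl fun r _ => ?_
      have e2 : |signSum S P fun i => β i r| = v r * signSum S P fun i => β i r :=
        (sign_mul_self _).symm
      rw [signSum] at e2
      rw [e2, Finset.mul_sum]
      exact Finset.sum_congr rfl fun i _ => by ring
    rw [← e1]
    refine (le_abs_self _).trans ((hM P _).trans ?_)
    have e3 : ‖T.symm v‖ ≤ t' * 1 :=
      ((T.symm : (Fin d → ℝ) →L[ℝ] E).le_opNorm v).trans (by gcongr)
    rw [mul_one] at e3
    gcongr
  have h2 : ∀ i ∈ S, θ ≤ (t * R) * ∑ r, |β i r| := fun i hi => by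
    refine (hb i hi).trans ?_
    have e1 : b i (f i) = ∑ r, T (f i) r * β i r := by
      rw [← hexp, T.symm_apply_apply]
    have e2 : ‖T (f i)‖ ≤ t * R :=
      ((T : E →L[ℝ] (Fin d → ℝ)).le_opNorm (f i)).trans (by gcongr; exact hf i hi)
    rw [e1, Finset.mul_sum]
    refine Finset.sum_le_sum fun r _ => (le_abs_self _).trans ?_
    rw [abs_mul]
    have e3 : |T (f i) r| ≤ t * R := (norm_le_pi_norm (T (f i)) r).trans e2
    gcongr
  have h3 := sqrt_card_mul_le (S := S) (β := fun i r => (t * R) * β i r) (M := (t * R) * (M * t'))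
    (θ := θ) (fun P => ?_) (fun i hi => ?_)
  · refine h3.trans ?_
    calc 4 * (t * R * (M * t')) = 4 * M * (R * (t * t')) := by ring
      _ ≤ _ := by gcongr
  · have e1 : ∀ r, |signSum S P fun i => (t * R) * β i r| =
        (t * R) * |signSum S P fun i => β i r| := fun r => by
      rw [← abs_of_nonneg (show 0 ≤ t * R by positivity), ← abs_mul, signSum, signSum,
        Finset.mul_sum, abs_of_nonneg (show 0 ≤ t * R by positivity)]
      congr 1
      exact Finset.sum_congr rfl fun i _ => by ring
    simp only [e1]
    rw [← Finset.mul_sum]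
    exact mul_le_mul_of_nonneg_left (h1 P) (by positivity)
  · refine (h2 i hi).trans_eq ?_
    rw [Finset.mul_sum]
    exact Finset.sum_congr rfl fun r _ => by
      rw [abs_mul, abs_of_nonneg (show 0 ≤ t * R by positivity)]

lemma exists_subspace_approx {E : Type*} [NormedAddCommGroup E] [NormedSpace ℝ E]
    {F : ℕ → Submodule ℝ E} (hF : Monotone F) (hd : Dense (⋃ n, (F n : Set E))) (S : Finset ℕ)
    (g : ℕ → E) {e : ℝ} (he : 0 < e) : ∃ n, ∀ i ∈ S, ∃ f ∈ F n, ‖g i - f‖ ≤ e := by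
  have h1 : ∀ i, ∃ n, ∃ f ∈ F n, ‖g i - f‖ ≤ e := fun i => by
    obtain ⟨f, hf, hdist⟩ := Metric.mem_closure_iff.mp (hd (g i)) e he
    obtain ⟨n, hn⟩ := Set.mem_iUnion.mp hf
    exact ⟨n, f, hn, by rw [← dist_eq_norm]; exact hdist.le⟩
  choose n f hf hfg using h1
  exact ⟨S.sup n, fun i hi => ⟨f i, hF (Finset.le_sup hi) (hf i), hfg i⟩⟩

theorem not_isLinftySpace_of_le_baseSpace {W : Submodule ℝ X} (hW : W ≤ baseSpace)
    (hWf : ¬ FiniteDimensional ℝ W) : ¬ IsLinftySpace W := by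
  rintro ⟨C, hC1, F, hFmono, -, hFdense, hFT⟩
  obtain ⟨u, s, g, A⟩ := exists_approx hWf one_pos
  obtain ⟨κ, B, l, h, hκ, δ, G⟩ := A.toIsBlock.exists_goodSeq A.strict A.half_lt
  have hδ : (0 : ℝ) < δ := by exact_mod_cast G.pos
  obtain ⟨i₀, hi₀⟩ := exists_pow_lt_of_lt_one (show 0 < (δ : ℝ) / 16 by positivity)
    (by norm_num : (1 / 2 : ℝ) < 1)
  obtain ⟨c, hc⟩ := exists_nat_gt (32 * C / δ)
  set j := c + 1 with hj
  obtain ⟨S, hS, hSi, hSM⟩ := G.exists_signSum_le (j := j) (by omega) i₀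
  let gW : ℕ → W := fun i => ⟨g (κ i), A.mem _⟩
  obtain ⟨n, hn⟩ := exists_subspace_approx hFmono hFdense S gW
    (show 0 < min 1 ((δ : ℝ) / 16) by positivity)
  obtain ⟨T, hT⟩ := hFT n
  have hn' : ∀ i, ∃ f : F n, i ∈ S → ‖gW i - f‖ ≤ min 1 ((δ : ℝ) / 16) := fun i => by
    by_cases hi : i ∈ S
    · obtain ⟨f, hf, hfg⟩ := hn i hi
      exact ⟨⟨f, hf⟩, fun _ => hfg⟩
    · exact ⟨0, fun h => absurd h hi⟩
  choose f hf using hn'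
  let b : ℕ → F n →L[ℝ] ℝ := fun i => (blockFun (B i)).comp (W.subtypeL.comp (F n).subtypeL)
  have hm : (0 : ℝ) < mw j := by exact_mod_cast mw_pos j
  have hclose : ∀ i, ‖ι (u (κ i)) - g (κ i)‖ ≤ (1 / 2) ^ i := fun i => by
    refine (A.close (κ i)).trans ?_
    rw [one_div, one_div, inv_pow]
    have hi : i ≤ κ i := hκ.id_le i
    gcongr
    · norm_num
  have hmain := sqrt_card_mul_le_of_equiv T hT (S := S) (b := b) (f := f) (M := mw j)
    (θ := (δ : ℝ) / 2) (R := 3) hm.le (by norm_num) (fun P f => hSM P _ (hW f.1.2))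
    (fun i hi => ?_) (fun i hi => ?_)
  · rw [hS] at hmain
    have h1 := mw_sq_le_sqrt (j := j) (by omega)
    have h2 : (mw j : ℝ) ^ 2 * (δ / 2) ≤ 4 * mw j * (3 * C) :=
      (mul_le_mul_of_nonneg_right h1 (by positivity)).trans hmain
    have h3 : (mw j : ℝ) * δ ≤ 24 * C := by
      have : (mw j : ℝ) * (mw j * δ) ≤ mw j * (24 * C) := by nlinarith
      exact le_of_mul_le_mul_left this hm
    have h4 : (c : ℝ) < mw j := by exact_mod_cast (show c < mw j by have := lt_mw j; omega)
    rw [div_lt_iff₀ hδ] at hc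
    nlinarith
  · have h1 : ‖gW i - f i‖ ≤ 1 := (hf i hi).trans (min_le_left _ _)
    have h2 : ‖gW i‖ ≤ 2 := by
      change ‖g (κ i)‖ ≤ 2
      have h3 : ‖ι (u (κ i))‖ ≤ 1 := by
        exact_mod_cast norm_ι_le (c := 1) (A.le_one (κ i))
      have h4 := norm_le_norm_add_norm_sub' (g (κ i)) (ι (u (κ i)))
      have h5 := hclose i
      rw [norm_sub_rev] at h5
      have h6 : ((1 : ℝ) / 2) ^ i ≤ 1 := pow_le_one₀ (by norm_num) (by norm_num)
      linarith
    have h3 := norm_le_norm_add_norm_sub' ((f i : F n) : W) (gW i)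
    rw [norm_sub_rev] at h3
    change ‖((f i : F n) : W)‖ ≤ 3
    linarith
  · change (δ : ℝ) / 2 ≤ blockFun (B i) ((f i : W) : X)
    have h1 : ‖g (κ i) - ((f i : W) : X)‖ ≤ δ / 16 := (hf i hi).trans (min_le_right _ _)
    have h2 : ‖ι (u (κ i)) - g (κ i)‖ ≤ δ / 16 := by
      refine (hclose i).trans (le_trans ?_ hi₀.le)
      exact pow_le_pow_of_le_one (by norm_num) (by norm_num) (hSi i hi)
    have h3 : (δ : ℝ) ≤ blockFun (B i) (ι (u (κ i))) := by
      rw [blockFun_ι]; exact_mod_cast G.apply_ge i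
    have h4 := (le_abs_self _).trans (abs_blockFun_le (G.coef i) (ι (u (κ i)) - g (κ i)))
    have h5 := (le_abs_self _).trans (abs_blockFun_le (G.coef i) (g (κ i) - ((f i : W) : X)))
    rw [map_sub] at h4 h5
    linarith

end BDSpace

/-- **Statement 13.** There exists an infinite-dimensional separable Banach space which is
an `L∞`-space, hereditarily indecomposable, contains no infinite-dimensional reflexive
closed subspace, and is not `L∞`-saturated: it has an infinite-dimensional closed subspace
`W` such that no infinite-dimensional closed subspace of `W` is an `L∞`-space. -/
theorem exists_Linfty_HI_not_Linfty_saturated :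
    ∃ (X : Type) (_ : NormedAddCommGroup X) (_ : NormedSpace ℝ X) (_ : CompleteSpace X),
      ¬FiniteDimensional ℝ X ∧ TopologicalSpace.SeparableSpace X ∧
      IsLinftySpace X ∧ HereditarilyIndecomposable X ∧ NoReflexiveSubspace X ∧
      ∃ W : Submodule ℝ X, IsClosed (W : Set X) ∧ ¬FiniteDimensional ℝ ↥W ∧
        ∀ W' : Submodule ℝ X, W' ≤ W → IsClosed (W' : Set X) →
          ¬FiniteDimensional ℝ ↥W' → ¬IsLinftySpace ↥W' :=
  ⟨BDSpace.X, inferInstance, inferInstance, inferInstance, BDSpace.not_finiteDimensional,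
    inferInstance, BDSpace.isLinftySpace, BDSpace.hereditarilyIndecomposable,
    BDSpace.noReflexiveSubspace, BDSpace.baseSpace, BDSpace.isClosed_baseSpace,
    BDSpace.not_finiteDimensional_baseSpace, fun _ hW _ hWf =>
      BDSpace.not_isLinftySpace_of_le_baseSpace hW hWf⟩
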